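/- arXiv:1207.1267 — 2 statements merged into one kernel-verified Lean document; each statement's English description precedes it below -/
import Mathlib

section
/- Let α : ℝ → ℝ have bounded variation on each compact subset of ℝ and satisfy |α(x)|² ≤ C(1+|x|²) for all x ∈ ℝ and some constant C > 0. Then for each x ∈ ℝ there exists a unique strong solution (φ_t(x))_{t≥0} of the SDE dφ_t(x) = α(φ_t(x))dt + dw(t), φ_0(x) = x. -/
open MeasureTheory ProbabilityTheory Filter Set

noncomputable section

/-- The σ-algebra generated by the process `w` up to time `t` (natural filtration). -/
def natSigma {Ω : Type*} [MeasurableSpace Ω] (w : ℝ → Ω → ℝ) (t : ℝ) : MeasurableSpace Ω :=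
  ⨆ s ∈ Set.Icc (0:ℝ) t, MeasurableSpace.comap (w s) inferInstance

/-- `w` is a one-dimensional Wiener process (Brownian motion) on `[0,∞)`:
continuous paths started at `0`, Gaussian increments `w t - w s ~ N(0, t-s)`,
and increments independent of the past. -/
structure IsWiener {Ω : Type*} [MeasureSpace Ω] (w : ℝ → Ω → ℝ) : Prop where
  isProb : IsProbabilityMeasure (ℙ : Measure Ω)
  meas : ∀ t : ℝ, Measurable (w t)
  init : ∀ᵐ ω ∂(ℙ : Measure Ω), w 0 ω = 0
  cont : ∀ᵐ ω ∂(ℙ : Measure Ω), Continuous fun t => w t ω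
  gauss : ∀ s t : ℝ, 0 ≤ s → s ≤ t →
    Measure.map (fun ω => w t ω - w s ω) ℙ = gaussianReal 0 ((t - s).toNNReal)
  indep : ∀ s t : ℝ, 0 ≤ s → s ≤ t →
    Indep (MeasurableSpace.comap (fun ω => w t ω - w s ω) inferInstance) (natSigma w s) ℙ

/-- `φ` is a strong solution of the SDE `dφ_t = α(φ_t) dt + dw(t)`, `φ_0 = x`:
it is adapted to the natural filtration of `w`, has continuous paths, and satisfies
the corresponding integral equation `φ_t = x + ∫_0^t α(φ_s) ds + w_t`. -/
structure IsStrongSolution {Ω : Type*} [MeasureSpace Ω] (α : ℝ → ℝ) (w : ℝ → Ω → ℝ)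
    (x : ℝ) (φ : ℝ → Ω → ℝ) : Prop where
  adapted : ∀ t : ℝ, 0 ≤ t → @Measurable Ω ℝ (natSigma w t) _ (φ t)
  init : ∀ ω, φ 0 ω = x
  cont : ∀ᵐ ω ∂(ℙ : Measure Ω), ContinuousOn (fun t => φ t ω) (Set.Ici 0)
  sde : ∀ᵐ ω ∂(ℙ : Measure Ω), ∀ t : ℝ, 0 ≤ t →
    φ t ω = x + (∫ s in (0:ℝ)..t, α (φ s ω)) + w t ω

/-- `L` is the local time of the path `X` at level `y` up to time `t`:
`L = lim_{ε↓0} (1/ε) ∫_0^t 1_{[y,y+ε)}(X_s) ds`. -/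
def IsLocalTime (X : ℝ → ℝ) (y t L : ℝ) : Prop :=
  Filter.Tendsto
    (fun ε : ℝ => (1/ε) * ∫ s in (0:ℝ)..t,
      Set.indicator (Set.Ico y (y + ε)) (fun _ => (1:ℝ)) (X s))
    (nhdsWithin 0 (Set.Ioi 0)) (nhds L)

/-- Condition (A): `α` has bounded variation on each compact subset of `ℝ`. -/
def CondA (α : ℝ → ℝ) : Prop := ∀ a b : ℝ, BoundedVariationOn α (Set.Icc a b)

/-- Condition (B): linear growth, `|α x|² ≤ C (1 + |x|²)` for some `C > 0`. -/
def CondB (α : ℝ → ℝ) : Prop := ∃ C > 0, ∀ x : ℝ, |α x| ^ 2 ≤ C * (1 + |x| ^ 2)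

/-- Condition (C): `α` has bounded variation on all of `ℝ`. -/
def CondC (α : ℝ → ℝ) : Prop := BoundedVariationOn α Set.univ

open scoped NNReal Topology

/-- `φ` solves `φ t = x + ∫₀ᵗ a (φ s) ds + v t` on `[0, T]`. -/
structure SolvesOn (a : ℝ → ℝ) (x : ℝ) (v : ℝ → ℝ) (T : ℝ) (φ : ℝ → ℝ) : Prop where
  cont : ContinuousOn φ (Icc 0 T)
  eqn : ∀ t ∈ Icc 0 T, φ t = x + (∫ s in (0:ℝ)..t, a (φ s)) + v t

theorem nonpos_of_integral_growth {d : ℝ → ℝ} {T K : ℝ} (hd : ContinuousOn d (Icc 0 T))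
    (h0 : d 0 ≤ 0)
    (hinc : ∀ r t, 0 ≤ r → r ≤ t → t ≤ T → (∀ s ∈ Ioc r t, 0 ≤ d s) →
      d t - d r ≤ K * ∫ s in r..t, d s) :
    ∀ t ∈ Icc 0 T, d t ≤ 0 := by
  intro t₁ ht₁
  by_contra! hpos
  set S : Set ℝ := Icc 0 t₁ ∩ d ⁻¹' Iic 0 with hS
  have hdt : ContinuousOn d (Icc 0 t₁) := hd.mono (Icc_subset_Icc_right ht₁.2)
  have hSc : IsClosed S := hdt.preimage_isClosed_of_isClosed isClosed_Icc isClosed_Iic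
  have hS0 : (0:ℝ) ∈ S := ⟨⟨le_rfl, ht₁.1⟩, h0⟩
  have hSb : BddAbove S := ⟨t₁, fun y hy => hy.1.2⟩
  set r := sSup S with hr
  have hrS : r ∈ S := hSc.csSup_mem ⟨0, hS0⟩ hSb
  have hr0 : 0 ≤ r := hrS.1.1
  have hrt : r ≤ t₁ := hrS.1.2
  have hposr : ∀ s ∈ Ioc r t₁, 0 ≤ d s := by
    intro s hs
    by_contra! hneg
    exact absurd (le_csSup hSb ⟨⟨hr0.trans hs.1.le, hs.2⟩, hneg.le⟩) (not_le.2 hs.1)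
  have hdr : ContinuousOn d (Icc r t₁) := hdt.mono (Icc_subset_Icc_left hr0)
  have hbound : ∀ t ∈ Icc r t₁, d t ≤ K * ∫ s in r..t, d s := by
    intro t ht
    have := hinc r t hr0 ht.1 (ht.2.trans ht₁.2) fun s hs => hposr s ⟨hs.1, hs.2.trans ht.2⟩
    linarith [show d r ≤ 0 from hrS.2]
  have hint : IntervalIntegrable d volume r t₁ := by
    apply ContinuousOn.intervalIntegrable
    rwa [uIcc_of_le hrt]
  have hu : ∀ t ∈ Icc r t₁, ∫ s in r..t, d s ≤ 0 := by
    intro t ht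
    have := le_gronwallBound_of_liminf_deriv_right_le (f := fun t => ∫ s in r..t, d s) (f' := d)
      (δ := 0) (K := K) (ε := 0) (a := r) (b := t₁) ?_ ?_ (by simp) ?_ t ht
    · simpa [gronwallBound_ε0] using this
    · have := intervalIntegral.continuousOn_primitive_interval
        (μ := volume) (f := d) (a := r) (b := t₁) ?_
      · rwa [uIcc_of_le hrt] at this
      · rw [uIcc_of_le hrt]; exact hdr.integrableOn_Icc
    · intro y hy ρ hρ
      have hder : HasDerivWithinAt (fun t => ∫ s in r..t, d s) (d y) (Ici y) y := by
        have h1 : IntervalIntegrable d volume r y :=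
          hint.mono_set (by
            rw [uIcc_of_le hrt, uIcc_of_le hy.1]; exact Icc_subset_Icc_right hy.2.le)
        have h2 : ContinuousWithinAt d (Ioi y) y :=
          ((hdr y ⟨hy.1, hy.2.le⟩).mono_of_mem_nhdsWithin
            (mem_of_superset (Ioc_mem_nhdsGT hy.2)
              (fun z hz => ⟨hy.1.trans hz.1.le, hz.2⟩)))
        refine intervalIntegral.integral_hasDerivWithinAt_right h1 (t := Ioi y) ?_ h2
        refine ⟨Ioc y t₁, Ioc_mem_nhdsGT hy.2, ?_⟩
        exact (hdr.mono fun z hz => ⟨hy.1.trans hz.1.le, hz.2⟩).aestronglyMeasurable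
          measurableSet_Ioc
      have := hder.liminf_right_slope_le hρ
      simpa [slope_def_field, div_eq_inv_mul] using this
    · intro y hy
      simpa using hbound y ⟨hy.1, hy.2.le⟩
  have h1 : 0 ≤ ∫ s in r..t₁, d s := by
    apply intervalIntegral.integral_nonneg_of_ae_restrict hrt
    refine (ae_restrict_iff' measurableSet_Icc).2 ?_
    have : ∀ᵐ s ∂(volume : Measure ℝ), s ≠ r := by
      simp [ae_iff]
    filter_upwards [this] with s hs hs'
    exact hposr s ⟨lt_of_le_of_ne hs'.1 (Ne.symm hs), hs'.2⟩
  have h2 := hbound t₁ ⟨hrt, le_rfl⟩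
  have h3 := hu t₁ ⟨hrt, le_rfl⟩
  have h4 : ∫ s in r..t₁, d s = 0 := le_antisymm h3 h1
  rw [h4] at h2
  simp at h2
  linarith

theorem SolvesOn.sub_eq {a v φ : ℝ → ℝ} {x T : ℝ} (h : SolvesOn a x v T φ)
    (hi : IntervalIntegrable (fun s => a (φ s)) volume 0 T) {r t : ℝ} (hr : 0 ≤ r) (hrt : r ≤ t)
    (ht : t ≤ T) : φ t - φ r = (∫ s in r..t, a (φ s)) + (v t - v r) := by
  have hT : 0 ≤ T := hr.trans (hrt.trans ht)
  rw [h.eqn t ⟨hr.trans hrt, ht⟩, h.eqn r ⟨hr, hrt.trans ht⟩]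
  have h1 : IntervalIntegrable (fun s => a (φ s)) volume 0 r :=
    hi.mono_set (by rw [uIcc_of_le hT, uIcc_of_le hr]; exact Icc_subset_Icc_right (hrt.trans ht))
  have h2 : IntervalIntegrable (fun s => a (φ s)) volume r t :=
    hi.mono_set (by rw [uIcc_of_le hT, uIcc_of_le hrt]; exact Icc_subset_Icc hr ht)
  rw [← intervalIntegral.integral_add_adjacent_intervals h1 h2]
  ring

theorem SolvesOn.intervalIntegrable {a v φ : ℝ → ℝ} {x T : ℝ} (h : SolvesOn a x v T φ)
    (ha : Continuous a) (hT : 0 ≤ T) : IntervalIntegrable (fun s => a (φ s)) volume 0 T := by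
  apply ContinuousOn.intervalIntegrable
  rw [uIcc_of_le hT]
  exact ha.comp_continuousOn h.cont

theorem SolvesOn.le_of_le {a b v φ ψ : ℝ → ℝ} {x T : ℝ} {K : ℝ≥0} (hφ : SolvesOn a x v T φ)
    (hψ : SolvesOn b x v T ψ) (ha : LipschitzWith K a)
    (hb : IntervalIntegrable (fun s => b (ψ s)) volume 0 T)
    (hab : ∀ s ∈ Icc 0 T, a (ψ s) ≤ b (ψ s)) : ∀ t ∈ Icc 0 T, φ t ≤ ψ t := by
  intro t ht
  have hT : 0 ≤ T := ht.1.trans ht.2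
  have h0 : (0:ℝ) ∈ Icc 0 T := ⟨le_rfl, hT⟩
  have hia := hφ.intervalIntegrable ha.continuous hT
  have := nonpos_of_integral_growth (d := fun t => φ t - ψ t) (K := K) (hφ.cont.sub hψ.cont)
    (by simp [hφ.eqn 0 h0, hψ.eqn 0 h0]) ?_ t ht
  · linarith
  intro r t hr hrt ht hs
  have h1 : IntervalIntegrable (fun s => a (φ s)) volume r t :=
    hia.mono_set (by rw [uIcc_of_le hT, uIcc_of_le hrt]; exact Icc_subset_Icc hr ht)
  have h2 : IntervalIntegrable (fun s => b (ψ s)) volume r t :=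
    hb.mono_set (by rw [uIcc_of_le hT, uIcc_of_le hrt]; exact Icc_subset_Icc hr ht)
  have h3 : IntervalIntegrable (fun s => φ s - ψ s) volume r t := by
    apply ContinuousOn.intervalIntegrable
    rw [uIcc_of_le hrt]
    exact (hφ.cont.sub hψ.cont).mono (Icc_subset_Icc hr ht)
  have e1 := hφ.sub_eq hia hr hrt ht
  have e2 := hψ.sub_eq hb hr hrt ht
  have e3 : (φ t - ψ t) - (φ r - ψ r) = ∫ s in r..t, (a (φ s) - b (ψ s)) := by
    rw [intervalIntegral.integral_sub h1 h2]; linarith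
  show (φ t - ψ t) - (φ r - ψ r) ≤ _
  rw [e3, ← intervalIntegral.integral_const_mul]
  apply intervalIntegral.integral_mono_ae_restrict hrt (h1.sub h2) (h3.const_mul _)
  refine (ae_restrict_iff' measurableSet_Icc).2 ?_
  have : ∀ᵐ s ∂(volume : Measure ℝ), s ≠ r := by
    simp [ae_iff]
  filter_upwards [this] with s hne hs'
  have hd := hs s ⟨lt_of_le_of_ne hs'.1 (Ne.symm hne), hs'.2⟩
  have hl := ha.dist_le_mul (φ s) (ψ s)
  rw [Real.dist_eq, Real.dist_eq, abs_of_nonneg hd] at hl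
  have := hab s ⟨hr.trans hs'.1, hs'.2.trans ht⟩
  linarith [le_abs_self (a (φ s) - a (ψ s))]

theorem SolvesOn.neg {a v φ : ℝ → ℝ} {x T : ℝ} (h : SolvesOn a x v T φ) :
    SolvesOn (fun y => - a (-y)) (-x) (fun t => - v t) T (fun t => - φ t) := by
  refine ⟨h.cont.neg, fun t ht => ?_⟩
  simp only [neg_neg, intervalIntegral.integral_neg]
  rw [h.eqn t ht]; ring

theorem SolvesOn.ge_of_ge {a b v φ ψ : ℝ → ℝ} {x T : ℝ} {K : ℝ≥0} (hφ : SolvesOn a x v T φ)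
    (hψ : SolvesOn b x v T ψ) (ha : LipschitzWith K a)
    (hb : IntervalIntegrable (fun s => b (ψ s)) volume 0 T)
    (hab : ∀ s ∈ Icc 0 T, b (ψ s) ≤ a (ψ s)) : ∀ t ∈ Icc 0 T, ψ t ≤ φ t := by
  intro t ht
  have hlip : LipschitzWith K (fun y => - a (-y)) := by
    refine LipschitzWith.of_dist_le_mul fun y z => ?_
    simpa [dist_neg_neg] using ha.dist_le_mul (-y) (-z)
  have := hφ.neg.le_of_le hψ.neg hlip
    (by simp only [neg_neg]; exact hb.neg) (by simpa using hab) t ht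
  simpa using this

theorem SolvesOn.congr {a v φ ψ : ℝ → ℝ} {x T : ℝ} (h : SolvesOn a x v T φ)
    (he : EqOn ψ φ (Icc 0 T)) : SolvesOn a x v T ψ := by
  refine ⟨h.cont.congr he, fun t ht => ?_⟩
  rw [he ht, h.eqn t ht]
  congr 2
  apply intervalIntegral.integral_congr
  intro s hs
  rw [uIcc_of_le ht.1] at hs
  simp only [he ⟨hs.1, hs.2.trans ht.2⟩]

theorem exists_solvesOn {a v : ℝ → ℝ} {K : ℝ≥0} {M : ℝ} (ha : LipschitzWith K a)
    (haM : ∀ y, |a y| ≤ M) (hv : Continuous v) (x : ℝ) {T : ℝ} (hT : 0 ≤ T) :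
    ∃ φ, SolvesOn a x v T φ := by
  have hM : 0 ≤ M := (abs_nonneg _).trans (haM 0)
  have hpl : IsPicardLindelof (fun t y => a (y + v t)) (tmin := 0) (tmax := T)
      ⟨0, le_rfl, hT⟩ x (M.toNNReal * T.toNNReal) 0 M.toNNReal K := by
    refine ⟨fun t _ => ?_, fun y _ => ?_, fun t _ y _ => ?_, ?_⟩
    · refine (LipschitzWith.of_dist_le_mul fun y z => ?_).lipschitzOnWith
      simpa using ha.dist_le_mul (y + v t) (z + v t)
    · exact (ha.continuous.comp (continuous_const.add hv)).continuousOn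
    · rw [Real.coe_toNNReal _ hM]; exact haM _
    · simp [Real.coe_toNNReal _ hM, Real.coe_toNNReal _ hT, hT]
  obtain ⟨y, hy0, hy⟩ := hpl.exists_eq_forall_mem_Icc_hasDerivWithinAt₀
  have hyc : ContinuousOn y (Icc 0 T) := fun t ht => (hy t ht).continuousWithinAt
  refine ⟨fun t => y t + v t, hyc.add hv.continuousOn, fun t ht => ?_⟩
  have hyc' : ContinuousOn y (Icc 0 t) := hyc.mono (Icc_subset_Icc_right ht.2)
  have := intervalIntegral.integral_eq_sub_of_hasDeriv_right_of_le ht.1 hyc'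
    (f' := fun s => a (y s + v s)) ?_ ?_
  · simp only at hy0
    rw [this, hy0]; ring
  · intro s hs
    exact (hy s ⟨hs.1.le, hs.2.le.trans ht.2⟩).mono_of_mem_nhdsWithin
      (mem_of_superset (Ioc_mem_nhdsGT (hs.2.trans_le ht.2))
        (fun z hz => ⟨hs.1.le.trans hz.1.le, hz.2⟩))
  · apply ContinuousOn.intervalIntegrable
    rw [uIcc_of_le ht.1]
    exact ha.continuous.comp_continuousOn (hyc'.add hv.continuousOn)

/-- Explicit Euler scheme with step `h` for `φ t = x + ∫₀ᵗ a (φ s) ds + v t`. -/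
def euler (a : ℝ → ℝ) (x : ℝ) (v : ℝ → ℝ) (h : ℝ) : ℕ → ℝ
  | 0 => x + v 0
  | n + 1 => euler a x v h n + a (euler a x v h n) * h + (v ((n + 1 : ℕ) * h) - v (n * h))

/-- Upper limit of the Euler schemes at time `t`. -/
def eulerLim (a : ℝ → ℝ) (x : ℝ) (v : ℝ → ℝ) (t : ℝ) : ℝ :=
  limsup (fun m : ℕ => euler a x v (t / (m + 1 : ℕ)) (m + 1)) atTop

theorem SolvesOn.euler_error {a v φ : ℝ → ℝ} {x T : ℝ} {K : ℝ≥0} (hφ : SolvesOn a x v T φ)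
    (ha : LipschitzWith K a) {h ε : ℝ} (hh : 0 ≤ h) (hε : 0 ≤ ε)
    (hosc : ∀ s ∈ Icc 0 T, ∀ r ∈ Icc 0 T, |s - r| ≤ h → |φ s - φ r| ≤ ε) (n : ℕ)
    (hn : n * h ≤ T) :
    |φ (n * h) - euler a x v h n| ≤ n * h * K * ε * Real.exp (K * (n * h)) := by
  induction n with
  | zero =>
    have h0 : (0:ℝ) ∈ Icc 0 T := ⟨le_rfl, by simpa using hn⟩
    simp [euler, hφ.eqn 0 h0]
  | succ n ih =>
    have hn' : (n:ℝ) * h + h ≤ T := by push_cast at hn; linarith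
    have hn0 : 0 ≤ (n:ℝ) * h := by positivity
    have ih := ih (by linarith)
    have hT : 0 ≤ T := by linarith
    have hi := hφ.intervalIntegrable ha.continuous hT
    have e1 := hφ.sub_eq hi (r := n * h) (t := n * h + h) hn0 (by linarith) hn'
    have hi2 : IntervalIntegrable (fun s => a (φ s)) volume (n * h) (n * h + h) :=
      hi.mono_set (by
        rw [uIcc_of_le hT, uIcc_of_le (by linarith)]; exact Icc_subset_Icc hn0 hn')
    set e := euler a x v h n with he
    have e2 : (∫ s in (n * h)..(n * h + h), (a (φ s) - a e))
        = (∫ s in (n * h)..(n * h + h), a (φ s)) - a e * h := by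
      rw [intervalIntegral.integral_sub hi2 (by simp)]
      simp [mul_comm]
    have e3 : |∫ s in (n * h)..(n * h + h), (a (φ s) - a e)|
        ≤ K * (ε + |φ (n * h) - e|) * h := by
      have := intervalIntegral.norm_integral_le_of_norm_le_const (a := n * h) (b := n * h + h)
        (f := fun s => a (φ s) - a e) (C := K * (ε + |φ (n * h) - e|)) ?_
      · simpa [abs_of_nonneg hh] using this
      · intro s hs
        rw [uIoc_of_le (by linarith)] at hs
        have h1 := ha.dist_le_mul (φ s) e
        rw [Real.dist_eq, Real.dist_eq] at h1
        have h2 := hosc s ⟨by linarith [hs.1], by linarith [hs.2]⟩ (n * h)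
          ⟨hn0, by linarith⟩ (by rw [abs_of_nonneg (by linarith [hs.1])]; linarith [hs.2])
        have h3 : |φ s - e| ≤ ε + |φ (n * h) - e| := by
          have := abs_sub_le (φ s) (φ (n * h)) e; linarith
        exact h1.trans (mul_le_mul_of_nonneg_left h3 K.2)
    have hidx : ((n + 1 : ℕ) : ℝ) * h = n * h + h := by push_cast; ring
    have e4 : φ (n * h + h) - euler a x v h (n + 1)
        = (φ (n * h) - e) + ∫ s in (n * h)..(n * h + h), (a (φ s) - a e) := by
      rw [e2, euler, hidx, ← he]; linarith
    rw [hidx, e4]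
    set E := |φ (n * h) - e|
    set q : ℝ := n * h
    have hexp : 1 + K * h ≤ Real.exp (K * h) := by
      have := Real.add_one_le_exp (K * h : ℝ); linarith
    have hKh : (0:ℝ) ≤ K * h := by positivity
    have h1 : 1 ≤ Real.exp (K * (q + h)) := Real.one_le_exp (by positivity)
    calc |φ q - e + ∫ s in q..(q + h), (a (φ s) - a e)|
        ≤ E + K * (ε + E) * h := (abs_add_le _ _).trans (by linarith)
      _ = (1 + K * h) * E + K * h * ε := by ring
      _ ≤ Real.exp (K * h) * (q * K * ε * Real.exp (K * q))
          + K * h * ε * Real.exp (K * (q + h)) := by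
        apply add_le_add
        · exact mul_le_mul hexp ih (abs_nonneg _) (Real.exp_pos _).le
        · exact le_mul_of_one_le_right (by positivity) h1
      _ = (q + h) * K * ε * Real.exp (K * (q + h)) := by
        rw [mul_add (K:ℝ) q h, Real.exp_add]; ring

theorem SolvesOn.tendsto_euler {a v φ : ℝ → ℝ} {x T : ℝ} {K : ℝ≥0} (hφ : SolvesOn a x v T φ)
    (ha : LipschitzWith K a) {t : ℝ} (ht : t ∈ Icc 0 T) :
    Tendsto (fun m : ℕ => euler a x v (t / (m + 1 : ℕ)) (m + 1)) atTop (𝓝 (φ t)) := by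
  rw [Metric.tendsto_atTop]
  intro ε hε
  set C : ℝ := t * K * Real.exp (K * t) + 1 with hC
  have hC1 : 1 ≤ C := by
    have : 0 ≤ t * K * Real.exp (K * t) := mul_nonneg (mul_nonneg ht.1 K.2) (Real.exp_pos _).le
    linarith
  have huc := isCompact_Icc.uniformContinuousOn_of_continuous hφ.cont
  rw [Metric.uniformContinuousOn_iff] at huc
  obtain ⟨δ, hδ, hosc⟩ := huc (ε / (2 * C)) (by positivity)
  obtain ⟨N, hN⟩ := exists_nat_gt (t / δ)
  refine ⟨N, fun m hm => ?_⟩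
  have hm1 : (0:ℝ) < (m + 1 : ℕ) := by positivity
  have hh : t / (m + 1 : ℕ) < δ := by
    rw [div_lt_iff₀ hm1]
    rw [div_lt_iff₀ hδ] at hN
    have : (N:ℝ) ≤ (m + 1 : ℕ) := by exact_mod_cast hm.trans (Nat.le_succ m)
    nlinarith
  have hmt : ((m + 1 : ℕ) : ℝ) * (t / (m + 1 : ℕ)) = t := by field_simp
  have := hφ.euler_error ha (h := t / (m + 1 : ℕ)) (ε := ε / (2 * C)) (div_nonneg ht.1 hm1.le)
    (by positivity) (fun s hs r hr hsr => (hosc s hs r hr (lt_of_le_of_lt hsr hh)).le) (m + 1)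
    (by rw [hmt]; exact ht.2)
  rw [hmt] at this
  rw [dist_comm, Real.dist_eq]
  refine this.trans_lt ?_
  have h2 : t * K * (ε / (2 * C)) * Real.exp (K * t) = (C - 1) / C * (ε / 2) := by
    rw [hC]; field_simp; ring
  rw [h2]
  have : (C - 1) / C ≤ 1 := by rw [div_le_one (by linarith)]; linarith
  nlinarith

theorem eulerLim_solvesOn {a v : ℝ → ℝ} {K : ℝ≥0} {M : ℝ} (ha : LipschitzWith K a)
    (haM : ∀ y, |a y| ≤ M) (hv : Continuous v) (x T : ℝ) :
    SolvesOn a x v T (eulerLim a x v) := by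
  rcases lt_or_ge T 0 with hT | hT
  · refine ⟨?_, fun t ht => ?_⟩
    · rw [Icc_eq_empty (not_le.2 hT)]; exact continuousOn_empty _
    · exact absurd (ht.1.trans ht.2) (not_le.2 hT)
  obtain ⟨φ, hφ⟩ := exists_solvesOn ha haM hv x hT
  exact hφ.congr fun t ht => (hφ.tendsto_euler ha ht).limsup_eq

theorem measurable_euler {Ω : Type*} {m : MeasurableSpace Ω} {a : ℝ → ℝ} (ha : Measurable a)
    (x : ℝ) {w : ℝ → Ω → ℝ} {h : ℝ} (n : ℕ) (hw : ∀ j ≤ n, Measurable (w (j * h))) :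
    Measurable fun ω => euler a x (fun t => w t ω) h n := by
  induction n with
  | zero => simpa [euler] using (hw 0 le_rfl).const_add x
  | succ n ih =>
    have ih := ih fun j hj => hw j (hj.trans (Nat.le_succ n))
    simp only [euler]
    exact (ih.add ((ha.comp ih).mul_const h)).add
      ((hw (n + 1) le_rfl).sub (hw n (Nat.le_succ n)))

theorem measurable_eulerLim {Ω : Type*} {m : MeasurableSpace Ω} {a : ℝ → ℝ} (ha : Measurable a)
    (x : ℝ) {w : ℝ → Ω → ℝ} {t : ℝ} (ht : 0 ≤ t) (hw : ∀ s ∈ Icc 0 t, Measurable (w s)) :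
    Measurable fun ω => eulerLim a x (fun t => w t ω) t := by
  refine Measurable.limsup fun n => measurable_euler ha x _ fun j hj => hw _ ?_
  have h1 : (0:ℝ) < (n + 1 : ℕ) := by positivity
  have h2 : (j:ℝ) ≤ (n + 1 : ℕ) := by exact_mod_cast hj
  refine ⟨by positivity, ?_⟩
  rw [← mul_div_assoc, div_le_iff₀ h1]
  nlinarith

/-- The largest `k`-Lipschitz minorant of `α`. -/
def lipMinorant (α : ℝ → ℝ) (k : ℕ) (x : ℝ) : ℝ := ⨅ y, (α y + k * |x - y|)

/-- The smallest `k`-Lipschitz majorant of `α`. -/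
def lipMajorant (α : ℝ → ℝ) (k : ℕ) (x : ℝ) : ℝ := - lipMinorant (fun y => - α y) k x

section envelopes

variable {α : ℝ → ℝ} {M : ℝ}

theorem bddBelow_lipMinorant (hM : ∀ y, |α y| ≤ M) (k : ℕ) (x : ℝ) :
    BddBelow (range fun y => α y + k * |x - y|) := by
  refine ⟨-M, ?_⟩
  rintro _ ⟨y, rfl⟩
  have := (abs_le.1 (hM y)).1
  have : (0:ℝ) ≤ k * |x - y| := by positivity
  dsimp only
  linarith

theorem lipMinorant_le_add (hM : ∀ y, |α y| ≤ M) (k : ℕ) (x y : ℝ) :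
    lipMinorant α k x ≤ α y + k * |x - y| :=
  ciInf_le (bddBelow_lipMinorant hM k x) y

theorem lipMinorant_le (hM : ∀ y, |α y| ≤ M) (k : ℕ) (x : ℝ) : lipMinorant α k x ≤ α x := by
  simpa using lipMinorant_le_add hM k x x

theorem lipMinorant_mono (hM : ∀ y, |α y| ≤ M) {k l : ℕ} (hkl : k ≤ l) (x : ℝ) :
    lipMinorant α k x ≤ lipMinorant α l x := by
  refine le_ciInf fun y => (lipMinorant_le_add hM k x y).trans ?_
  have : (k:ℝ) ≤ l := by exact_mod_cast hkl
  gcongr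

theorem abs_lipMinorant_le (hM : ∀ y, |α y| ≤ M) (k : ℕ) (x : ℝ) : |lipMinorant α k x| ≤ M := by
  refine abs_le.2 ⟨le_ciInf fun y => ?_, (lipMinorant_le hM k x).trans (abs_le.1 (hM x)).2⟩
  have := (abs_le.1 (hM y)).1
  have : (0:ℝ) ≤ k * |x - y| := by positivity
  linarith

theorem lipschitzWith_lipMinorant (hM : ∀ y, |α y| ≤ M) (k : ℕ) :
    LipschitzWith k (lipMinorant α k) := by
  refine LipschitzWith.of_le_add_mul _ fun x z => ?_
  rw [Real.dist_eq, ← sub_le_iff_le_add]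
  refine le_ciInf fun y => ?_
  have h1 := lipMinorant_le_add hM k x y
  have h2 : (k:ℝ) * |x - y| ≤ k * (|x - z| + |z - y|) :=
    mul_le_mul_of_nonneg_left (abs_sub_le x z y) (by positivity)
  simp only [NNReal.coe_natCast]
  linarith

theorem lipMinorant_eq_zero (hM : ∀ y, |α y| ≤ M) {R : ℝ} (hR : ∀ y, R < |y| → α y = 0) {k : ℕ}
    (hk : 1 ≤ k) {x : ℝ} (hx : R + M < |x|) : lipMinorant α k x = 0 := by
  have hM0 : 0 ≤ M := (abs_nonneg _).trans (hM 0)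
  refine le_antisymm ((lipMinorant_le hM k x).trans_eq (hR x (by linarith))) ?_
  refine le_ciInf fun y => ?_
  have hk' : (1:ℝ) ≤ k := by exact_mod_cast hk
  by_cases hy : R < |y|
  · rw [hR y hy]; positivity
  · have h1 := (abs_le.1 (hM y)).1
    have h2 : |x| - |y| ≤ |x - y| := abs_sub_abs_le_abs_sub x y
    have h3 : |x - y| ≤ k * |x - y| := le_mul_of_one_le_left (abs_nonneg _) hk'
    linarith [not_lt.1 hy]

theorem tendsto_lipMinorant (hM : ∀ y, |α y| ≤ M) {x : ℝ} (hx : ContinuousAt α x) :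
    Tendsto (fun k => lipMinorant α k x) atTop (𝓝 (α x)) := by
  have hM0 : 0 ≤ M := (abs_nonneg _).trans (hM 0)
  rw [Metric.tendsto_atTop]
  intro ε hε
  obtain ⟨δ, hδ, hc⟩ := Metric.continuousAt_iff.1 hx (ε / 2) (by positivity)
  obtain ⟨N, hN⟩ := exists_nat_gt (2 * M / δ)
  refine ⟨N, fun k hk => ?_⟩
  have hkN : (N:ℝ) ≤ k := by exact_mod_cast hk
  have h1 := lipMinorant_le hM k x
  have h2 : α x - ε / 2 ≤ lipMinorant α k x := by
    refine le_ciInf fun y => ?_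
    have h0 : (0:ℝ) ≤ k * |x - y| := by positivity
    by_cases hy : |x - y| < δ
    · have := hc (x := y) (by rw [dist_comm, Real.dist_eq]; exact hy)
      rw [Real.dist_eq] at this
      linarith [(abs_lt.1 this).1]
    · push Not at hy
      rw [div_lt_iff₀ hδ] at hN
      have h3 := (abs_le.1 (hM y)).1
      have h4 := (abs_le.1 (hM x)).2
      have h5 : N * δ ≤ k * |x - y| := by gcongr
      linarith
  rw [Real.dist_eq, abs_lt]
  constructor <;> linarith

theorem le_lipMajorant (hM : ∀ y, |α y| ≤ M) (k : ℕ) (x : ℝ) : α x ≤ lipMajorant α k x := by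
  have := lipMinorant_le (α := fun y => - α y) (M := M) (by simpa using hM) k x
  rw [lipMajorant]; linarith

theorem lipMajorant_anti (hM : ∀ y, |α y| ≤ M) {k l : ℕ} (hkl : k ≤ l) (x : ℝ) :
    lipMajorant α l x ≤ lipMajorant α k x :=
  neg_le_neg (lipMinorant_mono (α := fun y => - α y) (M := M) (by simpa using hM) hkl x)

theorem abs_lipMajorant_le (hM : ∀ y, |α y| ≤ M) (k : ℕ) (x : ℝ) : |lipMajorant α k x| ≤ M := by
  rw [lipMajorant, abs_neg]
  exact abs_lipMinorant_le (by simpa using hM) k x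

theorem lipschitzWith_lipMajorant (hM : ∀ y, |α y| ≤ M) (k : ℕ) :
    LipschitzWith k (lipMajorant α k) :=
  (lipschitzWith_lipMinorant (α := fun y => - α y) (M := M) (by simpa using hM) k).neg

theorem lipMajorant_eq_zero (hM : ∀ y, |α y| ≤ M) {R : ℝ} (hR : ∀ y, R < |y| → α y = 0) {k : ℕ}
    (hk : 1 ≤ k) {x : ℝ} (hx : R + M < |x|) : lipMajorant α k x = 0 := by
  rw [lipMajorant, lipMinorant_eq_zero (M := M) (R := R) (by simpa using hM)
    (by simpa using hR) hk hx, neg_zero]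

theorem tendsto_lipMajorant (hM : ∀ y, |α y| ≤ M) {x : ℝ} (hx : ContinuousAt α x) :
    Tendsto (fun k => lipMajorant α k x) atTop (𝓝 (α x)) := by
  have := (tendsto_lipMinorant (α := fun y => - α y) (M := M) (by simpa using hM) hx.neg).neg
  simpa [lipMajorant] using this

theorem tendsto_integral_lipMajorant_sub_lipMinorant (hM : ∀ y, |α y| ≤ M)
    (hc : {x | ¬ ContinuousAt α x}.Countable) (R : ℝ) :
    Tendsto (fun k => ∫ y in (-R)..R, (lipMajorant α k y - lipMinorant α k y)) atTop (𝓝 0) := by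
  have h := intervalIntegral.tendsto_integral_filter_of_dominated_convergence (μ := volume)
    (a := -R) (b := R) (l := atTop)
    (F := fun k y => lipMajorant α k y - lipMinorant α k y) (f := fun _ => 0)
    (fun _ => 2 * M) ?_ ?_ ?_ ?_
  · simpa using h
  · refine Eventually.of_forall fun k => Continuous.aestronglyMeasurable ?_
    exact (lipschitzWith_lipMajorant hM k).continuous.sub
      (lipschitzWith_lipMinorant hM k).continuous
  · refine Eventually.of_forall fun k => ae_of_all _ fun y _ => ?_
    have h1 := abs_lipMajorant_le hM k y
    have h2 := abs_lipMinorant_le hM k y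
    rw [Real.norm_eq_abs]
    linarith [abs_sub (lipMajorant α k y) (lipMinorant α k y)]
  · simp
  · filter_upwards [hc.ae_notMem volume] with y hy _
    have hy : ContinuousAt α y := by simpa using hy
    simpa using (tendsto_lipMajorant hM hy).sub (tendsto_lipMinorant hM hy)

end envelopes

theorem abs_sub_taylor_two_le {f f₁ f₂ : ℝ → ℝ} {K : ℝ≥0} (hf : ∀ y, HasDerivAt f (f₁ y) y)
    (hf₁ : ∀ y, HasDerivAt f₁ (f₂ y) y) (hK : LipschitzWith K f₂) (y d : ℝ) :
    |f (y + d) - f y - f₁ y * d - f₂ y * d ^ 2 / 2| ≤ K * |d| ^ 3 := by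
  set B : Set ℝ := Metric.closedBall 0 |d|
  have hB : Convex ℝ B := convex_closedBall _ _
  have h0 : (0:ℝ) ∈ B := by simp [B]
  have hmem : ∀ s ∈ B, |s| ≤ |d| := fun s hs => by simpa [B] using hs
  have hd : d ∈ B := by simp [B]
  have D2 : ∀ s ∈ B, HasDerivWithinAt (fun s => f₁ (y + s) - f₁ y - f₂ y * s)
      (f₂ (y + s) - f₂ y) B s := by
    intro s _
    have h1 : HasDerivAt (fun s => f₁ (y + s)) (f₂ (y + s)) s := by
      simpa using (hf₁ (y + s)).comp_const_add y s
    have := ((h1.sub_const (f₁ y)).sub ((hasDerivAt_id s).const_mul (f₂ y)))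
    exact (this.congr_deriv (by simp)).hasDerivWithinAt
  have D1 : ∀ s ∈ B, HasDerivWithinAt (fun s => f (y + s) - f y - f₁ y * s - f₂ y * s ^ 2 / 2)
      (f₁ (y + s) - f₁ y - f₂ y * s) B s := by
    intro s _
    have h1 : HasDerivAt (fun s => f (y + s)) (f₁ (y + s)) s := by
      simpa using (hf (y + s)).comp_const_add y s
    have h2 := (((h1.sub_const (f y)).sub ((hasDerivAt_id s).const_mul (f₁ y))).sub
      ((((hasDerivAt_id s).pow 2).const_mul (f₂ y)).div_const 2))
    refine (h2.congr_deriv ?_).hasDerivWithinAt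
    simp; ring
  have b2 : ∀ s ∈ B, |f₁ (y + s) - f₁ y - f₂ y * s| ≤ K * |d| * |d| := by
    intro s hs
    have := hB.norm_image_sub_le_of_norm_hasDerivWithin_le D2 (C := K * |d|) ?_ h0 hs
    · simp only [add_zero, sub_self, mul_zero, sub_zero, Real.norm_eq_abs] at this
      exact this.trans (mul_le_mul_of_nonneg_left (hmem s hs) (by positivity))
    · intro s hs
      have := hK.dist_le_mul (y + s) y
      simp only [Real.dist_eq, add_sub_cancel_left] at this
      exact this.trans (mul_le_mul_of_nonneg_left (hmem s hs) K.2)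
  have := hB.norm_image_sub_le_of_norm_hasDerivWithin_le D1 b2 h0 hd
  simp only [add_zero, sub_self, mul_zero, sub_zero, Real.norm_eq_abs] at this
  calc _ ≤ _ := by simpa using this
    _ = _ := by ring

/-- The `p`-th absolute moment of the standard Gaussian law. -/
def gaussAbsMoment (p : ℕ) : ℝ := ∫ z, |z| ^ p ∂(gaussianReal 0 1)

theorem gaussianReal_eq_map_sqrt {h : ℝ} (hh : 0 ≤ h) :
    gaussianReal 0 h.toNNReal = (gaussianReal 0 1).map (fun z => √h * z) := by
  rw [gaussianReal_map_const_mul]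
  congr 1
  · simp
  · ext; simp [Real.coe_toNNReal _ hh, Real.sq_sqrt hh]

section gauss

variable {Ω : Type*} [MeasurableSpace Ω] {P : Measure Ω} {N : Ω → ℝ} {h : ℝ}

theorem integrable_abs_pow_of_map_eq_gaussianReal (hN : AEMeasurable N P)
    (hl : P.map N = gaussianReal 0 h.toNNReal) (p : ℕ) : Integrable (fun ω => |N ω| ^ p) P := by
  have h1 : Integrable (fun z : ℝ => |z| ^ p) (P.map N) := by
    rw [hl]
    simpa using (memLp_id_gaussianReal (μ := 0) (v := h.toNNReal) p).integrable_norm_pow'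
  exact (integrable_map_measure (by fun_prop) hN).1 h1

theorem integral_abs_pow_of_map_eq_gaussianReal (hN : AEMeasurable N P) (hh : 0 ≤ h)
    (hl : P.map N = gaussianReal 0 h.toNNReal) (p : ℕ) :
    ∫ ω, |N ω| ^ p ∂P = √h ^ p * gaussAbsMoment p := by
  rw [← integral_map (f := fun z : ℝ => |z| ^ p) hN (by fun_prop), hl,
    gaussianReal_eq_map_sqrt hh, integral_map (by fun_prop) (by fun_prop), gaussAbsMoment,
    ← integral_const_mul]
  simp [abs_mul, mul_pow, abs_of_nonneg (Real.sqrt_nonneg h)]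

theorem integral_of_map_eq_gaussianReal (hN : AEMeasurable N P)
    (hl : P.map N = gaussianReal 0 h.toNNReal) : ∫ ω, N ω ∂P = 0 := by
  rw [← integral_map (f := fun z : ℝ => z) hN (by fun_prop), hl, integral_id_gaussianReal]

theorem integral_sq_of_map_eq_gaussianReal (hN : AEMeasurable N P) (hh : 0 ≤ h)
    (hl : P.map N = gaussianReal 0 h.toNNReal) : ∫ ω, N ω ^ 2 ∂P = h := by
  rw [← integral_map (f := fun z : ℝ => z ^ 2) hN (by fun_prop), hl]
  have h1 := variance_eq_sub (memLp_id_gaussianReal (μ := 0) (v := h.toNNReal) 2)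
  rw [variance_id_gaussianReal] at h1
  simp only [id_eq, Pi.pow_apply, integral_id_gaussianReal] at h1
  rw [Real.coe_toNNReal _ hh] at h1
  linarith

end gauss

theorem abs_integral_comp_le {a φ : ℝ → ℝ} {M : ℝ} (haM : ∀ y, |a y| ≤ M) {s t : ℝ}
    (hst : s ≤ t) : |∫ r in s..t, a (φ r)| ≤ M * (t - s) := by
  have := intervalIntegral.norm_integral_le_of_norm_le_const (a := s) (b := t)
    (f := fun r => a (φ r)) (C := M) fun r _ => haM _
  rwa [abs_of_nonneg (sub_nonneg.2 hst)] at this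

/-- The process `X` solves `dX = a(X) dt + dW`, `X 0 = x`, path by path, and the increments of the
Brownian motion `W` are independent of the present state of `X`. -/
structure IsPathwiseDiffusion {Ω : Type*} [MeasurableSpace Ω] (P : Measure Ω) (a : ℝ → ℝ) (x : ℝ)
    (W X : ℝ → Ω → ℝ) : Prop where
  measW : ∀ t, Measurable (W t)
  measX : ∀ t, 0 ≤ t → Measurable (X t)
  initW : ∀ ω, W 0 ω = 0
  sol : ∀ ω T, SolvesOn a x (fun t => W t ω) T (fun t => X t ω)
  gauss : ∀ s t, 0 ≤ s → s ≤ t →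
    P.map (fun ω => W t ω - W s ω) = gaussianReal 0 (t - s).toNNReal
  indep : ∀ s t, 0 ≤ s → s ≤ t → IndepFun (X s) (fun ω => W t ω - W s ω) P

namespace IsPathwiseDiffusion

variable {Ω : Type*} [MeasurableSpace Ω] {P : Measure Ω}
  {a : ℝ → ℝ} {x : ℝ} {W X : ℝ → Ω → ℝ} {M : ℝ}

theorem sub_eq (hX : IsPathwiseDiffusion P a x W X) (ha : Continuous a) {s t : ℝ}
    (hs : 0 ≤ s) (hst : s ≤ t) (ω : Ω) :
    X t ω - X s ω = (∫ r in s..t, a (X r ω)) + (W t ω - W s ω) :=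
  (hX.sol ω t).sub_eq ((hX.sol ω t).intervalIntegrable ha (hs.trans hst)) hs hst le_rfl

theorem abs_sub_le (hX : IsPathwiseDiffusion P a x W X) (ha : Continuous a)
    (haM : ∀ y, |a y| ≤ M) {s t : ℝ} (hs : 0 ≤ s) (hst : s ≤ t) (ω : Ω) :
    |X t ω - X s ω| ≤ M * (t - s) + |W t ω - W s ω| := by
  rw [hX.sub_eq ha hs hst]
  exact (abs_add_le _ _).trans (by gcongr; exact abs_integral_comp_le haM hst)

theorem measurable_incr (hX : IsPathwiseDiffusion P a x W X) (s t : ℝ) :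
    Measurable fun ω => W t ω - W s ω := (hX.measW t).sub (hX.measW s)

theorem integrable_incr_abs_pow (hX : IsPathwiseDiffusion P a x W X) {s t : ℝ} (hs : 0 ≤ s)
    (hst : s ≤ t) (p : ℕ) : Integrable (fun ω => |W t ω - W s ω| ^ p) P :=
  integrable_abs_pow_of_map_eq_gaussianReal (hX.measurable_incr s t).aemeasurable
    (hX.gauss s t hs hst) p

theorem integral_incr_abs_pow (hX : IsPathwiseDiffusion P a x W X) {s t : ℝ} (hs : 0 ≤ s)
    (hst : s ≤ t) (p : ℕ) :
    ∫ ω, |W t ω - W s ω| ^ p ∂P = √(t - s) ^ p * gaussAbsMoment p :=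
  integral_abs_pow_of_map_eq_gaussianReal (hX.measurable_incr s t).aemeasurable
    (sub_nonneg.2 hst) (hX.gauss s t hs hst) p

theorem integrable_incr (hX : IsPathwiseDiffusion P a x W X) {s t : ℝ} (hs : 0 ≤ s)
    (hst : s ≤ t) : Integrable (fun ω => W t ω - W s ω) P := by
  have := hX.integrable_incr_abs_pow hs hst 1
  simp only [pow_one] at this
  exact (integrable_norm_iff (hX.measurable_incr s t).aestronglyMeasurable).1 this

theorem init (hX : IsPathwiseDiffusion P a x W X) (ω : Ω) : X 0 ω = x := by
  have := (hX.sol ω 0).eqn 0 ⟨le_rfl, le_rfl⟩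
  simpa [hX.initW] using this

variable [IsProbabilityMeasure P]

theorem integrable_sub (hX : IsPathwiseDiffusion P a x W X) (ha : Continuous a)
    (haM : ∀ y, |a y| ≤ M) {s t : ℝ} (hs : 0 ≤ s) (hst : s ≤ t) :
    Integrable (fun ω => X t ω - X s ω) P := by
  have h1 := (integrable_const (μ := P) (M * (t - s))).add (hX.integrable_incr hs hst).abs
  refine h1.mono' ((hX.measX t (hs.trans hst)).sub (hX.measX s hs)).aestronglyMeasurable ?_
  exact ae_of_all _ fun ω => hX.abs_sub_le ha haM hs hst ω

theorem integral_abs_sub_le (hX : IsPathwiseDiffusion P a x W X) (ha : Continuous a)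
    (haM : ∀ y, |a y| ≤ M) {s t : ℝ} (hs : 0 ≤ s) (hst : s ≤ t) :
    ∫ ω, |X t ω - X s ω| ∂P ≤ M * (t - s) + √(t - s) * gaussAbsMoment 1 := by
  have h1 := hX.integral_incr_abs_pow hs hst 1
  simp only [pow_one] at h1
  calc ∫ ω, |X t ω - X s ω| ∂P ≤ ∫ ω, (M * (t - s) + |W t ω - W s ω|) ∂P :=
        integral_mono (hX.integrable_sub ha haM hs hst).abs
          ((integrable_const _).add (hX.integrable_incr hs hst).abs)
          fun ω => hX.abs_sub_le ha haM hs hst ω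
    _ = _ := by
      rw [integral_add (integrable_const _) (hX.integrable_incr hs hst).abs, h1]
      simp

theorem integrable_comp_sub (hX : IsPathwiseDiffusion P a x W X) (ha : Continuous a)
    (haM : ∀ y, |a y| ≤ M) {f : ℝ → ℝ} {C : ℝ≥0} (hf : LipschitzWith C f) {s t : ℝ} (hs : 0 ≤ s)
    (hst : s ≤ t) : Integrable (fun ω => f (X t ω) - f (X s ω)) P := by
  refine ((hX.integrable_sub ha haM hs hst).abs.const_mul (C:ℝ)).mono'
    ((hf.continuous.measurable.comp (hX.measX t (hs.trans hst))).sub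
      (hf.continuous.measurable.comp (hX.measX s hs))).aestronglyMeasurable ?_
  exact ae_of_all _ fun ω => hf.dist_le_mul _ _

theorem integrable_comp (hX : IsPathwiseDiffusion P a x W X) (ha : Continuous a)
    (haM : ∀ y, |a y| ≤ M) {f : ℝ → ℝ} {C : ℝ≥0} (hf : LipschitzWith C f) {t : ℝ} (ht : 0 ≤ t) :
    Integrable (fun ω => f (X t ω)) P := by
  refine ((hX.integrable_comp_sub ha haM hf le_rfl ht).add (integrable_const (f x))).congr
    (ae_of_all _ fun ω => ?_)
  simp [hX.init]

theorem abs_integral_comp_sub_le (hX : IsPathwiseDiffusion P a x W X) (ha : Continuous a)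
    (haM : ∀ y, |a y| ≤ M) {f : ℝ → ℝ} {C : ℝ≥0} (hf : LipschitzWith C f) {s t : ℝ} (hs : 0 ≤ s)
    (hst : s ≤ t) :
    |(∫ ω, f (X t ω) ∂P) - ∫ ω, f (X s ω) ∂P| ≤
      C * (M * (t - s) + √(t - s) * gaussAbsMoment 1) := by
  rw [← integral_sub (hX.integrable_comp ha haM hf (hs.trans hst))
    (hX.integrable_comp ha haM hf hs)]
  calc _ ≤ ∫ ω, |f (X t ω) - f (X s ω)| ∂P := abs_integral_le_integral_abs
    _ ≤ ∫ ω, C * |X t ω - X s ω| ∂P :=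
      integral_mono (hX.integrable_comp_sub ha haM hf hs hst).abs
        ((hX.integrable_sub ha haM hs hst).abs.const_mul _) fun ω => hf.dist_le_mul _ _
    _ ≤ _ := by
      rw [integral_const_mul]
      gcongr
      exact hX.integral_abs_sub_le ha haM hs hst

theorem continuousOn_integral_comp (hX : IsPathwiseDiffusion P a x W X) (ha : Continuous a)
    (haM : ∀ y, |a y| ≤ M) {f : ℝ → ℝ} {C : ℝ≥0} (hf : LipschitzWith C f) :
    ContinuousOn (fun t => ∫ ω, f (X t ω) ∂P) (Ici 0) := by
  intro t ht
  rw [ContinuousWithinAt, tendsto_iff_dist_tendsto_zero]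
  have hlim : Tendsto (fun s => C * (M * |s - t| + √|s - t| * gaussAbsMoment 1))
      (𝓝[Ici 0] t) (𝓝 0) := by
    have : Continuous fun s => C * (M * |s - t| + √|s - t| * gaussAbsMoment 1) := by fun_prop
    have := (this.tendsto t).mono_left (nhdsWithin_le_nhds (s := Ici 0))
    simpa using this
  refine squeeze_zero' (Eventually.of_forall fun _ => dist_nonneg) ?_ hlim
  filter_upwards [self_mem_nhdsWithin] with s hs
  rw [Real.dist_eq]
  rcases le_total s t with hst | hst
  · rw [abs_sub_comm, abs_sub_comm s t, abs_of_nonneg (sub_nonneg.2 hst)]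
    exact hX.abs_integral_comp_sub_le ha haM hf hs hst
  · rw [abs_of_nonneg (sub_nonneg.2 hst)]
    exact hX.abs_integral_comp_sub_le ha haM hf ht hst

theorem continuousOn_integral_comp_of_bounded (hX : IsPathwiseDiffusion P a x W X)
    {g : ℝ → ℝ} (hg : Continuous g) {B : ℝ} (hB : ∀ y, |g y| ≤ B) (T : ℝ) :
    ContinuousOn (fun t => ∫ ω, g (X t ω) ∂P) (Icc 0 T) := by
  refine continuousOn_of_dominated (bound := fun _ => B) (fun t ht => ?_)
    (fun t _ => ae_of_all _ fun ω => hB _) (integrable_const _) (ae_of_all _ fun ω => ?_)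
  · exact (hg.measurable.comp (hX.measX t ht.1)).aestronglyMeasurable
  · exact hg.comp_continuousOn (hX.sol ω T).cont

end IsPathwiseDiffusion

theorem lipschitzWith_of_hasDerivAt_abs_le {f f' : ℝ → ℝ} (hf : ∀ y, HasDerivAt f (f' y) y)
    {C : ℝ} (hC : ∀ y, |f' y| ≤ C) : LipschitzWith C.toNNReal f := by
  refine lipschitzWith_of_nnnorm_deriv_le (fun y => (hf y).differentiableAt) fun y => ?_
  rw [(hf y).deriv, ← NNReal.coe_le_coe, Real.coe_toNNReal _ ((abs_nonneg _).trans (hC 0))]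
  exact hC y

namespace IsPathwiseDiffusion

variable {Ω : Type*} [MeasurableSpace Ω] {P : Measure Ω}
  {a : ℝ → ℝ} {x : ℝ} {W X : ℝ → Ω → ℝ} {M : ℝ}

theorem abs_taylor_le {f f₁ f₂ : ℝ → ℝ} {K : ℝ≥0} {C₂ : ℝ} (hf : ∀ y, HasDerivAt f (f₁ y) y)
    (hf₁ : ∀ y, HasDerivAt f₁ (f₂ y) y) (hC₂ : ∀ y, |f₂ y| ≤ C₂) (hK : LipschitzWith K f₂)
    (y : ℝ) {r N b : ℝ} (hr : |r| ≤ b) :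
    |f (y + (r + N)) - f y - f₁ y * r - f₁ y * N - f₂ y * N ^ 2 / 2| ≤
      4 * K * b ^ 3 + C₂ * b ^ 2 / 2 + 4 * K * |N| ^ 3 + C₂ * b * |N| := by
  have hb : 0 ≤ b := (abs_nonneg _).trans hr
  have hC0 : 0 ≤ C₂ := (abs_nonneg _).trans (hC₂ 0)
  have h1 := abs_sub_taylor_two_le hf hf₁ hK y (r + N)
  have h2 : |r + N| ^ 3 ≤ 4 * (b ^ 3 + |N| ^ 3) := by
    have h3 : |r + N| ^ 3 ≤ (b + |N|) ^ 3 := by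
      gcongr
      exact (abs_add_le _ _).trans (by gcongr)
    nlinarith [mul_nonneg (add_nonneg hb (abs_nonneg N)) (sq_nonneg (b - |N|))]
  have h4 : |f₂ y * (r ^ 2 + 2 * r * N) / 2| ≤ C₂ * (b ^ 2 + 2 * b * |N|) / 2 := by
    rw [abs_div, abs_mul, abs_two]
    have : |r ^ 2 + 2 * r * N| ≤ b ^ 2 + 2 * b * |N| := by
      refine (abs_add_le _ _).trans ?_
      rw [abs_pow, abs_mul, abs_mul, abs_two]
      gcongr
    gcongr
    exact hC₂ y
  have h5 : f (y + (r + N)) - f y - f₁ y * r - f₁ y * N - f₂ y * N ^ 2 / 2 =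
      (f (y + (r + N)) - f y - f₁ y * (r + N) - f₂ y * (r + N) ^ 2 / 2) +
      f₂ y * (r ^ 2 + 2 * r * N) / 2 := by ring
  rw [h5]
  refine (abs_add_le _ _).trans ?_
  have h6 : (K:ℝ) * |r + N| ^ 3 ≤ K * (4 * (b ^ 3 + |N| ^ 3)) := by gcongr
  linarith

theorem integral_mul_incr (hX : IsPathwiseDiffusion P a x W X) {g u : ℝ → ℝ} (hg : Continuous g)
    (hu : Continuous u) {s t : ℝ} (hs : 0 ≤ s) (hst : s ≤ t) :
    ∫ ω, g (X s ω) * u (W t ω - W s ω) ∂P =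
      (∫ ω, g (X s ω) ∂P) * ∫ ω, u (W t ω - W s ω) ∂P :=
  (hX.indep s t hs hst).integral_fun_comp_mul_comp (hX.measX s hs).aemeasurable
    (hX.measurable_incr s t).aemeasurable hg.aestronglyMeasurable hu.aestronglyMeasurable

theorem measurable_drift (hX : IsPathwiseDiffusion P a x W X) (ha : Continuous a) {s t : ℝ}
    (hs : 0 ≤ s) (hst : s ≤ t) : Measurable fun ω => ∫ r in s..t, a (X r ω) := by
  have : (fun ω => ∫ r in s..t, a (X r ω)) = fun ω => X t ω - X s ω - (W t ω - W s ω) := by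
    funext ω; rw [hX.sub_eq ha hs hst]; ring
  rw [this]
  exact ((hX.measX t (hs.trans hst)).sub (hX.measX s hs)).sub (hX.measurable_incr s t)

variable [IsProbabilityMeasure P]

theorem abs_integral_taylor_le (hX : IsPathwiseDiffusion P a x W X) (ha : Continuous a)
    (haM : ∀ y, |a y| ≤ M) {f f₁ f₂ : ℝ → ℝ} {K : ℝ≥0} {C₁ C₂ : ℝ}
    (hf : ∀ y, HasDerivAt f (f₁ y) y) (hf₁ : ∀ y, HasDerivAt f₁ (f₂ y) y)
    (hC₁ : ∀ y, |f₁ y| ≤ C₁) (hC₂ : ∀ y, |f₂ y| ≤ C₂) (hK : LipschitzWith K f₂) {t z : ℝ}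
    (ht : 0 ≤ t) (htz : t ≤ z) :
    |(∫ ω, f (X z ω) ∂P) - (∫ ω, f (X t ω) ∂P) - (∫ ω, f₁ (X t ω) * (∫ r in t..z, a (X r ω)) ∂P)
      - (z - t) * ∫ ω, f₂ (X t ω) / 2 ∂P| ≤
      4 * K * (M * (z - t)) ^ 3 + C₂ * (M * (z - t)) ^ 2 / 2 +
        4 * K * (√(z - t) ^ 3 * gaussAbsMoment 3) +
        C₂ * (M * (z - t)) * (√(z - t) * gaussAbsMoment 1) := by
  have hfl := lipschitzWith_of_hasDerivAt_abs_le hf hC₁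
  have hc₁ : Continuous f₁ := (lipschitzWith_of_hasDerivAt_abs_le hf₁ hC₂).continuous
  have hm₁ := (hc₁.measurable.comp (hX.measX t ht)).aestronglyMeasurable (μ := P)
  have hm₂ := (hK.continuous.measurable.comp (hX.measX t ht)).aestronglyMeasurable (μ := P)
  have hz := hX.integrable_comp ha haM hfl (ht.trans htz)
  have ht' := hX.integrable_comp ha haM hfl ht
  have hρ : Integrable (fun ω => f₁ (X t ω) * (∫ r in t..z, a (X r ω))) P := by
    refine Integrable.bdd_mul (c := C₁) ?_ hm₁ (ae_of_all _ fun ω => hC₁ _)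
    refine (integrable_const (M * (z - t))).mono'
      (hX.measurable_drift ha ht htz).aestronglyMeasurable
      (ae_of_all _ fun ω => abs_integral_comp_le haM htz)
  have hN : Integrable (fun ω => f₁ (X t ω) * (W z ω - W t ω)) P :=
    Integrable.bdd_mul (c := C₁) (hX.integrable_incr ht htz) hm₁ (ae_of_all _ fun ω => hC₁ _)
  have hN2 : Integrable (fun ω => f₂ (X t ω) * (W z ω - W t ω) ^ 2) P := by
    refine Integrable.bdd_mul (c := C₂) ?_ hm₂ (ae_of_all _ fun ω => hC₂ _)
    simpa using hX.integrable_incr_abs_pow ht htz 2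
  have e1 : ∫ ω, f₁ (X t ω) * (W z ω - W t ω) ∂P = 0 := by
    have h := hX.integral_mul_incr hc₁ continuous_id ht htz
    simp only [id] at h
    rw [h, integral_of_map_eq_gaussianReal (hX.measurable_incr t z).aemeasurable
      (hX.gauss t z ht htz), mul_zero]
  have e2 : ∫ ω, f₂ (X t ω) * (W z ω - W t ω) ^ 2 / 2 ∂P =
      (z - t) * ∫ ω, f₂ (X t ω) / 2 ∂P := by
    rw [integral_div, hX.integral_mul_incr hK.continuous (continuous_pow 2) ht htz,
      integral_sq_of_map_eq_gaussianReal (hX.measurable_incr t z).aemeasurable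
        (sub_nonneg.2 htz) (hX.gauss t z ht htz), integral_div]
    ring
  rw [← e2]
  have j1 : Integrable (fun ω => f (X z ω) - f (X t ω)) P := hz.sub ht'
  have j2 : Integrable (fun ω => f (X z ω) - f (X t ω)
      - f₁ (X t ω) * (∫ r in t..z, a (X r ω))) P := j1.sub hρ
  have j3 : Integrable (fun ω => f (X z ω) - f (X t ω)
      - f₁ (X t ω) * (∫ r in t..z, a (X r ω)) - f₁ (X t ω) * (W z ω - W t ω)) P := j2.sub hN
  have e3 : (∫ ω, f (X z ω) ∂P) - (∫ ω, f (X t ω) ∂P) -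
      (∫ ω, f₁ (X t ω) * (∫ r in t..z, a (X r ω)) ∂P)
      - (∫ ω, f₂ (X t ω) * (W z ω - W t ω) ^ 2 / 2 ∂P) =
      ∫ ω, (f (X z ω) - f (X t ω) - f₁ (X t ω) * (∫ r in t..z, a (X r ω))
        - f₁ (X t ω) * (W z ω - W t ω) - f₂ (X t ω) * (W z ω - W t ω) ^ 2 / 2) ∂P := by
    rw [integral_sub j3 (hN2.div_const 2), integral_sub j2 hN, integral_sub j1 hρ,
      integral_sub hz ht', e1, sub_zero]
  rw [e3]
  have i3 := hX.integrable_incr_abs_pow ht htz 3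
  have i1 := (hX.integrable_incr ht htz).abs
  have m1 := hX.integral_incr_abs_pow ht htz 1
  simp only [pow_one] at m1
  rw [← m1, ← hX.integral_incr_abs_pow ht htz 3, ← integral_const_mul, ← integral_const_mul]
  refine abs_integral_le_integral_abs.trans ?_
  have j4 : Integrable (fun ω => (4 * K * (M * (z - t)) ^ 3 + C₂ * (M * (z - t)) ^ 2 / 2) +
      4 * K * |W z ω - W t ω| ^ 3) P := (integrable_const _).add (i3.const_mul _)
  calc _ ≤ ∫ ω, ((4 * K * (M * (z - t)) ^ 3 + C₂ * (M * (z - t)) ^ 2 / 2) +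
        4 * K * |W z ω - W t ω| ^ 3 + C₂ * (M * (z - t)) * |W z ω - W t ω|) ∂P := by
        refine integral_mono
          (j3.sub (hN2.div_const 2)).abs
          (j4.add (i1.const_mul _)) fun ω => ?_
        have h1 : X z ω = X t ω + ((∫ r in t..z, a (X r ω)) + (W z ω - W t ω)) := by
          rw [← hX.sub_eq ha ht htz]; ring
        have := abs_taylor_le hf hf₁ hC₂ hK (X t ω) (N := W z ω - W t ω)
          (abs_integral_comp_le (φ := fun r => X r ω) haM htz)
        rw [← h1] at this
        exact this
    _ = _ := by
      rw [integral_add j4 (i1.const_mul _), integral_add (integrable_const _) (i3.const_mul _)]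
      simp

theorem tendsto_integral_drift (hX : IsPathwiseDiffusion P a x W X) (ha : Continuous a)
    (haM : ∀ y, |a y| ≤ M) {g : ℝ → ℝ} (hg : Continuous g) {C : ℝ} (hC : ∀ y, |g y| ≤ C) {t : ℝ}
    (ht : 0 ≤ t) :
    Tendsto (fun z => ∫ ω, g (X t ω) * ((∫ r in t..z, a (X r ω)) / (z - t)) ∂P) (𝓝[>] t)
      (𝓝 (∫ ω, g (X t ω) * a (X t ω) ∂P)) := by
  have hM : 0 ≤ M := (abs_nonneg _).trans (haM 0)
  refine tendsto_integral_filter_of_dominated_convergence (fun _ => C * M) ?_ ?_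
    (integrable_const _) (ae_of_all _ fun ω => ?_)
  · filter_upwards [self_mem_nhdsWithin] with z hz
    exact ((hg.measurable.comp (hX.measX t ht)).mul
      ((hX.measurable_drift ha ht (le_of_lt hz)).div_const _)).aestronglyMeasurable
  · filter_upwards [self_mem_nhdsWithin] with z hz
    have hz' : 0 < z - t := sub_pos.2 hz
    refine ae_of_all _ fun ω => ?_
    rw [Real.norm_eq_abs, abs_mul, abs_div, abs_of_pos hz']
    have := abs_integral_comp_le (φ := fun r => X r ω) haM (le_of_lt hz)
    gcongr
    · exact (abs_nonneg _).trans (hC 0)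
    · exact hC _
    · rwa [div_le_iff₀ hz']
  · refine Tendsto.const_mul _ ?_
    have hcont : ContinuousOn (fun r => a (X r ω)) (Icc 0 (t + 1)) :=
      ha.comp_continuousOn (hX.sol ω (t + 1)).cont
    have hcw : ContinuousWithinAt (fun r => a (X r ω)) (Ioi t) t :=
      ((hcont t ⟨ht, by linarith⟩).mono (Icc_subset_Icc_left ht)).mono_of_mem_nhdsWithin
        (mem_of_superset (Ioc_mem_nhdsGT (by linarith : t < t + 1)) Ioc_subset_Icc_self)
    have hd : HasDerivWithinAt (fun z => ∫ r in t..z, a (X r ω)) (a (X t ω)) (Ici t) t := by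
      refine intervalIntegral.integral_hasDerivWithinAt_right (by simp) ?_ hcw
      refine ⟨Ioc t (t + 1), Ioc_mem_nhdsGT (by linarith), ?_⟩
      exact (hcont.mono (fun r hr => ⟨ht.trans hr.1.le, hr.2⟩)).aestronglyMeasurable
        measurableSet_Ioc
    have := (hasDerivWithinAt_iff_tendsto_slope' (by simp)).1 hd.Ioi_of_Ici
    refine this.congr fun z => ?_
    simp [slope_def_field]

theorem hasDerivWithinAt_integral_comp (hX : IsPathwiseDiffusion P a x W X) (ha : Continuous a)
    (haM : ∀ y, |a y| ≤ M) {f f₁ f₂ : ℝ → ℝ} {K : ℝ≥0} {C₁ C₂ : ℝ}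
    (hf : ∀ y, HasDerivAt f (f₁ y) y) (hf₁ : ∀ y, HasDerivAt f₁ (f₂ y) y)
    (hC₁ : ∀ y, |f₁ y| ≤ C₁) (hC₂ : ∀ y, |f₂ y| ≤ C₂) (hK : LipschitzWith K f₂) {t : ℝ}
    (ht : 0 ≤ t) :
    HasDerivWithinAt (fun t => ∫ ω, f (X t ω) ∂P)
      (∫ ω, (f₁ (X t ω) * a (X t ω) + f₂ (X t ω) / 2) ∂P) (Ioi t) t := by
  have hc₁ : Continuous f₁ := (lipschitzWith_of_hasDerivAt_abs_le hf₁ hC₂).continuous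
  have hm₁ := (hc₁.measurable.comp (hX.measX t ht)).aestronglyMeasurable (μ := P)
  have hm₂ := (hK.continuous.measurable.comp (hX.measX t ht)).aestronglyMeasurable (μ := P)
  rw [hasDerivWithinAt_iff_tendsto_slope' (by simp)]
  have i2 : Integrable (fun ω => f₂ (X t ω) / 2) P :=
    ((integrable_const C₂).mono' hm₂ (ae_of_all _ fun ω => hC₂ _)).div_const 2
  have i1 : Integrable (fun ω => f₁ (X t ω) * a (X t ω)) P :=
    Integrable.bdd_mul (c := C₁) ((integrable_const M).mono'
      (ha.measurable.comp (hX.measX t ht)).aestronglyMeasurable (ae_of_all _ fun ω => haM _)) hm₁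
      (ae_of_all _ fun ω => hC₁ _)
  rw [integral_add i1 i2]
  have h1 := (hX.tendsto_integral_drift ha haM hc₁ hC₁ ht).add_const (∫ ω, f₂ (X t ω) / 2 ∂P)
  have hlim : Tendsto (fun z => 4 * K * M ^ 3 * (z - t) ^ 2 + C₂ * M ^ 2 * (z - t) / 2 +
        4 * K * (√(z - t) * gaussAbsMoment 3) +
        C₂ * M * (√(z - t) * gaussAbsMoment 1)) (𝓝[>] t) (𝓝 0) := by
    have hcont : Continuous fun z => 4 * K * M ^ 3 * (z - t) ^ 2 + C₂ * M ^ 2 * (z - t) / 2 +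
        4 * K * (√(z - t) * gaussAbsMoment 3) +
        C₂ * M * (√(z - t) * gaussAbsMoment 1) := by fun_prop
    have := (hcont.tendsto t).mono_left (nhdsWithin_le_nhds (s := Ioi t))
    simpa using this
  refine tendsto_of_tendsto_of_dist h1 ?_
  refine squeeze_zero' (Eventually.of_forall fun _ => dist_nonneg) ?_ hlim
  filter_upwards [self_mem_nhdsWithin] with z hz
  have hz' : 0 < z - t := sub_pos.2 hz
  have h2 := hX.abs_integral_taylor_le ha haM hf hf₁ hC₁ hC₂ hK ht (le_of_lt hz)
  rw [dist_comm, Real.dist_eq, slope_def_field]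
  have e : ∫ ω, f₁ (X t ω) * ((∫ r in t..z, a (X r ω)) / (z - t)) ∂P =
      (∫ ω, f₁ (X t ω) * (∫ r in t..z, a (X r ω)) ∂P) / (z - t) := by
    rw [← integral_div]; congr 1; funext ω; ring
  rw [e]
  generalize (∫ ω, f₁ (X t ω) * (∫ r in t..z, a (X r ω)) ∂P) = A at *
  generalize ∫ ω, f₂ (X t ω) / 2 ∂P = B at *
  generalize ∫ ω, f (X z ω) ∂P = F at *
  generalize ∫ ω, f (X t ω) ∂P = G at *
  have e2 : (F - G) / (z - t) - (A / (z - t) + B) = (F - G - A - (z - t) * B) / (z - t) := by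
    field_simp
    ring
  rw [e2, abs_div, abs_of_pos hz', div_le_iff₀ hz']
  refine h2.trans_eq ?_
  have hs : √(z - t) ^ 3 = √(z - t) * (z - t) := by
    rw [pow_succ, Real.sq_sqrt hz'.le, mul_comm]
  rw [hs]
  ring

/-- The Dynkin formula. -/
theorem integral_comp_sub_eq (hX : IsPathwiseDiffusion P a x W X) (ha : Continuous a)
    (haM : ∀ y, |a y| ≤ M) {f f₁ f₂ : ℝ → ℝ} {K : ℝ≥0} {C₁ C₂ : ℝ}
    (hf : ∀ y, HasDerivAt f (f₁ y) y) (hf₁ : ∀ y, HasDerivAt f₁ (f₂ y) y)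
    (hC₁ : ∀ y, |f₁ y| ≤ C₁) (hC₂ : ∀ y, |f₂ y| ≤ C₂) (hK : LipschitzWith K f₂) {T : ℝ}
    (hT : 0 ≤ T) :
    (∫ ω, f (X T ω) ∂P) - f x =
      ∫ s in (0:ℝ)..T, ∫ ω, (f₁ (X s ω) * a (X s ω) + f₂ (X s ω) / 2) ∂P := by
  have hM : 0 ≤ M := (abs_nonneg _).trans (haM 0)
  have hc₁ : Continuous f₁ := (lipschitzWith_of_hasDerivAt_abs_le hf₁ hC₂).continuous
  have hfl := lipschitzWith_of_hasDerivAt_abs_le hf hC₁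
  have hb : ∀ y, |f₁ y * a y + f₂ y / 2| ≤ C₁ * M + C₂ / 2 := fun y => by
    refine (abs_add_le _ _).trans ?_
    rw [abs_mul, abs_div, abs_two]
    have := hC₁ y
    have := haM y
    have := hC₂ y
    have : 0 ≤ C₁ := (abs_nonneg _).trans (hC₁ 0)
    gcongr
  have hcb := hX.continuousOn_integral_comp_of_bounded
    (g := fun y => f₁ y * a y + f₂ y / 2) (by have := hK.continuous; fun_prop) hb T
  have := intervalIntegral.integral_eq_sub_of_hasDeriv_right_of_le hT
    ((hX.continuousOn_integral_comp ha haM hfl).mono (fun t ht => ht.1))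
    (fun t ht => hX.hasDerivWithinAt_integral_comp ha haM hf hf₁ hC₁ hC₂ hK ht.1.le)
    (by rw [← uIcc_of_le hT] at hcb; exact hcb.intervalIntegrable)
  rw [this]
  simp [hX.init]

end IsPathwiseDiffusion

theorem integral_eq_integral_clamp {g : ℝ → ℝ} (hg : Continuous g) {R : ℝ}
    (hR : ∀ y, R ≤ |y| → g y = 0) {c : ℝ} (hc : c ∈ Icc (-R) R) (y : ℝ) :
    ∫ z in c..y, g z = ∫ z in c..(max (-R) (min R y)), g z := by
  have hi : ∀ p q, IntervalIntegrable g volume p q := fun p q => hg.intervalIntegrable p q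
  have hR0 : -R ≤ R := hc.1.trans hc.2
  rw [← intervalIntegral.integral_add_adjacent_intervals (hi c (max (-R) (min R y))) (hi _ y)]
  rw [add_eq_left]
  refine intervalIntegral.integral_zero_ae (ae_of_all _ fun z hz => hR z ?_)
  rw [le_abs]
  rcases le_total y R with h1 | h1
  · rw [min_eq_right h1] at hz
    rcases le_total (-R) y with h2 | h2
    · rw [max_eq_right h2] at hz; simp at hz
    · rw [max_eq_left h2, uIoc_of_ge h2] at hz
      exact Or.inr (by linarith [hz.2])
  · rw [min_eq_left h1, max_eq_right hR0, uIoc_of_le h1] at hz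
    exact Or.inl hz.1.le

theorem clamp_mem {R : ℝ} (hR : 0 ≤ R) (y : ℝ) : max (-R) (min R y) ∈ Icc (-R) R :=
  ⟨le_max_left _ _, max_le (by linarith) (min_le_left _ _)⟩

theorem abs_integral_le_of_support {g : ℝ → ℝ} (hg : Continuous g) {R M : ℝ} (hR0 : 0 ≤ R)
    (hR : ∀ y, R ≤ |y| → g y = 0) (hM : ∀ y, |g y| ≤ M) (y : ℝ) :
    |∫ z in (0:ℝ)..y, g z| ≤ M * R := by
  rw [integral_eq_integral_clamp hg hR ⟨by linarith, hR0⟩]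
  have h1 := intervalIntegral.norm_integral_le_of_norm_le_const (a := 0)
    (b := max (-R) (min R y)) (f := g) (C := M) fun z _ => hM z
  refine h1.trans ?_
  have := (abs_nonneg _).trans (hM 0)
  have h2 := clamp_mem hR0 y
  rw [sub_zero]
  gcongr
  exact abs_le.2 h2

theorem hasDerivAt_integral_of_continuous {g : ℝ → ℝ} (hg : Continuous g) (c y : ℝ) :
    HasDerivAt (fun y => ∫ z in c..y, g z) (g y) y :=
  intervalIntegral.integral_hasDerivAt_right (hg.intervalIntegrable _ _)
    (hg.stronglyMeasurableAtFilter _ _) hg.continuousAt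

namespace IsPathwiseDiffusion

variable {Ω : Type*} [MeasurableSpace Ω] {P : Measure Ω} [IsProbabilityMeasure P]
  {a : ℝ → ℝ} {x : ℝ} {W X : ℝ → Ω → ℝ} {M : ℝ}

/-- The expected occupation measure up to time `T` has a density bounded by a constant that depends
only on `T` and on the bound of the drift. -/
theorem integral_occupation_le (hX : IsPathwiseDiffusion P a x W X) (ha : Continuous a)
    (haM : ∀ y, |a y| ≤ M) {g : ℝ → ℝ} {K : ℝ≥0} {B R : ℝ} (hg : LipschitzWith K g)
    (hg0 : ∀ y, 0 ≤ g y) (hB : ∀ y, |g y| ≤ B) (hR0 : 0 ≤ R) (hR : ∀ y, R ≤ |y| → g y = 0)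
    {T : ℝ} (hT : 0 ≤ T) :
    ∫ s in (0:ℝ)..T, ∫ ω, g (X s ω) ∂P ≤
      2 * (2 * M * T + √T * gaussAbsMoment 1) * ∫ y in (-R)..R, g y := by
  set I := ∫ y in (-R)..R, g y
  set f₁ : ℝ → ℝ := fun y => ∫ z in (-R)..y, g z
  have hI0 : 0 ≤ I := intervalIntegral.integral_nonneg (by linarith) fun y _ => hg0 y
  have hf₁ : ∀ y, HasDerivAt f₁ (g y) y := hasDerivAt_integral_of_continuous hg.continuous _
  have hf₁m : Monotone f₁ := monotone_of_deriv_nonneg (fun y => (hf₁ y).differentiableAt)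
    fun y => by rw [(hf₁ y).deriv]; exact hg0 y
  have hf₁I : ∀ y, |f₁ y| ≤ I := fun y => by
    have h1 : f₁ y = f₁ (max (-R) (min R y)) :=
      integral_eq_integral_clamp hg.continuous hR ⟨le_rfl, by linarith⟩ y
    have h2 := clamp_mem hR0 y
    rw [h1, abs_le]
    refine ⟨?_, hf₁m h2.2⟩
    have : f₁ (-R) = 0 := by simp [f₁]
    have := hf₁m h2.1
    linarith
  have hc₁ : Continuous f₁ := (lipschitzWith_of_hasDerivAt_abs_le hf₁ hB).continuous
  have hf : ∀ y, HasDerivAt (fun y => ∫ z in (0:ℝ)..y, f₁ z) (f₁ y) y :=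
    hasDerivAt_integral_of_continuous hc₁ _
  set f : ℝ → ℝ := fun y => ∫ z in (0:ℝ)..y, f₁ z
  have hfl := lipschitzWith_of_hasDerivAt_abs_le hf hf₁I
  have h1 := hX.integral_comp_sub_eq ha haM hf hf₁ hf₁I hB hg hT
  have h2 := hX.abs_integral_comp_sub_le ha haM hfl le_rfl hT
  simp only [hX.init, sub_zero, integral_const, probReal_univ, one_smul,
    Real.coe_toNNReal _ hI0] at h2
  have hb : ∀ y, |f₁ y * a y + g y / 2| ≤ I * M + B / 2 := fun y => by
    refine (abs_add_le _ _).trans ?_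
    rw [abs_mul, abs_div, abs_two]
    have := hf₁I y
    have := haM y
    have := hB y
    gcongr
  have c1 := hX.continuousOn_integral_comp_of_bounded
    (g := fun y => f₁ y * a y + g y / 2) (by have := hg.continuous; fun_prop) hb T
  have c2 := hX.continuousOn_integral_comp_of_bounded hg.continuous hB T
  rw [← uIcc_of_le hT] at c1 c2
  have h3 : ∫ s in (0:ℝ)..T, ((∫ ω, g (X s ω) ∂P) / 2 - I * M) ≤
      ∫ s in (0:ℝ)..T, ∫ ω, (f₁ (X s ω) * a (X s ω) + g (X s ω) / 2) ∂P := by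
    refine intervalIntegral.integral_mono_on hT
      ((c2.intervalIntegrable.div_const 2).sub intervalIntegrable_const) c1.intervalIntegrable
      fun s hs => ?_
    have m : ∀ {u : ℝ → ℝ}, Continuous u → AEStronglyMeasurable (fun ω => u (X s ω)) P :=
      fun hu => (hu.measurable.comp (hX.measX s hs.1)).aestronglyMeasurable
    have i1 : Integrable (fun ω => g (X s ω)) P :=
      (integrable_const B).mono' (m hg.continuous) (ae_of_all _ fun ω => hB _)
    have i2 : Integrable (fun ω => f₁ (X s ω) * a (X s ω) + g (X s ω) / 2) P :=
      (integrable_const _).mono'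
        (m (u := fun y => f₁ y * a y + g y / 2) (by have := hg.continuous; fun_prop))
        (ae_of_all _ fun ω => hb _)
    have : (∫ ω, g (X s ω) ∂P) / 2 - I * M = ∫ ω, (g (X s ω) / 2 - I * M) ∂P := by
      rw [integral_sub (i1.div_const 2) (integrable_const _), integral_div]
      simp
    rw [this]
    refine integral_mono ((i1.div_const 2).sub (integrable_const _)) i2 fun ω => ?_
    have h4 : |f₁ (X s ω) * a (X s ω)| ≤ I * M := by
      rw [abs_mul]
      have := hf₁I (X s ω)
      have := haM (X s ω)
      gcongr
    have := (abs_le.1 h4).1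
    dsimp only
    linarith
  rw [← h1, intervalIntegral.integral_sub (c2.intervalIntegrable.div_const 2)
    intervalIntegrable_const, intervalIntegral.integral_div, intervalIntegral.integral_const] at h3
  simp only [sub_zero, smul_eq_mul] at h3
  have := (abs_le.1 h2).2
  linarith

end IsPathwiseDiffusion

/-- The derivative of the scale function of the drift `a`. -/
def scaleDeriv (a : ℝ → ℝ) (y : ℝ) : ℝ := Real.exp (-2 * ∫ z in (0:ℝ)..y, a z)

/-- The scale function of the drift `a`. -/
def scaleFun (a : ℝ → ℝ) (y : ℝ) : ℝ := ∫ z in (0:ℝ)..y, scaleDeriv a z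

section scale

variable {a : ℝ → ℝ} {M R : ℝ} {L : ℝ≥0}

theorem hasDerivAt_scaleDeriv (ha : Continuous a) (y : ℝ) :
    HasDerivAt (scaleDeriv a) (-2 * a y * scaleDeriv a y) y :=
  (((hasDerivAt_integral_of_continuous ha 0 y).const_mul (-2)).exp).congr_deriv
    (by rw [scaleDeriv]; ring)

theorem continuous_scaleDeriv (ha : Continuous a) : Continuous (scaleDeriv a) :=
  continuous_iff_continuousAt.2 fun y => (hasDerivAt_scaleDeriv ha y).continuousAt

theorem hasDerivAt_scaleFun (ha : Continuous a) (y : ℝ) :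
    HasDerivAt (scaleFun a) (scaleDeriv a y) y :=
  hasDerivAt_integral_of_continuous (continuous_scaleDeriv ha) 0 y

theorem scaleDeriv_pos (a : ℝ → ℝ) (y : ℝ) : 0 < scaleDeriv a y := Real.exp_pos _

theorem scaleDeriv_mem_Icc (ha : Continuous a) (haM : ∀ y, |a y| ≤ M) (hR0 : 0 ≤ R)
    (hR : ∀ y, R ≤ |y| → a y = 0) (y : ℝ) :
    scaleDeriv a y ∈ Icc (Real.exp (-(2 * (M * R)))) (Real.exp (2 * (M * R))) := by
  have := abs_le.1 (abs_integral_le_of_support ha hR0 hR haM y)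
  exact ⟨Real.exp_le_exp.2 (by linarith), Real.exp_le_exp.2 (by linarith)⟩

theorem le_scaleFun_sub (ha : Continuous a) (haM : ∀ y, |a y| ≤ M) (hR0 : 0 ≤ R)
    (hR : ∀ y, R ≤ |y| → a y = 0) {y z : ℝ} (hyz : y ≤ z) :
    Real.exp (-(2 * (M * R))) * (z - y) ≤ scaleFun a z - scaleFun a y := by
  refine Convex.mul_sub_le_image_sub_of_le_deriv convex_univ
    (fun y _ => (hasDerivAt_scaleFun ha y).continuousAt.continuousWithinAt)
    (fun y _ => (hasDerivAt_scaleFun ha y).differentiableAt.differentiableWithinAt)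
    (fun y _ => ?_) y trivial z trivial hyz
  rw [(hasDerivAt_scaleFun ha y).deriv]
  exact (scaleDeriv_mem_Icc ha haM hR0 hR y).1

theorem abs_scaleDeriv_le (ha : Continuous a) (haM : ∀ y, |a y| ≤ M) (hR0 : 0 ≤ R)
    (hR : ∀ y, R ≤ |y| → a y = 0) (y : ℝ) : |scaleDeriv a y| ≤ Real.exp (2 * (M * R)) := by
  rw [abs_of_pos (scaleDeriv_pos a y)]
  exact (scaleDeriv_mem_Icc ha haM hR0 hR y).2

theorem abs_scaleDeriv_deriv_le (ha : Continuous a) (haM : ∀ y, |a y| ≤ M) (hR0 : 0 ≤ R)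
    (hR : ∀ y, R ≤ |y| → a y = 0) (y : ℝ) :
    |-2 * a y * scaleDeriv a y| ≤ 2 * M * Real.exp (2 * (M * R)) := by
  rw [abs_mul, abs_mul, abs_neg, abs_two]
  have := haM y
  have := abs_scaleDeriv_le ha haM hR0 hR y
  have : 0 ≤ M := (abs_nonneg _).trans (haM 0)
  gcongr

theorem exists_lipschitzWith_scaleDeriv_deriv (ha : LipschitzWith L a) (haM : ∀ y, |a y| ≤ M)
    (hR0 : 0 ≤ R) (hR : ∀ y, R ≤ |y| → a y = 0) :
    ∃ K, LipschitzWith K fun y => -2 * a y * scaleDeriv a y := by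
  have hM : 0 ≤ M := (abs_nonneg _).trans (haM 0)
  set E := Real.exp (2 * (M * R))
  have hE : 0 < E := Real.exp_pos _
  have hl := lipschitzWith_of_hasDerivAt_abs_le (hasDerivAt_scaleDeriv ha.continuous)
    (abs_scaleDeriv_deriv_le ha.continuous haM hR0 hR)
  refine ⟨(2 * (M * (2 * M * E) + L * E)).toNNReal, LipschitzWith.of_dist_le_mul fun y z => ?_⟩
  have h1 := hl.dist_le_mul y z
  have h2 := ha.dist_le_mul y z
  rw [Real.coe_toNNReal _ (by positivity)] at h1 ⊢
  rw [Real.dist_eq] at h1 h2 ⊢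
  have e : -2 * a y * scaleDeriv a y - -2 * a z * scaleDeriv a z =
      -2 * (a y * (scaleDeriv a y - scaleDeriv a z) + (a y - a z) * scaleDeriv a z) := by ring
  rw [e, abs_mul, abs_neg, abs_two]
  have h3 : |a y * (scaleDeriv a y - scaleDeriv a z) + (a y - a z) * scaleDeriv a z| ≤
      M * (2 * M * E * dist y z) + L * dist y z * E := by
    refine (abs_add_le _ _).trans ?_
    rw [abs_mul, abs_mul]
    have := haM y
    have := abs_scaleDeriv_le ha.continuous haM hR0 hR z
    gcongr
  linarith

end scale

namespace IsPathwiseDiffusion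

variable {Ω : Type*} [MeasurableSpace Ω] {P : Measure Ω} [IsProbabilityMeasure P]
  {a b : ℝ → ℝ} {x : ℝ} {W X Y : ℝ → Ω → ℝ} {M R : ℝ} {L L' : ℝ≥0}

theorem integral_scaleFun_sub_eq (hX : IsPathwiseDiffusion P b x W X) (hb : Continuous b)
    (hbM : ∀ y, |b y| ≤ M) (ha : LipschitzWith L a) (haM : ∀ y, |a y| ≤ M) (hR0 : 0 ≤ R)
    (hR : ∀ y, R ≤ |y| → a y = 0) {T : ℝ} (hT : 0 ≤ T) :
    (∫ ω, scaleFun a (X T ω) ∂P) - scaleFun a x =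
      ∫ s in (0:ℝ)..T, ∫ ω, scaleDeriv a (X s ω) * (b (X s ω) - a (X s ω)) ∂P := by
  obtain ⟨K, hK⟩ := exists_lipschitzWith_scaleDeriv_deriv ha haM hR0 hR
  rw [hX.integral_comp_sub_eq hb hbM (hasDerivAt_scaleFun ha.continuous)
    (hasDerivAt_scaleDeriv ha.continuous) (abs_scaleDeriv_le ha.continuous haM hR0 hR)
    (abs_scaleDeriv_deriv_le ha.continuous haM hR0 hR) hK hT]
  refine intervalIntegral.integral_congr fun s _ => integral_congr_ae (ae_of_all _ fun ω => ?_)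
  ring

theorem integral_sub_le (hX : IsPathwiseDiffusion P a x W X) (hY : IsPathwiseDiffusion P b x W Y)
    (ha : LipschitzWith L a) (hb : LipschitzWith L' b) (haM : ∀ y, |a y| ≤ M)
    (hbM : ∀ y, |b y| ≤ M) (hab : ∀ y, a y ≤ b y) (hR0 : 0 ≤ R)
    (hRa : ∀ y, R ≤ |y| → a y = 0) (hRb : ∀ y, R ≤ |y| → b y = 0) {T : ℝ} (hT : 0 ≤ T) :
    ∫ ω, (Y T ω - X T ω) ∂P ≤ Real.exp (4 * (M * R)) *
      (2 * (2 * M * T + √T * gaussAbsMoment 1)) * ∫ y in (-R)..R, (b y - a y) := by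
  have hM : 0 ≤ M := (abs_nonneg _).trans (haM 0)
  set E := Real.exp (2 * (M * R))
  have hE : 0 < E := Real.exp_pos _
  have hle : ∀ ω, X T ω ≤ Y T ω := fun ω =>
    (hX.sol ω T).le_of_le (hY.sol ω T) ha ((hY.sol ω T).intervalIntegrable hb.continuous hT)
      (fun s _ => hab _) T ⟨hT, le_rfl⟩
  have hSl := lipschitzWith_of_hasDerivAt_abs_le (hasDerivAt_scaleFun ha.continuous)
    (abs_scaleDeriv_le ha.continuous haM hR0 hRa)
  have iY := hY.integrable_comp hb.continuous hbM hSl hT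
  have iX := hX.integrable_comp ha.continuous haM hSl hT
  have iYX : Integrable (fun ω => Y T ω - X T ω) P :=
    (hY.integrable_comp hb.continuous hbM LipschitzWith.id hT).sub
      (hX.integrable_comp ha.continuous haM LipschitzWith.id hT)
  have h1 := hX.integral_scaleFun_sub_eq ha.continuous haM ha haM hR0 hRa hT
  have h2 := hY.integral_scaleFun_sub_eq hb.continuous hbM ha haM hR0 hRa hT
  simp only [sub_self, mul_zero, integral_zero, intervalIntegral.integral_zero] at h1
  have h3 : Real.exp (-(2 * (M * R))) * ∫ ω, (Y T ω - X T ω) ∂P ≤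
      ∫ s in (0:ℝ)..T, ∫ ω, scaleDeriv a (Y s ω) * (b (Y s ω) - a (Y s ω)) ∂P := by
    rw [← h2, ← sub_eq_zero.1 h1, ← integral_sub iY iX, ← integral_const_mul]
    exact integral_mono (iYX.const_mul _) (iY.sub iX) fun ω =>
      le_scaleFun_sub ha.continuous haM hR0 hRa (hle ω)
  have hg0 : ∀ y, 0 ≤ b y - a y := fun y => sub_nonneg.2 (hab y)
  have hgB : ∀ y, |b y - a y| ≤ M + M := fun y =>
    (abs_sub _ _).trans (add_le_add (hbM y) (haM y))
  have hgl : LipschitzWith (L' + L) fun y => b y - a y := hb.sub ha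
  have hocc := hY.integral_occupation_le hb.continuous hbM hgl hg0 hgB hR0
    (fun y hy => by rw [hRa y hy, hRb y hy, sub_zero]) hT
  have hsb : ∀ y, |scaleDeriv a y * (b y - a y)| ≤ E * (M + M) := fun y => by
    rw [abs_mul]
    have := abs_scaleDeriv_le ha.continuous haM hR0 hRa y
    have := hgB y
    gcongr
  have hsc : Continuous fun y => scaleDeriv a y * (b y - a y) :=
    (continuous_scaleDeriv ha.continuous).mul hgl.continuous
  have c1 := hY.continuousOn_integral_comp_of_bounded hsc hsb T
  have c2 := hY.continuousOn_integral_comp_of_bounded hgl.continuous hgB T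
  rw [← uIcc_of_le hT] at c1 c2
  have h4 : ∫ s in (0:ℝ)..T, ∫ ω, scaleDeriv a (Y s ω) * (b (Y s ω) - a (Y s ω)) ∂P ≤
      E * ∫ s in (0:ℝ)..T, ∫ ω, (b (Y s ω) - a (Y s ω)) ∂P := by
    rw [← intervalIntegral.integral_const_mul]
    refine intervalIntegral.integral_mono_on hT c1.intervalIntegrable
      (c2.intervalIntegrable.const_mul _) fun s hs => ?_
    have m : ∀ {u : ℝ → ℝ}, Continuous u → AEStronglyMeasurable (fun ω => u (Y s ω)) P :=
      fun hu => (hu.measurable.comp (hY.measX s hs.1)).aestronglyMeasurable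
    rw [← integral_const_mul]
    refine integral_mono
      ((integrable_const _).mono' (m hsc) (ae_of_all _ fun ω => hsb _))
      (((integrable_const _).mono' (m hgl.continuous) (ae_of_all _ fun ω => hgB _)).const_mul _)
      fun ω => ?_
    exact mul_le_mul_of_nonneg_right (scaleDeriv_mem_Icc ha.continuous haM hR0 hRa _).2 (hg0 _)
  have h5 := h3.trans (h4.trans (mul_le_mul_of_nonneg_left hocc hE.le))
  have h6 := mul_le_mul_of_nonneg_left h5 hE.le
  have e1 : E * Real.exp (-(2 * (M * R))) = 1 := by
    rw [← Real.exp_add]; simp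
  have e2 : E * E = Real.exp (4 * (M * R)) := by
    rw [← Real.exp_add]; ring_nf
  rw [← mul_assoc, e1, one_mul, ← mul_assoc, e2] at h6
  exact h6.trans_eq (by ring)

end IsPathwiseDiffusion

/-- The solution driven by `v` whose drift is the `(k + 1)`-Lipschitz minorant of `β`. -/
def lowerSol (β : ℝ → ℝ) (x : ℝ) (v : ℝ → ℝ) (k : ℕ) : ℝ → ℝ :=
  eulerLim (lipMinorant β (k + 1)) x v

/-- The solution driven by `v` whose drift is the `(k + 1)`-Lipschitz majorant of `β`. -/
def upperSol (β : ℝ → ℝ) (x : ℝ) (v : ℝ → ℝ) (k : ℕ) : ℝ → ℝ :=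
  eulerLim (lipMajorant β (k + 1)) x v

/-- The limit of the lower approximations. -/
def midSol (β : ℝ → ℝ) (x : ℝ) (v : ℝ → ℝ) (t : ℝ) : ℝ :=
  limsup (fun k => lowerSol β x v k t) atTop

/-- The gap between the Lipschitz envelopes of `β`. -/
def lipGap (β : ℝ → ℝ) (k : ℕ) (y : ℝ) : ℝ := lipMajorant β (k + 1) y - lipMinorant β (k + 1) y

section sandwich

variable {β v : ℝ → ℝ} {M x : ℝ}

theorem lowerSol_solvesOn (hM : ∀ y, |β y| ≤ M) (hv : Continuous v) (x : ℝ) (k : ℕ) (T : ℝ) :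
    SolvesOn (lipMinorant β (k + 1)) x v T (lowerSol β x v k) :=
  eulerLim_solvesOn (lipschitzWith_lipMinorant hM _) (abs_lipMinorant_le hM _) hv x T

theorem upperSol_solvesOn (hM : ∀ y, |β y| ≤ M) (hv : Continuous v) (x : ℝ) (k : ℕ) (T : ℝ) :
    SolvesOn (lipMajorant β (k + 1)) x v T (upperSol β x v k) :=
  eulerLim_solvesOn (lipschitzWith_lipMajorant hM _) (abs_lipMajorant_le hM _) hv x T

theorem lowerSol_le_of_solvesOn (hM : ∀ y, |β y| ≤ M) (hv : Continuous v) {α ψ : ℝ → ℝ} {T : ℝ}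
    (hψ : SolvesOn α x v T ψ) (hα : IntervalIntegrable (fun s => α (ψ s)) volume 0 T)
    (k : ℕ) (h : ∀ s ∈ Icc 0 T, lipMinorant β (k + 1) (ψ s) ≤ α (ψ s)) {t : ℝ} (ht : t ∈ Icc 0 T) :
    lowerSol β x v k t ≤ ψ t :=
  (lowerSol_solvesOn hM hv x k T).le_of_le hψ (lipschitzWith_lipMinorant hM _) hα h t ht

theorem le_upperSol_of_solvesOn (hM : ∀ y, |β y| ≤ M) (hv : Continuous v) {α ψ : ℝ → ℝ} {T : ℝ}
    (hψ : SolvesOn α x v T ψ) (hα : IntervalIntegrable (fun s => α (ψ s)) volume 0 T)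
    (k : ℕ) (h : ∀ s ∈ Icc 0 T, α (ψ s) ≤ lipMajorant β (k + 1) (ψ s)) {t : ℝ} (ht : t ∈ Icc 0 T) :
    ψ t ≤ upperSol β x v k t :=
  (upperSol_solvesOn hM hv x k T).ge_of_ge hψ (lipschitzWith_lipMajorant hM _) hα h t ht

theorem monotone_lowerSol (hM : ∀ y, |β y| ≤ M) (hv : Continuous v) {t : ℝ} (ht : 0 ≤ t) :
    Monotone fun k => lowerSol β x v k t := fun k l hkl =>
  lowerSol_le_of_solvesOn hM hv (lowerSol_solvesOn hM hv x l t)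
    ((lowerSol_solvesOn hM hv x l t).intervalIntegrable
      (lipschitzWith_lipMinorant hM _).continuous ht) k
    (fun s _ => lipMinorant_mono hM (by lia) _) ⟨ht, le_rfl⟩

theorem antitone_upperSol (hM : ∀ y, |β y| ≤ M) (hv : Continuous v) {t : ℝ} (ht : 0 ≤ t) :
    Antitone fun k => upperSol β x v k t := fun k l hkl =>
  le_upperSol_of_solvesOn hM hv (upperSol_solvesOn hM hv x l t)
    ((upperSol_solvesOn hM hv x l t).intervalIntegrable
      (lipschitzWith_lipMajorant hM _).continuous ht) k
    (fun s _ => lipMajorant_anti hM (by lia) _) ⟨ht, le_rfl⟩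

theorem lowerSol_le_upperSol (hM : ∀ y, |β y| ≤ M) (hv : Continuous v) {t : ℝ} (ht : 0 ≤ t)
    (k l : ℕ) : lowerSol β x v k t ≤ upperSol β x v l t :=
  lowerSol_le_of_solvesOn hM hv (upperSol_solvesOn hM hv x l t)
    ((upperSol_solvesOn hM hv x l t).intervalIntegrable
      (lipschitzWith_lipMajorant hM _).continuous ht) k
    (fun _ _ => (lipMinorant_le hM _ _).trans (le_lipMajorant hM _ _)) ⟨ht, le_rfl⟩

theorem tendsto_lowerSol (hM : ∀ y, |β y| ≤ M) (hv : Continuous v) {t : ℝ} (ht : 0 ≤ t) :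
    Tendsto (fun k => lowerSol β x v k t) atTop (𝓝 (midSol β x v t)) := by
  have h := tendsto_atTop_ciSup (monotone_lowerSol (x := x) hM hv ht)
    ⟨upperSol β x v 0 t, by rintro _ ⟨k, rfl⟩; exact lowerSol_le_upperSol hM hv ht k 0⟩
  rw [midSol, h.limsup_eq]
  exact h

theorem abs_lowerSol_sub_le (hM : ∀ y, |β y| ≤ M) (hv : Continuous v) (k : ℕ) {s t : ℝ}
    (hs : 0 ≤ s) (hst : s ≤ t) :
    |lowerSol β x v k t - lowerSol β x v k s - (v t - v s)| ≤ M * (t - s) := by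
  have h := lowerSol_solvesOn hM hv x k t
  rw [h.sub_eq (h.intervalIntegrable (lipschitzWith_lipMinorant hM _).continuous (hs.trans hst))
    hs hst le_rfl, add_sub_cancel_right]
  exact abs_integral_comp_le (abs_lipMinorant_le hM _) hst

theorem abs_upperSol_sub_le (hM : ∀ y, |β y| ≤ M) (hv : Continuous v) (k : ℕ) {s t : ℝ}
    (hs : 0 ≤ s) (hst : s ≤ t) :
    |upperSol β x v k t - upperSol β x v k s - (v t - v s)| ≤ M * (t - s) := by
  have h := upperSol_solvesOn hM hv x k t
  rw [h.sub_eq (h.intervalIntegrable (lipschitzWith_lipMajorant hM _).continuous (hs.trans hst))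
    hs hst le_rfl, add_sub_cancel_right]
  exact abs_integral_comp_le (abs_lipMajorant_le hM _) hst

theorem tendsto_upperSol_sub_lowerSol_of_rat (hM : ∀ y, |β y| ≤ M) (hv : Continuous v)
    (h : ∀ q : ℚ, (0:ℝ) ≤ q →
      Tendsto (fun k => upperSol β x v k q - lowerSol β x v k q) atTop (𝓝 0))
    {t : ℝ} (ht : 0 ≤ t) :
    Tendsto (fun k => upperSol β x v k t - lowerSol β x v k t) atTop (𝓝 0) := by
  have hM0 : 0 ≤ M := (abs_nonneg _).trans (hM 0)
  rw [Metric.tendsto_atTop]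
  intro ε hε
  obtain ⟨q, hq1, hq2⟩ := exists_rat_btwn (show t < t + ε / (4 * (M + 1)) by
    have : 0 < ε / (4 * (M + 1)) := by positivity
    linarith)
  obtain ⟨N, hN⟩ := Metric.tendsto_atTop.1 (h q (ht.trans hq1.le)) (ε / 2) (half_pos hε)
  refine ⟨N, fun k hk => ?_⟩
  have h1 := (abs_le.1 (abs_lowerSol_sub_le (x := x) hM hv k ht hq1.le)).2
  have h2 := (abs_le.1 (abs_upperSol_sub_le (x := x) hM hv k ht hq1.le)).1
  have h3 := hN k hk
  have h4 := lowerSol_le_upperSol (x := x) hM hv ht k k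
  rw [Real.dist_eq, sub_zero, abs_lt] at h3
  rw [Real.dist_eq, sub_zero, abs_of_nonneg (sub_nonneg.2 h4)]
  have h5 : M * (q - t) ≤ ε / 4 := by
    calc M * (q - t) ≤ (M + 1) * (ε / (4 * (M + 1))) := by
          gcongr
          · linarith
          · linarith
      _ = ε / 4 := by field_simp
  linarith [h3.2]

/-- The approximations from below and from above of the solution with drift `β` driven by `v` have
the same limit, and this limit spends no time where the envelopes of `β` do not meet. -/
structure IsSqueezed (β : ℝ → ℝ) (x : ℝ) (v : ℝ → ℝ) : Prop where
  tendsto_sub : ∀ t, 0 ≤ t → Tendsto (fun k => upperSol β x v k t - lowerSol β x v k t) atTop (𝓝 0)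
  ae_tendsto : ∀ n : ℕ, ∀ᵐ s ∂volume.restrict (Icc 0 (n:ℝ)),
    Tendsto (fun m => lipGap β m (midSol β x v s)) atTop (𝓝 0)

theorem IsSqueezed.eq_midSol (h : IsSqueezed β x v) (hM : ∀ y, |β y| ≤ M) (hv : Continuous v)
    {α ψ : ℝ → ℝ} {T : ℝ} (hψ : SolvesOn α x v T ψ)
    (hα : IntervalIntegrable (fun s => α (ψ s)) volume 0 T)
    (hαβ : ∀ s ∈ Icc 0 T, α (ψ s) = β (ψ s)) {t : ℝ} (ht : t ∈ Icc 0 T) :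
    ψ t = midSol β x v t := by
  have h1 := tendsto_lowerSol (x := x) hM hv ht.1
  have h2 := (h.tendsto_sub t ht.1).add h1
  simp only [sub_add_cancel, zero_add] at h2
  refine le_antisymm (ge_of_tendsto' h2 fun k => ?_) (le_of_tendsto' h1 fun k => ?_)
  · exact le_upperSol_of_solvesOn hM hv hψ hα k
      (fun s hs => (hαβ s hs).trans_le (le_lipMajorant hM _ _)) ht
  · exact lowerSol_le_of_solvesOn hM hv hψ hα k
      (fun s hs => (lipMinorant_le hM _ _).trans_eq (hαβ s hs).symm) ht

theorem tendsto_lipMinorant_comp (hM : ∀ y, |β y| ≤ M) {u : ℕ → ℝ} {l : ℝ}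
    (hu : Tendsto u atTop (𝓝 l)) (hgap : Tendsto (fun m => lipGap β m l) atTop (𝓝 0)) :
    Tendsto (fun k => lipMinorant β (k + 1) (u k)) atTop (𝓝 (β l)) := by
  rw [Metric.tendsto_atTop]
  intro ε hε
  obtain ⟨m, hm⟩ := (hgap.eventually (gt_mem_nhds (half_pos hε))).exists
  have h1 := ((lipschitzWith_lipMinorant hM (m + 1)).continuous.tendsto l).comp hu
  have h2 := ((lipschitzWith_lipMajorant hM (m + 1)).continuous.tendsto l).comp hu
  have e1 := h1.eventually (lt_mem_nhds (sub_lt_self _ (half_pos hε)))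
  have e2 := h2.eventually (gt_mem_nhds (lt_add_of_pos_right _ (half_pos hε)))
  refine eventually_atTop.1 ?_
  filter_upwards [e1, e2, eventually_ge_atTop m] with k e1 e2 hk
  simp only [Function.comp_apply] at e1 e2
  have h3 := lipMinorant_mono hM (Nat.succ_le_succ hk) (u k)
  have h4 := (lipMinorant_le hM (k + 1) (u k)).trans (le_lipMajorant hM (m + 1) (u k))
  have h5 := lipMinorant_le hM (m + 1) l
  have h6 := le_lipMajorant hM (m + 1) l
  simp only [lipGap, Nat.succ_eq_add_one] at hm h3
  rw [Real.dist_eq, abs_lt]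
  constructor <;> linarith

theorem IsSqueezed.solvesOn (h : IsSqueezed β x v) (hM : ∀ y, |β y| ≤ M) (hv : Continuous v)
    (T : ℝ) : SolvesOn β x v T (midSol β x v) := by
  obtain ⟨n, hn⟩ := exists_nat_ge T
  have hae : ∀ t ∈ Icc 0 T, ∀ᵐ s ∂volume.restrict (Ioc 0 t),
      Tendsto (fun k => lipMinorant β (k + 1) (lowerSol β x v k s)) atTop
        (𝓝 (β (midSol β x v s))) := by
    intro t ht
    have hsub : Ioc 0 t ⊆ Icc 0 (n:ℝ) := fun s hs => ⟨hs.1.le, hs.2.trans (ht.2.trans hn)⟩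
    filter_upwards [ae_restrict_of_ae_restrict_of_subset hsub (h.ae_tendsto n),
      ae_restrict_mem measurableSet_Ioc] with s h1 hs
    exact tendsto_lipMinorant_comp hM (tendsto_lowerSol hM hv hs.1.le) h1
  have hmeas : ∀ t ∈ Icc 0 T, ∀ k, AEStronglyMeasurable
      (fun s => lipMinorant β (k + 1) (lowerSol β x v k s)) (volume.restrict (Ioc 0 t)) := by
    intro t ht k
    exact (((lipschitzWith_lipMinorant hM _).continuous.comp_continuousOn
      (lowerSol_solvesOn hM hv x k t).cont).mono Ioc_subset_Icc_self).aestronglyMeasurable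
      measurableSet_Ioc
  have heqn : ∀ t ∈ Icc 0 T,
      midSol β x v t = x + (∫ s in (0:ℝ)..t, β (midSol β x v s)) + v t := by
    intro t ht
    refine tendsto_nhds_unique (tendsto_lowerSol (x := x) hM hv ht.1) ?_
    have h1 : Tendsto (fun k => ∫ s in (0:ℝ)..t, lipMinorant β (k + 1) (lowerSol β x v k s)) atTop
        (𝓝 (∫ s in (0:ℝ)..t, β (midSol β x v s))) := by
      refine intervalIntegral.tendsto_integral_filter_of_dominated_convergence (fun _ => M)
        (Eventually.of_forall fun k => ?_) (Eventually.of_forall fun k => ?_)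
        intervalIntegrable_const ?_
      · rw [uIoc_of_le ht.1]
        exact hmeas t ht k
      · exact ae_of_all _ fun s _ => abs_lipMinorant_le hM _ _
      · rw [uIoc_of_le ht.1]
        exact (ae_restrict_iff' measurableSet_Ioc).1 (hae t ht)
    refine ((h1.const_add x).add_const (v t)).congr fun k => ?_
    exact ((lowerSol_solvesOn hM hv x k t).eqn t ⟨ht.1, le_rfl⟩).symm
  refine ⟨?_, heqn⟩
  rcases lt_or_ge T 0 with hT | hT
  · rw [Icc_eq_empty (not_le.2 hT)]; exact continuousOn_empty _
  have hi : IntegrableOn (fun s => β (midSol β x v s)) (uIcc 0 T) := by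
    rw [uIcc_of_le hT, integrableOn_Icc_iff_integrableOn_Ioc]
    exact (integrable_const M).mono'
      (aestronglyMeasurable_of_tendsto_ae atTop (hmeas T ⟨hT, le_rfl⟩) (hae T ⟨hT, le_rfl⟩))
      (ae_of_all _ fun s => hM _)
  have hp := intervalIntegral.continuousOn_primitive_interval hi
  rw [uIcc_of_le hT] at hp
  exact ((hp.const_add x).add hv.continuousOn).congr heqn

end sandwich

theorem continuousOn_Ici_of_forall_Icc {φ : ℝ → ℝ} {c : ℝ}
    (h : ∀ T, ContinuousOn φ (Icc c T)) : ContinuousOn φ (Ici c) := by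
  intro t ht
  refine (h (t + 1) t ⟨ht, by linarith⟩).mono_of_mem_nhdsWithin ?_
  filter_upwards [self_mem_nhdsWithin, nhdsWithin_le_nhds (Iio_mem_nhds (lt_add_one t))]
    with s hs hs'
  exact ⟨hs, le_of_lt hs'⟩

theorem ae_tendsto_zero_of_antitone {Ω : Type*} [MeasurableSpace Ω] {P : Measure Ω}
    {f : ℕ → Ω → ℝ} (hf : ∀ k, AEMeasurable (f k) P) (h0 : ∀ k ω, 0 ≤ f k ω)
    (hanti : ∀ ω, Antitone fun k => f k ω) {c : ℕ → ℝ} (hc : Tendsto c atTop (𝓝 0))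
    (hle : ∀ k, ∫⁻ ω, ENNReal.ofReal (f k ω) ∂P ≤ ENNReal.ofReal (c k)) :
    ∀ᵐ ω ∂P, Tendsto (fun k => f k ω) atTop (𝓝 0) := by
  have hm : AEMeasurable (fun ω => ⨅ k, ENNReal.ofReal (f k ω)) P :=
    AEMeasurable.iInf fun k => (hf k).ennreal_ofReal
  have hc' : Tendsto (fun k => ENNReal.ofReal (c k)) atTop (𝓝 0) := by
    simpa [Function.comp_def] using (ENNReal.continuous_ofReal.tendsto 0).comp hc
  have hz : ∫⁻ ω, ⨅ k, ENNReal.ofReal (f k ω) ∂P = 0 := by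
    refine le_antisymm (ge_of_tendsto' hc' fun k => ?_) zero_le
    exact (lintegral_mono fun ω => iInf_le _ k).trans (hle k)
  filter_upwards [(lintegral_eq_zero_iff' hm).1 hz] with ω hω
  have h1 : Tendsto (fun k => ENNReal.ofReal (f k ω)) atTop (𝓝 0) := by
    have := tendsto_atTop_iInf (f := fun k => ENNReal.ofReal (f k ω))
      fun k l hkl => ENNReal.ofReal_le_ofReal (hanti ω hkl)
    rwa [show (⨅ k, ENNReal.ofReal (f k ω)) = 0 from hω] at this
  have h2 := (ENNReal.tendsto_toReal ENNReal.zero_ne_top).comp h1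
  simpa [Function.comp_def, ENNReal.toReal_ofReal (h0 _ ω)] using h2

namespace IsPathwiseDiffusion

variable {Ω : Type*} [MeasurableSpace Ω] {P : Measure Ω}
  {a : ℝ → ℝ} {x : ℝ} {W X : ℝ → Ω → ℝ} {M : ℝ}

theorem measurable_uncurry (hX : IsPathwiseDiffusion P a x W X) :
    Measurable fun z : Ω × ℝ => X (max z.2 0) z.1 := by
  have h := measurable_uncurry_of_continuous_of_measurable (u := fun (s : ℝ) ω => X (max s 0) ω)
    (fun ω => ?_) fun s => hX.measX _ (le_max_right _ _)
  · exact h.comp measurable_swap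
  · exact (continuousOn_Ici_of_forall_Icc fun T => (hX.sol ω T).cont).comp_continuous
      (by fun_prop) fun s => mem_Ici.2 (le_max_right _ _)

theorem lintegral_occupation_le [IsProbabilityMeasure P] (hX : IsPathwiseDiffusion P a x W X)
    (ha : Continuous a) (haM : ∀ y, |a y| ≤ M) {g : ℝ → ℝ} {K : ℝ≥0} {B R : ℝ}
    (hg : LipschitzWith K g) (hg0 : ∀ y, 0 ≤ g y) (hB : ∀ y, |g y| ≤ B) (hR0 : 0 ≤ R)
    (hR : ∀ y, R ≤ |y| → g y = 0) {T : ℝ} (hT : 0 ≤ T) :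
    ∫⁻ z, ENNReal.ofReal (g (X (max z.2 0) z.1)) ∂(P.prod (volume.restrict (Icc 0 T))) ≤
      ENNReal.ofReal (2 * (2 * M * T + √T * gaussAbsMoment 1) * ∫ y in (-R)..R, g y) := by
  have hm : Measurable fun z : Ω × ℝ => ENNReal.ofReal (g (X (max z.2 0) z.1)) :=
    (hg.continuous.measurable.comp hX.measurable_uncurry).ennreal_ofReal
  rw [lintegral_prod_symm _ hm.aemeasurable]
  have c1 := hX.continuousOn_integral_comp_of_bounded hg.continuous hB T
  have h1 : ∀ s ∈ Icc 0 T, ∫⁻ ω, ENNReal.ofReal (g (X (max s 0) ω)) ∂P =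
      ENNReal.ofReal (∫ ω, g (X s ω) ∂P) := by
    intro s hs
    rw [max_eq_left hs.1, ofReal_integral_eq_lintegral_ofReal _ (ae_of_all _ fun ω => hg0 _)]
    exact (integrable_const B).mono'
      (hg.continuous.measurable.comp (hX.measX s hs.1)).aestronglyMeasurable
      (ae_of_all _ fun ω => hB _)
  rw [setLIntegral_congr_fun measurableSet_Icc h1,
    ← ofReal_integral_eq_lintegral_ofReal (c1.integrableOn_compact isCompact_Icc)
      (ae_of_all _ fun s => integral_nonneg fun ω => hg0 _),
    integral_Icc_eq_integral_Ioc, ← intervalIntegral.integral_of_le hT]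
  exact ENNReal.ofReal_le_ofReal
    (hX.integral_occupation_le ha haM hg hg0 hB hR0 hR hT)

end IsPathwiseDiffusion

section gap

variable {β : ℝ → ℝ} {M : ℝ}

theorem lipGap_nonneg (hM : ∀ y, |β y| ≤ M) (k : ℕ) (y : ℝ) : 0 ≤ lipGap β k y :=
  sub_nonneg.2 ((lipMinorant_le hM _ _).trans (le_lipMajorant hM _ _))

theorem antitone_lipGap (hM : ∀ y, |β y| ≤ M) (y : ℝ) : Antitone fun k => lipGap β k y :=
  fun _ _ hkl => sub_le_sub (lipMajorant_anti hM (by lia) y) (lipMinorant_mono hM (by lia) y)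

theorem abs_lipGap_le (hM : ∀ y, |β y| ≤ M) (k : ℕ) (y : ℝ) : |lipGap β k y| ≤ M + M :=
  (abs_sub _ _).trans (add_le_add (abs_lipMajorant_le hM _ _) (abs_lipMinorant_le hM _ _))

theorem lipschitzWith_lipGap (hM : ∀ y, |β y| ≤ M) (k : ℕ) :
    LipschitzWith ((k + 1 : ℕ) + (k + 1 : ℕ)) (lipGap β k) :=
  (lipschitzWith_lipMajorant hM _).sub (lipschitzWith_lipMinorant hM _)

end gap

section squeeze

variable {Ω : Type*} [MeasurableSpace Ω] {P : Measure Ω} [IsProbabilityMeasure P]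
  {β : ℝ → ℝ} {M R x : ℝ} {W : ℝ → Ω → ℝ}

theorem ae_isSqueezed (hM : ∀ y, |β y| ≤ M) (hR0 : 0 ≤ R) (hR : ∀ y, R < |y| → β y = 0)
    (hc : {y | ¬ ContinuousAt β y}.Countable) (hW : ∀ ω, Continuous fun t => W t ω)
    (hL : ∀ k, IsPathwiseDiffusion P (lipMinorant β (k + 1)) x W
      fun t ω => lowerSol β x (fun t => W t ω) k t)
    (hU : ∀ k, IsPathwiseDiffusion P (lipMajorant β (k + 1)) x W
      fun t ω => upperSol β x (fun t => W t ω) k t) :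
    ∀ᵐ ω ∂P, IsSqueezed β x fun t => W t ω := by
  have hM0 : 0 ≤ M := (abs_nonneg _).trans (hM 0)
  set S := R + M + 1
  have hS0 : 0 ≤ S := by positivity
  have hmin : ∀ k y, S ≤ |y| → lipMinorant β (k + 1) y = 0 := fun k y hy =>
    lipMinorant_eq_zero hM hR (by lia) (by linarith)
  have hmaj : ∀ k y, S ≤ |y| → lipMajorant β (k + 1) y = 0 := fun k y hy =>
    lipMajorant_eq_zero hM hR (by lia) (by linarith)
  have hgap : ∀ k y, S ≤ |y| → lipGap β k y = 0 := fun k y hy => by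
    rw [lipGap, hmin k y hy, hmaj k y hy, sub_zero]
  have hI : Tendsto (fun k => ∫ y in (-S)..S, lipGap β k y) atTop (𝓝 0) :=
    (tendsto_integral_lipMajorant_sub_lipMinorant hM hc S).comp (tendsto_add_atTop_nat 1)
  have h1 : ∀ q : ℚ, ∀ᵐ ω ∂P, (0:ℝ) ≤ q → Tendsto (fun k => upperSol β x (fun t => W t ω) k q -
      lowerSol β x (fun t => W t ω) k q) atTop (𝓝 0) := by
    intro q
    by_cases hq : (0:ℝ) ≤ q
    swap
    · exact ae_of_all _ fun ω h => absurd h hq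
    have hnn : ∀ k ω, 0 ≤ upperSol β x (fun t => W t ω) k q - lowerSol β x (fun t => W t ω) k q :=
      fun k ω => sub_nonneg.2 (lowerSol_le_upperSol hM (hW ω) hq k k)
    have hlim := hI.const_mul (Real.exp (4 * (M * S)) *
      (2 * (2 * M * q + √q * gaussAbsMoment 1)))
    rw [mul_zero] at hlim
    have := ae_tendsto_zero_of_antitone (P := P)
      (f := fun k ω => upperSol β x (fun t => W t ω) k q - lowerSol β x (fun t => W t ω) k q)
      (fun k => (((hU k).measX q hq).sub ((hL k).measX q hq)).aemeasurable) hnn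
      (fun ω k l hkl => sub_le_sub (antitone_upperSol hM (hW ω) hq hkl)
        (monotone_lowerSol hM (hW ω) hq hkl)) hlim fun k => ?_
    · filter_upwards [this] with ω h _ using h
    · have ha := lipschitzWith_lipMinorant hM (k + 1)
      have hb := lipschitzWith_lipMajorant hM (k + 1)
      rw [← ofReal_integral_eq_lintegral_ofReal _ (ae_of_all _ fun ω => hnn k ω)]
      · exact ENNReal.ofReal_le_ofReal ((hL k).integral_sub_le (hU k) ha hb
          (abs_lipMinorant_le hM _) (abs_lipMajorant_le hM _)
          (fun y => (lipMinorant_le hM _ _).trans (le_lipMajorant hM _ _)) hS0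
          (hmin k) (hmaj k) hq)
      · exact ((hU k).integrable_comp hb.continuous (abs_lipMajorant_le hM _)
          LipschitzWith.id hq).sub ((hL k).integrable_comp ha.continuous
          (abs_lipMinorant_le hM _) LipschitzWith.id hq)
  have h2 : ∀ n : ℕ, ∀ᵐ ω ∂P, ∀ᵐ s ∂volume.restrict (Icc 0 (n:ℝ)),
      Tendsto (fun m => lipGap β m (midSol β x (fun t => W t ω) s)) atTop (𝓝 0) := by
    intro n
    have hn : (0:ℝ) ≤ n := n.cast_nonneg
    have hlm : ∀ k, Measurable fun z : Ω × ℝ => lowerSol β x (fun t => W t z.1) k (max z.2 0) :=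
      fun k => (hL k).measurable_uncurry
    have hmm : Measurable fun z : Ω × ℝ => midSol β x (fun t => W t z.1) (max z.2 0) :=
      Measurable.limsup hlm
    have hlim := hI.const_mul (2 * (2 * M * n + √n * gaussAbsMoment 1))
    rw [mul_zero] at hlim
    have := ae_tendsto_zero_of_antitone (P := P.prod (volume.restrict (Icc 0 (n:ℝ))))
      (f := fun m z => lipGap β m (midSol β x (fun t => W t z.1) (max z.2 0)))
      (fun m => ((lipschitzWith_lipGap hM m).continuous.measurable.comp hmm).aemeasurable)
      (fun m z => lipGap_nonneg hM _ _) (fun z => antitone_lipGap hM _) hlim fun m => ?_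
    · filter_upwards [Measure.ae_ae_of_ae_prod this] with ω h
      filter_upwards [h, ae_restrict_mem measurableSet_Icc] with s hs hs'
      simpa only [max_eq_left hs'.1] using hs
    · have hgc := (lipschitzWith_lipGap hM m).continuous
      have hpt : ∀ z : Ω × ℝ, ENNReal.ofReal
          (lipGap β m (midSol β x (fun t => W t z.1) (max z.2 0))) =
          liminf (fun k => ENNReal.ofReal
            (lipGap β m (lowerSol β x (fun t => W t z.1) k (max z.2 0)))) atTop := fun z =>
        (((ENNReal.continuous_ofReal.comp hgc).tendsto _).comp
          (tendsto_lowerSol hM (hW z.1) (le_max_right z.2 0))).liminf_eq.symm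
      simp only [hpt]
      refine (lintegral_liminf_le fun k =>
        (hgc.measurable.comp (hlm k)).ennreal_ofReal).trans ?_
      refine (liminf_le_liminf (Eventually.of_forall fun k =>
        (hL k).lintegral_occupation_le (lipschitzWith_lipMinorant hM _).continuous
          (abs_lipMinorant_le hM _) (lipschitzWith_lipGap hM m) (lipGap_nonneg hM m)
          (abs_lipGap_le hM m) hS0 (hgap m) hn)).trans ?_
      rw [liminf_const]
  filter_upwards [ae_all_iff.2 h1, ae_all_iff.2 h2] with ω h1 h2
  exact ⟨fun t ht => tendsto_upperSol_sub_lowerSol_of_rat hM (hW ω) h1 ht, h2⟩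

end squeeze

/-- A version of a Wiener process all of whose paths are continuous and start at `0`. -/
theorem IsWiener.exists_continuous_version {Ω : Type*} [MeasureSpace Ω] {w : ℝ → Ω → ℝ}
    (hw : IsWiener w) : ∃ W : ℝ → Ω → ℝ, (∀ t, Measurable (W t)) ∧ (∀ ω, W 0 ω = 0) ∧
      (∀ ω, Continuous fun t => W t ω) ∧
      ∀ᵐ ω ∂(ℙ : Measure Ω), (fun t => W t ω) = fun t => w t ω := by
  classical
  obtain ⟨N, hN, hNm, hN0⟩ := exists_measurable_superset_of_null
    (ae_iff.1 (hw.init.and hw.cont))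
  refine ⟨fun t => N.piecewise 0 (w t), fun t => measurable_const.piecewise hNm (hw.meas t),
    fun ω => ?_, fun ω => ?_, ?_⟩
  · by_cases hω : ω ∈ N
    · simp [hω]
    · have := not_not.1 fun h => hω (hN h)
      simp [hω, this.1]
  · by_cases hω : ω ∈ N
    · simp only [hω, piecewise_eq_of_mem]
      exact continuous_const
    · have := not_not.1 fun h => hω (hN h)
      simpa [hω] using this.2
  · filter_upwards [measure_eq_zero_iff_ae_notMem.1 hN0] with ω hω
    simp [hω]

theorem IsWiener.isPathwiseDiffusion {Ω : Type*} [MeasureSpace Ω] {w W : ℝ → Ω → ℝ}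
    (hw : IsWiener w) (hWm : ∀ t, Measurable (W t)) (hW0 : ∀ ω, W 0 ω = 0)
    (hWc : ∀ ω, Continuous fun t => W t ω)
    (hWw : ∀ᵐ ω ∂(ℙ : Measure Ω), (fun t => W t ω) = fun t => w t ω)
    {a : ℝ → ℝ} {K : ℝ≥0} {M : ℝ} (ha : LipschitzWith K a) (haM : ∀ y, |a y| ≤ M) (x : ℝ) :
    IsPathwiseDiffusion ℙ a x W fun t ω => eulerLim a x (fun t => W t ω) t where
  measW := hWm
  measX t ht := measurable_eulerLim ha.continuous.measurable x ht fun s _ => hWm s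
  initW := hW0
  sol ω T := eulerLim_solvesOn ha haM (hWc ω) x T
  gauss s t hs hst := by
    rw [← hw.gauss s t hs hst]
    refine Measure.map_congr ?_
    filter_upwards [hWw] with ω hω
    rw [congrFun hω t, congrFun hω s]
  indep s t hs hst := by
    have hle : MeasurableSpace.comap (fun ω => eulerLim a x (fun t => w t ω) s) inferInstance ≤
        natSigma w s := by
      refine Measurable.comap_le ?_
      refine measurable_eulerLim (m := natSigma w s) ha.continuous.measurable x hs fun r hr => ?_
      exact (comap_measurable (w r)).mono (le_iSup₂_of_le r hr le_rfl) le_rfl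
    have h1 : IndepFun (fun ω => eulerLim a x (fun t => w t ω) s)
        (fun ω => w t ω - w s ω) ℙ := by
      rw [IndepFun_iff_Indep]
      exact indep_of_indep_of_le_left (hw.indep s t hs hst).symm hle
    refine h1.congr ?_ ?_
    · filter_upwards [hWw] with ω hω
      rw [hω]
    · filter_upwards [hWw] with ω hω
      rw [congrFun hω t, congrFun hω s]

theorem measurable_midSol {Ω : Type*} {m : MeasurableSpace Ω} {β : ℝ → ℝ} {M : ℝ}
    (hM : ∀ y, |β y| ≤ M) (x : ℝ) {w : ℝ → Ω → ℝ} {t : ℝ} (ht : 0 ≤ t)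
    (hw : ∀ s ∈ Icc 0 t, Measurable (w s)) :
    Measurable fun ω => midSol β x (fun t => w t ω) t :=
  Measurable.limsup fun _ => measurable_eulerLim
    (lipschitzWith_lipMinorant hM _).continuous.measurable x ht hw

theorem IsWiener.ae_isSqueezed {Ω : Type*} [MeasureSpace Ω] {w : ℝ → Ω → ℝ} (hw : IsWiener w)
    {β : ℝ → ℝ} {M R : ℝ} (hM : ∀ y, |β y| ≤ M) (hR0 : 0 ≤ R) (hR : ∀ y, R < |y| → β y = 0)
    (hc : {y | ¬ ContinuousAt β y}.Countable) (x : ℝ) :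
    ∀ᵐ ω ∂(ℙ : Measure Ω), IsSqueezed β x fun t => w t ω := by
  have := hw.isProb
  obtain ⟨W, hWm, hW0, hWc, hWw⟩ := hw.exists_continuous_version
  filter_upwards [_root_.ae_isSqueezed (x := x) hM hR0 hR hc hWc
    (fun k => hw.isPathwiseDiffusion hWm hW0 hWc hWw
      (lipschitzWith_lipMinorant hM _) (abs_lipMinorant_le hM _) x)
    (fun k => hw.isPathwiseDiffusion hWm hW0 hWc hWw
      (lipschitzWith_lipMajorant hM _) (abs_lipMajorant_le hM _) x), hWw] with ω h1 h2
  rwa [h2] at h1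

theorem SolvesOn.abs_le_of_linear_growth {β v ψ : ℝ → ℝ} {x T A B : ℝ} (hψ : SolvesOn β x v T ψ)
    (hβ : ∀ y, |β y| ≤ A * (1 + |y|)) (hv : ∀ t ∈ Icc 0 T, |v t| ≤ B) {t : ℝ}
    (ht : t ∈ Icc 0 T) :
    |ψ t| ≤ (|x| + A * T + B) + A * gronwallBound 0 A (|x| + A * T + B) T := by
  have hA : 0 ≤ A := by
    have := (abs_nonneg _).trans (hβ 0)
    simpa using this
  have hT : 0 ≤ T := ht.1.trans ht.2
  have hB : 0 ≤ B := (abs_nonneg _).trans (hv 0 ⟨le_rfl, hT⟩)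
  set G := |x| + A * T + B
  have hG : 0 ≤ G := by positivity
  have hc : ContinuousOn (fun s => |ψ s|) (Icc 0 T) := hψ.cont.abs
  have hi : ∀ s ∈ Icc 0 T, IntervalIntegrable (fun s => |ψ s|) volume 0 s := fun s hs =>
    ContinuousOn.intervalIntegrable
      (hc.mono (by rw [uIcc_of_le hs.1]; exact Icc_subset_Icc_right hs.2))
  set u : ℝ → ℝ := fun t => ∫ s in (0:ℝ)..t, |ψ s|
  have hu0 : ∀ s ∈ Icc 0 T, 0 ≤ u s := fun s hs =>
    intervalIntegral.integral_nonneg hs.1 fun r _ => abs_nonneg _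
  have hbound : ∀ s ∈ Icc 0 T, |ψ s| ≤ G + A * u s := by
    intro s hs
    have hint : IntervalIntegrable (fun r => A * (1 + |ψ r|)) volume 0 s :=
      (intervalIntegrable_const.add (hi s hs)).const_mul A
    have h1 : ‖∫ r in (0:ℝ)..s, β (ψ r)‖ ≤ ∫ r in (0:ℝ)..s, A * (1 + |ψ r|) :=
      intervalIntegral.norm_integral_le_of_norm_le hs.1 (ae_of_all _ fun r _ => hβ (ψ r)) hint
    rw [intervalIntegral.integral_const_mul,
      intervalIntegral.integral_add intervalIntegrable_const (hi s hs), Real.norm_eq_abs] at h1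
    simp only [intervalIntegral.integral_const, sub_zero, smul_eq_mul, mul_one] at h1
    rw [hψ.eqn s hs]
    have h2 := hv s hs
    have h3 : A * s ≤ A * T := mul_le_mul_of_nonneg_left hs.2 hA
    have h4 := abs_add_le (x + ∫ r in (0:ℝ)..s, β (ψ r)) (v s)
    have h5 := abs_add_le x (∫ r in (0:ℝ)..s, β (ψ r))
    simp only [G, u]
    linarith
  have hgr := norm_le_gronwallBound_of_norm_deriv_right_le (f := u) (f' := fun s => |ψ s|)
    (δ := 0) (K := A) (ε := G) (a := 0) (b := T) ?_ ?_ (by simp [u]) ?_ t ht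
  · have h1 := gronwallBound_mono le_rfl hG hA ht.2
    rw [sub_zero, Real.norm_eq_abs] at hgr
    have h2 := (le_abs_self _).trans (hgr.trans h1)
    exact (hbound t ht).trans (by gcongr)
  · have := intervalIntegral.continuousOn_primitive_interval (f := fun s => |ψ s|) (a := 0) (b := T)
      (μ := volume) (by rw [uIcc_of_le hT]; exact hc.integrableOn_compact isCompact_Icc)
    rwa [uIcc_of_le hT] at this
  · intro s hs
    have hcw : ContinuousWithinAt (fun s => |ψ s|) (Ioi s) s :=
      ((hc s ⟨hs.1, hs.2.le⟩).mono (Icc_subset_Icc_left hs.1)).mono_of_mem_nhdsWithin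
        (mem_of_superset (Ioc_mem_nhdsGT hs.2) Ioc_subset_Icc_self)
    refine intervalIntegral.integral_hasDerivWithinAt_right (hi s ⟨hs.1, hs.2.le⟩) ?_ hcw
    refine ⟨Ioc s T, Ioc_mem_nhdsGT hs.2, ?_⟩
    exact (hc.mono fun r hr => ⟨hs.1.trans hr.1.le, hr.2⟩).aestronglyMeasurable measurableSet_Ioc
  · intro s hs
    have hs' : s ∈ Icc 0 T := ⟨hs.1, hs.2.le⟩
    simp only [Real.norm_eq_abs, abs_abs]
    rw [abs_of_nonneg (hu0 s hs')]
    linarith [hbound s hs']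

theorem intervalIntegrable_comp_of_bounded {α ψ : ℝ → ℝ} {T B : ℝ} (hα : Measurable α)
    (hψ : ContinuousOn ψ (Icc 0 T)) (hT : 0 ≤ T) (hB : ∀ s ∈ Icc 0 T, |α (ψ s)| ≤ B) :
    IntervalIntegrable (fun s => α (ψ s)) volume 0 T := by
  rw [intervalIntegrable_iff_integrableOn_Icc_of_le hT]
  refine (integrable_const B).mono'
    (hα.comp_aemeasurable (hψ.aemeasurable measurableSet_Icc)).aestronglyMeasurable ?_
  filter_upwards [ae_restrict_mem measurableSet_Icc] with s hs using hB s hs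

/-- The function `α` cut off outside `[-n, n]`. -/
def cutoff (α : ℝ → ℝ) (n : ℕ) : ℝ → ℝ := (Icc (-(n:ℝ)) n).indicator α

section cutoff

variable {α : ℝ → ℝ}

theorem cutoff_eq {n : ℕ} {y : ℝ} (hy : |y| ≤ n) : cutoff α n y = α y :=
  indicator_of_mem (s := Icc (-(n:ℝ)) n) (abs_le.1 hy) α

theorem cutoff_eq_zero {n : ℕ} {y : ℝ} (hy : n < |y|) : cutoff α n y = 0 :=
  indicator_of_notMem (s := Icc (-(n:ℝ)) n) (fun h => (abs_le.2 h).not_gt hy) α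

theorem abs_cutoff_le_abs (n : ℕ) (y : ℝ) : |cutoff α n y| ≤ |α y| := by
  rcases le_or_gt |y| n with h | h
  · rw [cutoff_eq h]
  · rw [cutoff_eq_zero h, abs_zero]; exact abs_nonneg _

theorem abs_cutoff_le {A : ℝ} (hα : ∀ y, |α y| ≤ A * (1 + |y|)) (n : ℕ) (y : ℝ) :
    |cutoff α n y| ≤ A * (1 + n) := by
  have hA : 0 ≤ A := by
    have := (abs_nonneg _).trans (hα 0)
    simpa using this
  rcases le_or_gt |y| n with h | h
  · rw [cutoff_eq h]
    exact (hα y).trans (by gcongr)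
  · rw [cutoff_eq_zero h, abs_zero]; positivity

theorem countable_not_continuousAt_cutoff (hα : {y | ¬ ContinuousAt α y}.Countable) (n : ℕ) :
    {y | ¬ ContinuousAt (cutoff α n) y}.Countable := by
  refine (hα.union ((countable_singleton (n:ℝ)).union (countable_singleton (-(n:ℝ))))).mono ?_
  intro y hy
  by_contra h
  simp only [mem_union, mem_ofPred_eq, mem_singleton_iff, not_or, not_not] at h
  refine hy ?_
  rcases lt_trichotomy |y| n with h1 | h1 | h1
  · refine (continuousAt_congr ?_).2 h.1
    filter_upwards [(continuous_abs.tendsto y).eventually (gt_mem_nhds h1)] with z hz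
    exact cutoff_eq (le_of_lt hz)
  · rcases abs_choice y with h2 | h2
    · exact absurd (h2.symm.trans h1) h.2.1
    · exact absurd (by rw [← h1, h2, neg_neg]) h.2.2
  · refine (continuousAt_congr ?_).2 (continuousAt_const (y := (0:ℝ)))
    filter_upwards [(continuous_abs.tendsto y).eventually (lt_mem_nhds h1)] with z hz
    exact cutoff_eq_zero hz

end cutoff

/-- The solution with drift `α` and driving path `v`, as the limit of the solutions with cut-off
drifts. -/
def pathSol (α : ℝ → ℝ) (x : ℝ) (v : ℝ → ℝ) (t : ℝ) : ℝ :=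
  if t = 0 then x else limsup (fun n => midSol (cutoff α n) x v t) atTop

section pathSol

variable {α v : ℝ → ℝ} {A x : ℝ}

theorem exists_abs_midSol_cutoff_le (hα : ∀ y, |α y| ≤ A * (1 + |y|)) (hv : Continuous v)
    (hsq : ∀ n, IsSqueezed (cutoff α n) x v) (T : ℝ) :
    ∃ N : ℕ, ∀ n, ∀ t ∈ Icc 0 T, |midSol (cutoff α n) x v t| ≤ N := by
  obtain ⟨B, hB⟩ := (isCompact_Icc (a := 0) (b := T)).exists_bound_of_continuousOn hv.continuousOn
  obtain ⟨N, hN⟩ := exists_nat_ge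
    ((|x| + A * T + B) + A * gronwallBound 0 A (|x| + A * T + B) T)
  exact ⟨N, fun n t ht => (((hsq n).solvesOn (abs_cutoff_le hα n) hv T).abs_le_of_linear_growth
    (fun y => (abs_cutoff_le_abs n y).trans (hα y)) hB ht).trans hN⟩

theorem exists_eqOn_pathSol (hαm : Measurable α) (hα : ∀ y, |α y| ≤ A * (1 + |y|))
    (hv : Continuous v) (hv0 : v 0 = 0) (hsq : ∀ n, IsSqueezed (cutoff α n) x v) (T : ℝ) :
    ∃ N : ℕ, (∀ n, ∀ t ∈ Icc 0 T, |midSol (cutoff α n) x v t| ≤ N) ∧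
      ∀ n, N ≤ n → EqOn (pathSol α x v) (midSol (cutoff α n) x v) (Icc 0 T) := by
  obtain ⟨N, hN⟩ := exists_abs_midSol_cutoff_le hα hv hsq T
  refine ⟨N, hN, fun n hn t ht => ?_⟩
  have hn' : (N:ℝ) ≤ n := by exact_mod_cast hn
  have hsol := fun m => (hsq m).solvesOn (abs_cutoff_le hα m) hv T
  by_cases h0 : t = 0
  · rw [pathSol, if_pos h0, (hsol n).eqn t ht, h0, hv0]
    simp
  · rw [pathSol, if_neg h0]
    have hev : ∀ᶠ m in atTop, midSol (cutoff α m) x v t = midSol (cutoff α n) x v t := by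
      filter_upwards [eventually_ge_atTop n] with m hm
      have hm' : (n:ℝ) ≤ m := by exact_mod_cast hm
      refine (hsq n).eq_midSol (abs_cutoff_le hα n) hv (hsol m) ?_ (fun s hs => ?_) ht
      · exact intervalIntegrable_comp_of_bounded (hαm.indicator measurableSet_Icc) (hsol m).cont
          (ht.1.trans ht.2) fun s _ => abs_cutoff_le hα m _
      · rw [cutoff_eq ((hN m s hs).trans (hn'.trans hm')), cutoff_eq ((hN m s hs).trans hn')]
    rw [limsup_congr hev, limsup_const]

theorem pathSol_solvesOn (hαm : Measurable α) (hα : ∀ y, |α y| ≤ A * (1 + |y|))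
    (hv : Continuous v) (hv0 : v 0 = 0) (hsq : ∀ n, IsSqueezed (cutoff α n) x v) (T : ℝ) :
    SolvesOn α x v T (pathSol α x v) := by
  obtain ⟨N, hN, he⟩ := exists_eqOn_pathSol hαm hα hv hv0 hsq T
  refine SolvesOn.congr ?_ (he N le_rfl)
  have h := (hsq N).solvesOn (abs_cutoff_le hα N) hv T
  refine ⟨h.cont, fun t ht => ?_⟩
  rw [h.eqn t ht]
  congr 2
  refine intervalIntegral.integral_congr fun s hs => ?_
  rw [uIcc_of_le ht.1] at hs
  have hs' : s ∈ Icc 0 T := ⟨hs.1, hs.2.trans ht.2⟩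
  exact cutoff_eq (hN N s hs')

theorem SolvesOn.eq_pathSol {ψ : ℝ → ℝ} {T : ℝ} (hψ : SolvesOn α x v T ψ) (hαm : Measurable α)
    (hα : ∀ y, |α y| ≤ A * (1 + |y|)) (hv : Continuous v) (hv0 : v 0 = 0)
    (hsq : ∀ n, IsSqueezed (cutoff α n) x v) {t : ℝ} (ht : t ∈ Icc 0 T) :
    ψ t = pathSol α x v t := by
  obtain ⟨N, -, he⟩ := exists_eqOn_pathSol hαm hα hv hv0 hsq T
  obtain ⟨B, hB⟩ := (isCompact_Icc (a := 0) (b := T)).exists_bound_of_continuousOn hψ.cont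
  obtain ⟨m, hm⟩ := exists_nat_ge B
  have hψm : ∀ s ∈ Icc 0 T, |ψ s| ≤ (max N m : ℕ) := fun s hs =>
    ((hB s hs).trans hm).trans (by exact_mod_cast le_max_right N m)
  have hA : 0 ≤ A := by
    have := (abs_nonneg _).trans (hα 0)
    simpa using this
  rw [he _ (le_max_left N m) ht]
  refine (hsq _).eq_midSol (abs_cutoff_le hα _) hv hψ ?_ (fun s hs => (cutoff_eq (hψm s hs)).symm)
    ht
  exact intervalIntegrable_comp_of_bounded hαm hψ.cont (ht.1.trans ht.2) fun s hs =>
    (hα _).trans (mul_le_mul_of_nonneg_left (add_le_add_right (hψm s hs) 1) hA)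

end pathSol

theorem CondA.countable_not_continuousAt {α : ℝ → ℝ} (hA : CondA α) :
    {y | ¬ ContinuousAt α y}.Countable := by
  have hl : LocallyBoundedVariationOn α univ := fun a b _ _ => by
    rw [univ_inter]; exact hA a b
  obtain ⟨p, q, hp, hq, rfl⟩ := hl.exists_monotoneOn_sub_monotoneOn
  refine ((monotoneOn_univ.1 hp).countable_not_continuousAt.union
    (monotoneOn_univ.1 hq).countable_not_continuousAt).mono fun y hy => ?_
  by_contra h
  simp only [mem_union, mem_ofPred_eq, not_or, not_not] at h
  exact hy (h.1.sub h.2)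

theorem CondB.exists_linear_growth {α : ℝ → ℝ} (hB : CondB α) :
    ∃ A, ∀ y, |α y| ≤ A * (1 + |y|) := by
  obtain ⟨C, hC, h⟩ := hB
  refine ⟨√C, fun y => ?_⟩
  refine (sq_le_sq₀ (abs_nonneg _) (by positivity)).1 ?_
  rw [mul_pow, Real.sq_sqrt hC.le]
  refine (h y).trans (mul_le_mul_of_nonneg_left ?_ hC.le)
  nlinarith [abs_nonneg y]

/-- If `α` has locally bounded variation (A) and linear growth (B),
then for each initial point `x` the SDE `dφ_t = α(φ_t)dt + dw(t)`, `φ_0 = x`, has a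
unique strong solution (uniqueness up to indistinguishability on `[0,∞)`). -/
theorem existence_uniqueness_strong_solution
    {Ω : Type*} [MeasureSpace Ω] (w : ℝ → Ω → ℝ) (hw : IsWiener w)
    (α : ℝ → ℝ) (hA : CondA α) (hB : CondB α) (x : ℝ) :
    ∃ φ : ℝ → Ω → ℝ, IsStrongSolution α w x φ ∧
      ∀ φ' : ℝ → Ω → ℝ, IsStrongSolution α w x φ' →
        ∀ᵐ ω ∂(ℙ : Measure Ω), ∀ t : ℝ, 0 ≤ t → φ t ω = φ' t ω := by
  obtain ⟨A, hα⟩ := hB.exists_linear_growth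
  have hc := hA.countable_not_continuousAt
  have hαm : Measurable α := measurable_of_countable_not_continuousAt hc
  have hsq : ∀ᵐ ω ∂(ℙ : Measure Ω), ∀ n, IsSqueezed (cutoff α n) x fun t => w t ω :=
    ae_all_iff.2 fun n => hw.ae_isSqueezed (abs_cutoff_le hα n) n.cast_nonneg
      (fun y hy => cutoff_eq_zero hy) (countable_not_continuousAt_cutoff hc n) x
  refine ⟨fun t ω => pathSol α x (fun t => w t ω) t, ⟨fun t ht => ?_, fun ω => if_pos rfl, ?_, ?_⟩,
    fun φ' hφ' => ?_⟩
  · by_cases h0 : t = 0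
    · simp only [pathSol, if_pos h0]
      exact measurable_const
    · simp only [pathSol, if_neg h0]
      refine Measurable.limsup fun n => measurable_midSol (m := natSigma w t)
        (abs_cutoff_le hα n) x ht fun s hs => ?_
      exact (comap_measurable (w s)).mono (le_iSup₂_of_le s hs le_rfl) le_rfl
  · filter_upwards [hsq, hw.cont, hw.init] with ω h hv hv0
    exact continuousOn_Ici_of_forall_Icc fun T => (pathSol_solvesOn hαm hα hv hv0 h T).cont
  · filter_upwards [hsq, hw.cont, hw.init] with ω h hv hv0 t ht
    exact (pathSol_solvesOn hαm hα hv hv0 h t).eqn t ⟨ht, le_rfl⟩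
  · filter_upwards [hsq, hw.cont, hw.init, hφ'.cont, hφ'.sde] with ω h hv hv0 hc' hs t ht
    have hsol : SolvesOn α x (fun t => w t ω) t fun t => φ' t ω :=
      ⟨hc'.mono fun s hs => hs.1, fun s hs' => hs s hs'.1⟩
    exact (hsol.eq_pathSol hαm hα hv hv0 h ⟨ht, le_rfl⟩).symm

end
end

section
/- Let α : ℝ → ℝ satisfy conditions (A) and (B), and let (φ_t(x))_{t≥0} solve dφ_t(x) = α(φ_t(x))dt + dw(t), φ_0(x) = x, driven by the same Wiener process for all initial points. Then for all x₁, x₂ ∈ ℝ with x₁ ≠ x₂, one has P{φ_t(x₁) ≠ φ_t(x₂) for all t ≥ 0} = 1; that is, the flow has no coalescence. -/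
open MeasureTheory ProbabilityTheory Filter Set

noncomputable section

open scoped ENNReal NNReal

/-- The Euclidean norm `u ↦ √((x + u)² + z²)` lies above its tangent at `u = 0`, with a quadratic
gain of order `u² / z` when `|x|, |u| ≤ z`. -/
theorem sqrt_add_sq_tangent_le (x u : ℝ) {z : ℝ} (hz : 0 < z) :
    √(x ^ 2 + z ^ 2) + x / √(x ^ 2 + z ^ 2) * u
      + (if |x| ≤ z then 1 / z else 0) * (if |u| ≤ z then u ^ 2 else 0) / 10
      ≤ √((x + u) ^ 2 + z ^ 2) := by
  set r := √(x ^ 2 + z ^ 2) with hr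
  set v := √((x + u) ^ 2 + z ^ 2) with hv
  have hr2 : r ^ 2 = x ^ 2 + z ^ 2 := Real.sq_sqrt (by positivity)
  have hv2 : v ^ 2 = (x + u) ^ 2 + z ^ 2 := Real.sq_sqrt (by positivity)
  have hr0 : 0 < r := Real.sqrt_pos.2 (by positivity)
  have hv0 : 0 < v := Real.sqrt_pos.2 (by positivity)
  have hid : (r * v) ^ 2 = (r ^ 2 + x * u) ^ 2 + z ^ 2 * u ^ 2 := by
    rw [mul_pow, hv2, hr2]; ring
  have hcs : r ^ 2 + x * u ≤ r * v :=
    (le_abs_self _).trans (abs_le_of_sq_le_sq (by nlinarith [sq_nonneg (z * u)]) (by positivity))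
  have hx : x / r * u = x * u / r := by ring
  have main : ∀ k : ℝ, r ^ 2 + x * u + r * k ≤ r * v → r + x / r * u + k ≤ v := by
    intro k hk
    have : r * (r + x / r * u + k) = r ^ 2 + x * u + r * k := by
      field_simp
    exact le_of_mul_le_mul_left (this ▸ hk) hr0
  apply main
  split_ifs with h1 h2
  · have hx2 : x ^ 2 ≤ z ^ 2 := sq_le_sq' (by linarith [abs_le.1 h1]) (abs_le.1 h1).2
    have hu2 : (x + u) ^ 2 ≤ (2 * z) ^ 2 :=
      sq_le_sq' (by linarith [abs_le.1 h1, abs_le.1 h2]) (by linarith [abs_le.1 h1, abs_le.1 h2])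
    have hvz : v ≤ 5 / 2 * z := by
      refine le_of_sq_le_sq ?_ (by positivity)
      nlinarith
    have hrz : r ^ 2 ≤ 2 * z ^ 2 := by linarith
    have key : z ^ 2 * u ^ 2 ≤ (r * v - (r ^ 2 + x * u)) * (2 * (r * v)) := by
      nlinarith
    have k2 : z ^ 2 * u ^ 2 / (2 * (r * v)) ≤ r * v - (r ^ 2 + x * u) :=
      (div_le_iff₀ (by positivity)).2 key
    have k3 : r * (1 / z * u ^ 2 / 10) ≤ z ^ 2 * u ^ 2 / (2 * (r * v)) := by
      rw [le_div_iff₀ (by positivity)]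
      have : r * (1 / z * u ^ 2 / 10) * (2 * (r * v)) = (r ^ 2 * v) * u ^ 2 / (5 * z) := by
        field_simp; ring
      rw [this, div_le_iff₀ (by positivity)]
      have : r ^ 2 * v ≤ 5 * z ^ 3 := by
        calc r ^ 2 * v ≤ (2 * z ^ 2) * (5 / 2 * z) := by gcongr
          _ = 5 * z ^ 3 := by ring
      nlinarith [mul_le_mul_of_nonneg_right this (sq_nonneg u)]
    linarith
  all_goals simpa using hcs

/-- `(x, z) ↦ √(x² + z²)` is Lipschitz for the `ℓ¹` norm. -/
theorem sqrt_add_sq_le_add_abs (a b c d : ℝ) :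
    √(a ^ 2 + b ^ 2) ≤ √(c ^ 2 + d ^ 2) + |a - c| + |b - d| := by
  have h : ∀ p q : ℝ, √(p ^ 2 + q ^ 2) = ‖(⟨p, q⟩ : ℂ)‖ := by
    intro p q
    rw [Complex.norm_eq_sqrt_sq_add_sq]
  rw [h, h]
  have e : (⟨a, b⟩ : ℂ) = ⟨c, d⟩ + ⟨a - c, b - d⟩ := by
    apply Complex.ext <;> simp
  have := Complex.norm_le_abs_re_add_abs_im ⟨a - c, b - d⟩
  rw [e]
  exact (norm_add_le _ _).trans (by simp only at this; linarith)

/-- The second moment of a standard Gaussian variable truncated at level `1`. -/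
def truncatedGaussianMoment : ℝ :=
  ∫ x, (if |x| ≤ 1 then x ^ 2 else 0) ∂gaussianReal 0 1

theorem measurable_truncated_sq (δ : ℝ) :
    Measurable fun x : ℝ => if |x| ≤ δ then x ^ 2 else 0 :=
  Measurable.ite (measurableSet_le (by fun_prop) (by fun_prop)) (by fun_prop) (by fun_prop)

theorem truncated_sq_mem (δ x : ℝ) :
    0 ≤ (if |x| ≤ δ then x ^ 2 else 0) ∧ (if |x| ≤ δ then x ^ 2 else 0) ≤ δ ^ 2 := by
  split_ifs with h
  · exact ⟨sq_nonneg _, sq_le_sq' (abs_le.1 h).1 (abs_le.1 h).2⟩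
  · exact ⟨le_rfl, sq_nonneg _⟩

theorem truncatedGaussianMoment_pos : 0 < truncatedGaussianMoment := by
  have hint : Integrable (fun x : ℝ => if |x| ≤ 1 then x ^ 2 else 0) (gaussianReal 0 1) := by
    refine Integrable.of_bound (measurable_truncated_sq 1).aestronglyMeasurable 1 (ae_of_all _ ?_)
    intro x
    rw [Real.norm_eq_abs, abs_of_nonneg (truncated_sq_mem 1 x).1]
    simpa using (truncated_sq_mem 1 x).2
  rw [truncatedGaussianMoment, integral_pos_iff_support_of_nonneg
    (fun x => (truncated_sq_mem 1 x).1) hint, pos_iff_ne_zero]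
  intro h0
  have h1 := gaussianReal_absolutelyContinuous' 0 (one_ne_zero : (1 : ℝ≥0) ≠ 0) h0
  have h2 : Set.Ioo (0 : ℝ) 1 ⊆ Function.support (fun x : ℝ => if |x| ≤ 1 then x ^ 2 else 0) := by
    intro x hx
    have : |x| ≤ 1 := abs_le.2 ⟨by linarith [hx.1], hx.2.le⟩
    simp [this, hx.1.ne']
  have h3 := measure_mono_null h2 h1
  simp at h3

theorem integral_truncated_sq_gaussianReal {δ : ℝ} (hδ : 0 < δ) :
    ∫ x, (if |x| ≤ δ then x ^ 2 else 0) ∂gaussianReal 0 (δ ^ 2).toNNReal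
      = δ ^ 2 * truncatedGaussianMoment := by
  have h := gaussianReal_map_const_mul (μ := 0) (v := 1) δ
  have hv : (NNReal.mk (δ ^ 2) (sq_nonneg δ) * 1) = (δ ^ 2).toNNReal := by
    ext; simp [sq_nonneg]
  rw [hv, mul_zero] at h
  rw [← h, integral_map (by fun_prop) (measurable_truncated_sq δ).aestronglyMeasurable,
    truncatedGaussianMoment, ← integral_const_mul]
  congr 1
  ext x
  have : |δ * x| ≤ δ ↔ |x| ≤ 1 := by
    rw [abs_mul, abs_of_pos hδ]
    exact mul_le_iff_le_one_right hδ
  simp only [this]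
  split_ifs <;> ring

/-- A continuous path starting away from `0` whose increments are controlled by
`∫ k |D|` with `k` integrable never reaches `0`. -/
theorem ne_zero_of_abs_sub_le_lintegral {D : ℝ → ℝ} {k : ℝ → ℝ≥0∞} {T : ℝ}
    (hD : Continuous D) (hk : ∫⁻ r in Set.Icc 0 T, k r ≠ ∞)
    (hinc : ∀ s t, 0 ≤ s → s ≤ t → t ≤ T →
      ENNReal.ofReal |D t - D s| ≤ ∫⁻ r in Set.Icc s t, k r * ENNReal.ofReal |D r|)
    (h0 : D 0 ≠ 0) : ∀ t ∈ Set.Icc 0 T, D t ≠ 0 := by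
  by_contra! hcon
  obtain ⟨t₀, ht₀, hDt₀⟩ := hcon
  set N : Set ℝ := Set.Icc 0 T ∩ D ⁻¹' {0} with hN
  have hNc : IsCompact N := isCompact_Icc.inter_right (isClosed_singleton.preimage hD)
  obtain ⟨τ, ⟨hτ, hDτ⟩, hmin⟩ := hNc.exists_isLeast ⟨t₀, ht₀, hDt₀⟩
  have hDτ : D τ = 0 := hDτ
  have hτ0 : 0 < τ := by
    rcases hτ.1.lt_or_eq with h | h
    · exact h
    · exact absurd (h ▸ hDτ) h0
  obtain ⟨η, hη, hsmall⟩ := exists_pos_setLIntegral_lt_of_measure_lt hk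
    (ε := (1 / 2 : ℝ≥0∞)) (by simp)
  obtain ⟨ρ, hρ0, hρ⟩ : ∃ ρ : ℝ, 0 < ρ ∧ ENNReal.ofReal ρ < η := by
    obtain ⟨q, hq0, hq⟩ := ENNReal.lt_iff_exists_nnreal_btwn.1 hη
    exact ⟨q, by simpa using hq0, by simpa using hq⟩
  set s := max 0 (τ - ρ) with hs
  have hs0 : 0 ≤ s := le_max_left _ _
  have hsτ : s < τ := max_lt hτ0 (by linarith)
  have hk2 : ∫⁻ r in Set.Icc s τ, k r ≤ 1 / 2 := by
    have h1 := hsmall (Set.Icc s τ) (by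
      refine lt_of_le_of_lt (Measure.restrict_apply_le _ _) ?_
      rw [Real.volume_Icc]
      refine lt_of_le_of_lt (ENNReal.ofReal_le_ofReal ?_) hρ
      have := le_max_right 0 (τ - ρ)
      linarith)
    rw [Measure.restrict_restrict measurableSet_Icc,
      Set.inter_eq_self_of_subset_left (Set.Icc_subset_Icc hs0 hτ.2)] at h1
    exact h1.le
  obtain ⟨m, hm, hmax⟩ := isCompact_Icc.exists_isMaxOn (Set.nonempty_Icc.2 hsτ.le)
    (hD.abs.continuousOn (s := Set.Icc s τ))
  have hDs : D s ≠ 0 := fun h =>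
    absurd (hmin ⟨⟨hs0, hsτ.le.trans hτ.2⟩, h⟩) (not_le.2 hsτ)
  have hDm : 0 < |D m| := (abs_pos.2 hDs).trans_le (hmax (Set.left_mem_Icc.2 hsτ.le))
  have h1 := hinc m τ (hs0.trans hm.1) hm.2 hτ.2
  rw [hDτ, zero_sub, abs_neg] at h1
  have h2 : ∫⁻ r in Set.Icc m τ, k r * ENNReal.ofReal |D r| ≤ ENNReal.ofReal |D m| * (1 / 2) := by
    calc ∫⁻ r in Set.Icc m τ, k r * ENNReal.ofReal |D r|
        ≤ ∫⁻ r in Set.Icc s τ, k r * ENNReal.ofReal |D r| :=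
          lintegral_mono_set (Set.Icc_subset_Icc_left hm.1)
      _ ≤ ∫⁻ r in Set.Icc s τ, ENNReal.ofReal |D m| * k r := by
          refine setLIntegral_mono' measurableSet_Icc fun r hr => ?_
          rw [mul_comm]
          exact mul_le_mul' (ENNReal.ofReal_le_ofReal (hmax hr)) le_rfl
      _ = ENNReal.ofReal |D m| * ∫⁻ r in Set.Icc s τ, k r :=
          lintegral_const_mul' _ _ ENNReal.ofReal_ne_top
      _ ≤ _ := by gcongr
  have h3 := h1.trans h2
  have h4 : ENNReal.ofReal |D m| * (1 / 2) = ENNReal.ofReal (|D m| * (1 / 2)) := by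
    rw [ENNReal.ofReal_mul (abs_nonneg _)]
    congr 1
    rw [ENNReal.ofReal_div_of_pos (by norm_num)]
    simp
  rw [h4, ENNReal.ofReal_le_ofReal_iff (by positivity)] at h3
  linarith

/-- Gronwall's bound for a path that stays within a drift of linear growth of a given path. -/
theorem one_add_abs_le_of_linear_drift {X W : ℝ → ℝ} (hX : Continuous X) (hW : Continuous W)
    {c x S : ℝ} (hc : 0 ≤ c)
    (h : ∀ t, 0 ≤ t → |X t - x - W t| ≤ ∫ r in (0 : ℝ)..t, c * (1 + |X r|))
    {t : ℝ} (ht : t ∈ Set.Icc 0 S) :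
    1 + |X t| ≤ (1 + |x| + |W t|)
      + c * Real.exp (c * S) * ∫ r in (0 : ℝ)..S, (1 + |x| + |W r|) := by
  set v : ℝ → ℝ := fun r => 1 + |X r| with hv
  set a : ℝ → ℝ := fun r => 1 + |x| + |W r| with ha
  have hvc : Continuous v := by fun_prop
  have hac : Continuous a := by fun_prop
  have ha0 : ∀ r, 0 ≤ a r := fun r => by positivity
  set U : ℝ → ℝ := fun t => ∫ r in (0 : ℝ)..t, v r with hU
  set A : ℝ → ℝ := fun t => ∫ r in (0 : ℝ)..t, a r with hA
  have hUd : ∀ t, HasDerivAt U (v t) t := fun t => hvc.integral_hasStrictDerivAt 0 t |>.hasDerivAt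
  have hAd : ∀ t, HasDerivAt A (a t) t := fun t => hac.integral_hasStrictDerivAt 0 t |>.hasDerivAt
  have hle : ∀ t, 0 ≤ t → v t ≤ a t + c * U t := by
    intro t ht
    have h1 := h t ht
    rw [intervalIntegral.integral_const_mul] at h1
    have h2 : |X t| ≤ |X t - x - W t| + |x| + |W t| := by
      have := abs_add_three (X t - x - W t) x (W t)
      rwa [show X t - x - W t + x + W t = X t by ring] at this
    simp only [hv, ha, hU]
    linarith
  have hmono : MonotoneOn (fun t => A t - Real.exp (-c * t) * U t) (Set.Ici 0) := by
    have hd : ∀ t, HasDerivAt (fun t => A t - Real.exp (-c * t) * U t)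
        (a t - (Real.exp (-c * t) * (-c) * U t + Real.exp (-c * t) * v t)) t := by
      intro t
      have he : HasDerivAt (fun t => Real.exp (-c * t)) (Real.exp (-c * t) * (-c)) t := by
        simpa using ((hasDerivAt_id t).const_mul (-c)).exp
      exact (hAd t).sub (he.mul (hUd t))
    refine monotoneOn_of_deriv_nonneg (convex_Ici 0)
      (fun t _ => (hd t).continuousAt.continuousWithinAt)
      (fun t _ => (hd t).differentiableAt.differentiableWithinAt) fun t ht => ?_
    rw [interior_Ici] at ht
    have ht : 0 < t := ht
    rw [(hd t).deriv]
    have h1 := hle t ht.le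
    have h2 : Real.exp (-c * t) ≤ 1 := Real.exp_le_one_iff.2 (by nlinarith)
    nlinarith [Real.exp_pos (-c * t), ha0 t]
  have hAS : A t ≤ A S := by
    simp only [hA]
    rw [← intervalIntegral.integral_add_adjacent_intervals (hac.intervalIntegrable 0 t)
      (hac.intervalIntegrable t S)]
    have := intervalIntegral.integral_nonneg (μ := volume) ht.2 fun r _ => ha0 r
    linarith
  have hA0 : 0 ≤ A t := intervalIntegral.integral_nonneg ht.1 fun r _ => ha0 r
  have h0 : A 0 - Real.exp (-c * 0) * U 0 ≤ A t - Real.exp (-c * t) * U t :=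
    hmono (Set.mem_Ici.2 le_rfl) ht.1 ht.1
  have hUt : U t ≤ Real.exp (c * S) * A S := by
    have h1 : Real.exp (-c * t) * U t ≤ A t := by simpa [hA, hU] using h0
    calc U t = Real.exp (c * t) * (Real.exp (-c * t) * U t) := by
          rw [← mul_assoc, ← Real.exp_add]; simp
      _ ≤ Real.exp (c * t) * A t := by gcongr
      _ ≤ Real.exp (c * S) * A S := by
          have := ht.2
          gcongr
  calc v t ≤ a t + c * U t := hle t ht.1
    _ ≤ a t + c * (Real.exp (c * S) * A S) := by gcongr
    _ = _ := by ring

/-- A jointly measurable process with bounded first moments is integrable on the product space. -/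
theorem integrable_uncurry_of_moment_le {Ω : Type*} [MeasurableSpace Ω] {P : Measure Ω}
    [IsProbabilityMeasure P] {ν : Measure ℝ} [IsFiniteMeasure ν] {Y : ℝ → Ω → ℝ} {K : ℝ}
    (hY : Measurable (Function.uncurry Y))
    (hK : ∀ᵐ t ∂ν, Integrable (Y t) P ∧ ∫ ω, |Y t ω| ∂P ≤ K) :
    Integrable (Function.uncurry Y) (ν.prod P) := by
  rw [integrable_prod_iff hY.aestronglyMeasurable]
  refine ⟨hK.mono fun t ht => ht.1, ?_⟩
  have hm : StronglyMeasurable fun t => ∫ ω, ‖Function.uncurry Y (t, ω)‖ ∂P :=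
    StronglyMeasurable.integral_prod_right (f := fun t ω => ‖Function.uncurry Y (t, ω)‖)
      hY.norm.stronglyMeasurable
  refine Integrable.of_bound hm.aestronglyMeasurable K (hK.mono fun t ht => ?_)
  rw [Real.norm_eq_abs, abs_of_nonneg (integral_nonneg fun ω => norm_nonneg _)]
  exact ht.2

/-- Two continuous processes `X₁`, `X₂` started at `x₁`, `x₂`, each of which follows the increments
of the Wiener process `W` up to a drift of linear growth, whose difference is driven by
`α (X₂) - α (X₁)`, and whose past is independent of the future increments of `W`. -/
structure IsDrivenPair {Ω : Type*} [MeasurableSpace Ω] (P : Measure Ω) (α : ℝ → ℝ)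
    (c x₁ x₂ : ℝ) (W X₁ X₂ : ℝ → Ω → ℝ) : Prop where
  measW : ∀ t, Measurable (W t)
  meas₁ : ∀ t, Measurable (X₁ t)
  meas₂ : ∀ t, Measurable (X₂ t)
  contW : ∀ ω, Continuous fun t => W t ω
  cont₁ : ∀ ω, Continuous fun t => X₁ t ω
  cont₂ : ∀ ω, Continuous fun t => X₂ t ω
  initW : ∀ ω, W 0 ω = 0
  init₁ : ∀ ω, X₁ 0 ω = x₁
  init₂ : ∀ ω, X₂ 0 ω = x₂
  law : ∀ s t, 0 ≤ s → s ≤ t →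
    Measure.map (fun ω => W t ω - W s ω) P = gaussianReal 0 (t - s).toNNReal
  indep : ∀ s t, 0 ≤ s → s ≤ t →
    IndepFun (fun ω => W t ω - W s ω) (fun ω => (X₁ s ω, X₂ s ω)) P
  drift₁ : ∀ ω s t, 0 ≤ s → s ≤ t →
    |X₁ t ω - X₁ s ω - (W t ω - W s ω)| ≤ ∫ r in s..t, c * (1 + |X₁ r ω|)
  drift₂ : ∀ ω s t, 0 ≤ s → s ≤ t →
    |X₂ t ω - X₂ s ω - (W t ω - W s ω)| ≤ ∫ r in s..t, c * (1 + |X₂ r ω|)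
  diff : ∀ ω s t, 0 ≤ s → s ≤ t →
    ENNReal.ofReal |(X₂ t ω - X₁ t ω) - (X₂ s ω - X₁ s ω)|
      ≤ ∫⁻ r in Set.Icc s t, ENNReal.ofReal |α (X₂ r ω) - α (X₁ r ω)|

theorem integrable_and_integral_abs_le_of_map_gaussianReal {Ω : Type*} [MeasurableSpace Ω]
    {P : Measure Ω} [IsProbabilityMeasure P] {U : Ω → ℝ} {v : ℝ≥0} (hU : Measurable U)
    (h : Measure.map U P = gaussianReal 0 v) :
    Integrable U P ∧ ∫ ω, U ω ∂P = 0 ∧ ∫ ω, |U ω| ∂P ≤ 1 + v := by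
  have hmem : MemLp id 2 (Measure.map U P) := by
    rw [h]; exact memLp_id_gaussianReal 2
  have hmem' : MemLp U 2 P := (memLp_map_measure_iff (by fun_prop) hU.aemeasurable).1 hmem
  have hint : Integrable U P := hmem'.integrable (by norm_num)
  have hzero : ∫ ω, U ω ∂P = 0 := by
    have := integral_map (f := fun x : ℝ => x) hU.aemeasurable (by fun_prop) (μ := P)
    rw [← this, h, integral_id_gaussianReal]
  refine ⟨hint, hzero, ?_⟩
  have hsq : ∫ ω, U ω ^ 2 ∂P = v := by
    have h1 : Var[fun x => x; gaussianReal 0 v] = v := variance_fun_id_gaussianReal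
    rw [variance_eq_integral (by fun_prop), integral_id_gaussianReal, ← h,
      integral_map hU.aemeasurable (by fun_prop)] at h1
    simpa using h1
  calc ∫ ω, |U ω| ∂P ≤ ∫ ω, (1 + U ω ^ 2) ∂P := by
        refine integral_mono hint.abs ((integrable_const 1).add hmem'.integrable_sq) fun ω => ?_
        have : |U ω| ≤ 1 + U ω ^ 2 := by
          nlinarith [sq_abs (U ω), sq_nonneg (|U ω| - 1), abs_nonneg (U ω)]
        exact this
    _ = 1 + v := by
        rw [integral_add (integrable_const 1) hmem'.integrable_sq, hsq]; simp

/-- First moments of a process with drift of linear growth are locally bounded in time. -/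
theorem exists_moment_bound {Ω : Type*} [MeasurableSpace Ω] {P : Measure Ω}
    [IsProbabilityMeasure P] {W X : ℝ → Ω → ℝ} {c x : ℝ} (hc : 0 ≤ c)
    (measW : ∀ t, Measurable (W t)) (measX : ∀ t, Measurable (X t))
    (contW : ∀ ω, Continuous fun t => W t ω) (contX : ∀ ω, Continuous fun t => X t ω)
    (initW : ∀ ω, W 0 ω = 0) (initX : ∀ ω, X 0 ω = x)
    (law : ∀ s t, 0 ≤ s → s ≤ t →
      Measure.map (fun ω => W t ω - W s ω) P = gaussianReal 0 (t - s).toNNReal)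
    (drift : ∀ ω s t, 0 ≤ s → s ≤ t →
      |X t ω - X s ω - (W t ω - W s ω)| ≤ ∫ r in s..t, c * (1 + |X r ω|)) (S : ℝ) :
    ∃ K, ∀ t ∈ Set.Icc 0 S, Integrable (X t) P ∧ ∫ ω, |X t ω| ∂P ≤ K := by
  have hW : ∀ t ∈ Set.Icc 0 S, Integrable (W t) P ∧ ∫ ω, |W t ω| ∂P ≤ 1 + S := by
    intro t ht
    have h1 := law 0 t le_rfl ht.1
    simp only [initW, sub_zero] at h1
    obtain ⟨h2, -, h3⟩ := integrable_and_integral_abs_le_of_map_gaussianReal (measW t) h1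
    rw [Real.coe_toNNReal _ ht.1] at h3
    exact ⟨h2, h3.trans (by linarith [ht.2])⟩
  set I : Ω → ℝ := fun ω => ∫ r in (0 : ℝ)..S, (1 + |x| + |W r ω|) with hI
  have hpath : ∀ t ∈ Set.Icc 0 S, ∀ ω,
      |X t ω| ≤ |x| + |W t ω| + c * Real.exp (c * S) * I ω := by
    intro t ht ω
    have := one_add_abs_le_of_linear_drift (contX ω) (contW ω) (x := x) (S := S) hc (fun t ht => by
      simpa [initW, initX] using drift ω 0 t le_rfl ht) ht
    simp only [hI]
    linarith
  by_cases hS : 0 ≤ S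
  swap
  · exact ⟨0, fun t ht => absurd (ht.1.trans ht.2) hS⟩
  have hIint : Integrable I P := by
    have hmeas : Measurable (Function.uncurry fun t ω => 1 + |x| + |W t ω|) :=
      (measurable_const.add (measurable_uncurry_of_continuous_of_measurable contW measW).abs)
    have := integrable_uncurry_of_moment_le (P := P) (ν := volume.restrict (Set.Ioc 0 S))
      (K := 1 + |x| + (1 + S)) hmeas ((ae_restrict_mem measurableSet_Ioc).mono fun t ht => by
        obtain ⟨h1, h2⟩ := hW t ⟨ht.1.le, ht.2⟩
        refine ⟨(integrable_const _).add h1.abs, ?_⟩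
        have habs : ∀ ω, |(1 + |x| + |W t ω|)| = 1 + |x| + |W t ω| := fun ω =>
          abs_of_nonneg (by positivity)
        simp_rw [habs]
        rw [integral_add (integrable_const _) h1.abs]
        simpa using h2)
    have h2 := this.integral_prod_right
    simp only [hI, intervalIntegral.integral_of_le hS]
    exact h2
  have hdom : ∀ t ∈ Set.Icc 0 S,
      Integrable (fun ω => |x| + |W t ω| + c * Real.exp (c * S) * I ω) P := fun t ht =>
    ((integrable_const _).add (hW t ht).1.abs).add (hIint.const_mul _)
  refine ⟨|x| + (1 + S) + c * Real.exp (c * S) * ∫ ω, I ω ∂P, fun t ht => ?_⟩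
  have hint : Integrable (X t) P :=
    (hdom t ht).mono' (measX t).aestronglyMeasurable (ae_of_all _ (hpath t ht))
  refine ⟨hint, (integral_mono hint.abs (hdom t ht) (hpath t ht)).trans ?_⟩
  have hadd : Integrable (fun ω => |x| + |W t ω|) P := (integrable_const _).add (hW t ht).1.abs
  rw [integral_add hadd (hIint.const_mul _), integral_add (integrable_const _) (hW t ht).1.abs,
    integral_const_mul]
  simpa using (hW t ht).2

/-- Distance from `(x₁ - y, max |x₂ - x₁| δ)` to the origin. -/
def gapEnergy (y δ x₁ x₂ : ℝ) : ℝ := √((x₁ - y) ^ 2 + (max |x₂ - x₁| δ) ^ 2)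

/-- The kernel `1{|x₁ - y| ≤ z} / z` with `z = max |x₂ - x₁| δ`. -/
def gapKernel (y δ x₁ x₂ : ℝ) : ℝ :=
  if |x₁ - y| ≤ max |x₂ - x₁| δ then 1 / max |x₂ - x₁| δ else 0

theorem continuous_gapEnergy (y δ : ℝ) : Continuous fun q : ℝ × ℝ => gapEnergy y δ q.1 q.2 := by
  unfold gapEnergy
  fun_prop

theorem measurable_gapKernel (δ : ℝ) :
    Measurable fun q : ℝ × ℝ × ℝ => gapKernel q.1 δ q.2.1 q.2.2 := by
  unfold gapKernel
  exact Measurable.ite (measurableSet_le (by fun_prop) (by fun_prop)) (by fun_prop) (by fun_prop)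

theorem gapEnergy_nonneg (y δ x₁ x₂ : ℝ) : 0 ≤ gapEnergy y δ x₁ x₂ := Real.sqrt_nonneg _

theorem gapEnergy_le {y δ R : ℝ} (x₁ x₂ : ℝ) (hδ : 0 ≤ δ) (hδ1 : δ ≤ 1) (hy : |y| ≤ R) :
    gapEnergy y δ x₁ x₂ ≤ 2 * |x₁| + |x₂| + (R + 1) := by
  have h := sqrt_add_sq_le_add_abs (x₁ - y) (max |x₂ - x₁| δ) 0 0
  have h1 : max |x₂ - x₁| δ ≤ |x₁| + |x₂| + 1 := by
    apply max_le
    · have := abs_sub x₂ x₁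
      linarith
    · have := abs_nonneg x₁
      have := abs_nonneg x₂
      linarith
  have h2 : |x₁ - y| ≤ |x₁| + |y| := abs_sub _ _
  have h3 : |max |x₂ - x₁| δ| = max |x₂ - x₁| δ := abs_of_nonneg (le_max_of_le_right hδ)
  simp only [sub_zero, h3] at h
  unfold gapEnergy
  norm_num at h
  linarith

theorem gapKernel_mem {y δ x₁ x₂ : ℝ} (hδ : 0 < δ) :
    0 ≤ gapKernel y δ x₁ x₂ ∧ gapKernel y δ x₁ x₂ ≤ 1 / δ := by
  unfold gapKernel
  split_ifs
  · exact ⟨by positivity, one_div_le_one_div_of_le hδ (le_max_right _ _)⟩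
  · exact ⟨le_rfl, by positivity⟩

/-- Pointwise one-step lower bound for the increment of `gapEnergy`. -/
theorem gapEnergy_step (y u a₁ a₂ b₁ b₂ : ℝ) {δ : ℝ} (hδ : 0 < δ) :
    gapEnergy y δ a₁ a₂ + (a₁ - y) / gapEnergy y δ a₁ a₂ * u
        + gapKernel y δ a₁ a₂ * (if |u| ≤ δ then u ^ 2 else 0) / 10
      ≤ gapEnergy y δ b₁ b₂ + (2 * |b₁ - a₁ - u| + |b₂ - a₂ - u|) := by
  have hz : 0 < max |a₂ - a₁| δ := lt_max_of_lt_right hδ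
  have h1 := sqrt_add_sq_tangent_le (a₁ - y) u hz
  have h2 := sqrt_add_sq_le_add_abs (a₁ - y + u) (max |a₂ - a₁| δ) (b₁ - y) (max |b₂ - b₁| δ)
  have h3 : |max |a₂ - a₁| δ - max |b₂ - b₁| δ| ≤ |b₁ - a₁ - u| + |b₂ - a₂ - u| := by
    refine (abs_max_sub_max_le_abs _ _ _).trans ((abs_abs_sub_abs_le_abs_sub _ _).trans ?_)
    rw [show a₂ - a₁ - (b₂ - b₁) = (b₁ - a₁ - u) - (b₂ - a₂ - u) by ring]
    exact abs_sub _ _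
  have h4 : |a₁ - y + u - (b₁ - y)| = |b₁ - a₁ - u| := by
    rw [abs_sub_comm]; congr 1; ring
  have h5 : gapKernel y δ a₁ a₂ * (if |u| ≤ δ then u ^ 2 else 0)
      ≤ (if |a₁ - y| ≤ max |a₂ - a₁| δ then 1 / max |a₂ - a₁| δ else 0)
        * (if |u| ≤ max |a₂ - a₁| δ then u ^ 2 else 0) := by
    refine mul_le_mul_of_nonneg_left ?_ (gapKernel_mem hδ).1
    by_cases h : |u| ≤ δ
    · rw [if_pos h, if_pos (h.trans (le_max_right _ _))]
    · rw [if_neg h]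
      split_ifs <;> positivity
  rw [h4] at h2
  simp only [gapEnergy] at *
  linarith

section Energy

variable {Ω : Type*} [MeasurableSpace Ω] {P : Measure Ω} [IsProbabilityMeasure P] {α : ℝ → ℝ}
  {c x₁ x₂ : ℝ} {W X₁ X₂ : ℝ → Ω → ℝ}

theorem IsDrivenPair.integral_gapEnergy_step (hp : IsDrivenPair P α c x₁ x₂ W X₁ X₂) (hc : 0 ≤ c)
    {S K y δ R t : ℝ}
    (hK₁ : ∀ t ∈ Set.Icc 0 S, Integrable (X₁ t) P ∧ ∫ ω, |X₁ t ω| ∂P ≤ K)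
    (hK₂ : ∀ t ∈ Set.Icc 0 S, Integrable (X₂ t) P ∧ ∫ ω, |X₂ t ω| ∂P ≤ K)
    (hδ : 0 < δ) (hδ1 : δ ≤ 1) (hy : |y| ≤ R) (ht : 0 ≤ t) (htS : t + δ ^ 2 ≤ S) :
    δ ^ 2 * (truncatedGaussianMoment / 10) * ∫ ω, gapKernel y δ (X₁ t ω) (X₂ t ω) ∂P
      ≤ ∫ ω, gapEnergy y δ (X₁ (t + δ ^ 2) ω) (X₂ (t + δ ^ 2) ω) ∂P
        - ∫ ω, gapEnergy y δ (X₁ t ω) (X₂ t ω) ∂P + δ ^ 2 * (c * (3 + 3 * K)) := by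
  have hδ2 : 0 < δ ^ 2 := by positivity
  have htt : t ≤ t + δ ^ 2 := by linarith
  have hEint : ∀ s ∈ Set.Icc 0 S, Integrable (fun ω => gapEnergy y δ (X₁ s ω) (X₂ s ω)) P := by
    intro s hs
    refine (((hK₁ s hs).1.abs.const_mul 2).add ((hK₂ s hs).1.abs)).add
      (integrable_const (R + 1)) |>.mono' ?_ (ae_of_all _ fun ω => ?_)
    · exact ((continuous_gapEnergy y δ).measurable.comp
        ((hp.meas₁ s).prodMk (hp.meas₂ s))).aestronglyMeasurable
    · rw [Real.norm_eq_abs, abs_of_nonneg (gapEnergy_nonneg _ _ _ _)]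
      exact gapEnergy_le _ _ hδ.le hδ1 hy
  set U : Ω → ℝ := fun ω => W (t + δ ^ 2) ω - W t ω with hU
  have hUm : Measurable U := (hp.measW _).sub (hp.measW _)
  have hlaw : Measure.map U P = gaussianReal 0 (δ ^ 2).toNNReal := by
    have := hp.law t (t + δ ^ 2) ht htt
    rwa [add_sub_cancel_left] at this
  obtain ⟨hUint, hU0, -⟩ := integrable_and_integral_abs_le_of_map_gaussianReal hUm hlaw
  have hind : IndepFun U (fun ω => (X₁ t ω, X₂ t ω)) P := hp.indep t (t + δ ^ 2) ht htt
  have hXm : Measurable fun ω => (X₁ t ω, X₂ t ω) := (hp.meas₁ t).prodMk (hp.meas₂ t)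
  have hslope : Measurable fun q : ℝ × ℝ => (q.1 - y) / gapEnergy y δ q.1 q.2 :=
    (by fun_prop : Measurable fun q : ℝ × ℝ => q.1 - y).div (continuous_gapEnergy y δ).measurable
  have hkm : Measurable fun q : ℝ × ℝ => gapKernel y δ q.1 q.2 :=
    (measurable_gapKernel δ).comp (measurable_const.prodMk measurable_id)
  have hmart : ∫ ω, (X₁ t ω - y) / gapEnergy y δ (X₁ t ω) (X₂ t ω) * U ω ∂P = 0 := by
    have h1 := (hind.symm.comp hslope measurable_id).integral_fun_mul_eq_mul_integral
      (hslope.comp hXm).aestronglyMeasurable hUm.aestronglyMeasurable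
    simp only [Function.comp_apply, id_eq] at h1
    rw [h1, hU0, mul_zero]
  have hgain : ∫ ω, gapKernel y δ (X₁ t ω) (X₂ t ω) * (if |U ω| ≤ δ then U ω ^ 2 else 0) ∂P
      = (∫ ω, gapKernel y δ (X₁ t ω) (X₂ t ω) ∂P) * (δ ^ 2 * truncatedGaussianMoment) := by
    have h1 := (hind.symm.comp hkm (measurable_truncated_sq δ)).integral_fun_mul_eq_mul_integral
      (hkm.comp hXm).aestronglyMeasurable
      ((measurable_truncated_sq δ).comp hUm).aestronglyMeasurable
    simp only [Function.comp_apply] at h1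
    rw [h1, ← integral_truncated_sq_gaussianReal hδ, ← hlaw,
      integral_map hUm.aemeasurable (measurable_truncated_sq δ).aestronglyMeasurable]
  have hslope_le : ∀ a b : ℝ, |(a - y) / gapEnergy y δ a b| ≤ 1 := by
    intro a b
    rw [abs_div, abs_of_nonneg (gapEnergy_nonneg _ _ _ _)]
    refine div_le_one_of_le₀ (Real.abs_le_sqrt ?_) (gapEnergy_nonneg _ _ _ _)
    nlinarith [sq_nonneg (max |b - a| δ)]
  have hmart_int :
      Integrable (fun ω => (X₁ t ω - y) / gapEnergy y δ (X₁ t ω) (X₂ t ω) * U ω) P := by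
    refine hUint.abs.mono' ((hslope.comp hXm).mul hUm).aestronglyMeasurable
      (ae_of_all _ fun ω => ?_)
    rw [Real.norm_eq_abs, abs_mul]
    exact mul_le_of_le_one_left (abs_nonneg _) (hslope_le _ _)
  have hgain_int : Integrable (fun ω => gapKernel y δ (X₁ t ω) (X₂ t ω)
      * (if |U ω| ≤ δ then U ω ^ 2 else 0) / 10) P := by
    refine Integrable.of_bound (((hkm.comp hXm).mul
      ((measurable_truncated_sq δ).comp hUm)).div_const 10).aestronglyMeasurable
      (1 / δ * δ ^ 2 / 10) (ae_of_all _ fun ω => ?_)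
    have h1 := gapKernel_mem (y := y) (x₁ := X₁ t ω) (x₂ := X₂ t ω) hδ
    have h2 := truncated_sq_mem δ (U ω)
    rw [Real.norm_eq_abs, abs_of_nonneg (by have := mul_nonneg h1.1 h2.1; positivity)]
    have := mul_le_mul h1.2 h2.2 h2.1 (by positivity)
    linarith
  set b : ℝ → Ω → ℝ := fun r ω => c * (3 + 2 * |X₁ r ω| + |X₂ r ω|) with hb
  have hbc : ∀ ω, Continuous fun r => b r ω := fun ω => by
    have := hp.cont₁ ω
    have := hp.cont₂ ω
    fun_prop
  have hbm : Measurable (Function.uncurry b) :=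
    measurable_uncurry_of_continuous_of_measurable hbc fun r => by
      have := hp.meas₁ r
      have := hp.meas₂ r
      fun_prop
  have hb_mom : ∀ r ∈ Set.Icc 0 S, Integrable (b r) P ∧ ∫ ω, |b r ω| ∂P ≤ c * (3 + 3 * K) := by
    intro r hr
    obtain ⟨i1, k1⟩ := hK₁ r hr
    obtain ⟨i2, k2⟩ := hK₂ r hr
    have j1 : Integrable (fun ω => 3 + 2 * |X₁ r ω|) P :=
      (integrable_const _).add (i1.abs.const_mul 2)
    refine ⟨(j1.add i2.abs).const_mul c, ?_⟩
    have habs : ∀ ω, |b r ω| = c * (3 + 2 * |X₁ r ω| + |X₂ r ω|) := fun ω =>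
      abs_of_nonneg (by positivity)
    simp_rw [habs]
    rw [integral_const_mul, integral_add j1 i2.abs,
      integral_add (integrable_const _) (i1.abs.const_mul 2), integral_const_mul]
    refine mul_le_mul_of_nonneg_left ?_ hc
    simp
    linarith
  have hbprod : Integrable (Function.uncurry b)
      ((volume.restrict (Set.Ioc t (t + δ ^ 2))).prod P) :=
    integrable_uncurry_of_moment_le hbm ((ae_restrict_mem measurableSet_Ioc).mono fun r hr =>
      hb_mom r ⟨ht.trans hr.1.le, hr.2.trans htS⟩)
  have herr : ∀ ω, 2 * |X₁ (t + δ ^ 2) ω - X₁ t ω - U ω| + |X₂ (t + δ ^ 2) ω - X₂ t ω - U ω|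
      ≤ ∫ r in Set.Ioc t (t + δ ^ 2), b r ω := by
    intro ω
    have h1 := hp.drift₁ ω t (t + δ ^ 2) ht htt
    have h2 := hp.drift₂ ω t (t + δ ^ 2) ht htt
    have c1 : Continuous fun r => c * (1 + |X₁ r ω|) := by have := hp.cont₁ ω; fun_prop
    have c2 : Continuous fun r => c * (1 + |X₂ r ω|) := by have := hp.cont₂ ω; fun_prop
    rw [← intervalIntegral.integral_of_le htt]
    have e : ∀ r, b r ω = 2 * (c * (1 + |X₁ r ω|)) + c * (1 + |X₂ r ω|) := fun r => by
      simp only [hb]; ring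
    simp_rw [e]
    rw [intervalIntegral.integral_add ((c1.const_mul 2).intervalIntegrable _ _)
      (c2.intervalIntegrable _ _), intervalIntegral.integral_const_mul]
    linarith
  have herr_int : Integrable (fun ω => ∫ r in Set.Ioc t (t + δ ^ 2), b r ω) P :=
    hbprod.integral_prod_right
  have herr_le : ∫ ω, (∫ r in Set.Ioc t (t + δ ^ 2), b r ω) ∂P ≤ δ ^ 2 * (c * (3 + 3 * K)) := by
    rw [← integral_integral_swap hbprod]
    have h1 : ∫ r in Set.Ioc t (t + δ ^ 2), ∫ ω, b r ω ∂P
        ≤ ∫ r in Set.Ioc t (t + δ ^ 2), c * (3 + 3 * K) := by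
      refine setIntegral_mono_on hbprod.integral_prod_left (integrable_const _)
        measurableSet_Ioc fun r hr => ?_
      obtain ⟨i1, k1⟩ := hb_mom r ⟨ht.trans hr.1.le, hr.2.trans htS⟩
      exact (integral_mono i1 i1.abs fun ω => le_abs_self _).trans k1
    refine h1.trans (le_of_eq ?_)
    simp [hδ2.le]
  have htmem : t ∈ Set.Icc 0 S := ⟨ht, htt.trans htS⟩
  have htmem' : t + δ ^ 2 ∈ Set.Icc 0 S := ⟨ht.trans htt, htS⟩
  have hfin := integral_mono (((hEint t htmem).add hmart_int).add hgain_int)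
    ((hEint _ htmem').add herr_int) fun ω =>
      (gapEnergy_step y (U ω) (X₁ t ω) (X₂ t ω) (X₁ (t + δ ^ 2) ω) (X₂ (t + δ ^ 2) ω) hδ).trans
        (add_le_add_right (herr ω) _)
  simp only [Pi.add_apply] at hfin
  rw [integral_add (f := fun ω => gapEnergy y δ (X₁ t ω) (X₂ t ω)
      + (X₁ t ω - y) / gapEnergy y δ (X₁ t ω) (X₂ t ω) * U ω)
      ((hEint t htmem).add hmart_int) hgain_int,
    integral_add (hEint t htmem) hmart_int, integral_add (hEint _ htmem') herr_int, hmart,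
    integral_div, hgain] at hfin
  linarith

/-- Occupation estimate, uniform in the level `y ∈ [-R, R]` and in the cutoff `δ ∈ (0, 1]`. -/
theorem IsDrivenPair.lintegral_gapKernel_le (hp : IsDrivenPair P α c x₁ x₂ W X₁ X₂) (hc : 0 ≤ c)
    {T K y δ R : ℝ} (hT : 0 ≤ T)
    (hK₁ : ∀ t ∈ Set.Icc 0 (T + 1), Integrable (X₁ t) P ∧ ∫ ω, |X₁ t ω| ∂P ≤ K)
    (hK₂ : ∀ t ∈ Set.Icc 0 (T + 1), Integrable (X₂ t) P ∧ ∫ ω, |X₂ t ω| ∂P ≤ K)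
    (hδ : 0 < δ) (hδ1 : δ ≤ 1) (hy : |y| ≤ R) :
    ∫⁻ t in Set.Icc 0 T, ∫⁻ ω, ENNReal.ofReal (gapKernel y δ (X₁ t ω) (X₂ t ω)) ∂P
      ≤ ENNReal.ofReal
        (10 / truncatedGaussianMoment * (3 * K + (R + 1) + T * (c * (3 + 3 * K)))) := by
  have hδ2 : 0 < δ ^ 2 := by positivity
  have hδ21 : δ ^ 2 ≤ 1 := by nlinarith
  set g : ℝ := truncatedGaussianMoment with hg
  have hg0 : 0 < g := truncatedGaussianMoment_pos
  set M : ℝ := 3 * K + (R + 1) with hM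
  set B : ℝ := c * (3 + 3 * K) with hB
  set m : ℝ → ℝ := fun t => ∫ ω, gapEnergy y δ (X₁ t ω) (X₂ t ω) ∂P with hm
  set p : ℝ → ℝ := fun t => ∫ ω, gapKernel y δ (X₁ t ω) (X₂ t ω) ∂P with hpdef
  have hX : Measurable fun q : ℝ × Ω => (X₁ q.1 q.2, X₂ q.1 q.2) :=
    (measurable_uncurry_of_continuous_of_measurable hp.cont₁ hp.meas₁).prodMk
      (measurable_uncurry_of_continuous_of_measurable hp.cont₂ hp.meas₂)
  have hkm : Measurable fun q : ℝ × ℝ => gapKernel y δ q.1 q.2 :=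
    (measurable_gapKernel δ).comp (measurable_const.prodMk measurable_id)
  have hmm : StronglyMeasurable m :=
    StronglyMeasurable.integral_prod_right
      (f := fun t ω => gapEnergy y δ (X₁ t ω) (X₂ t ω))
      ((continuous_gapEnergy y δ).measurable.comp hX).stronglyMeasurable
  have hpm : StronglyMeasurable p :=
    StronglyMeasurable.integral_prod_right
      (f := fun t ω => gapKernel y δ (X₁ t ω) (X₂ t ω)) (hkm.comp hX).stronglyMeasurable
  have hm0 : ∀ t, 0 ≤ m t := fun t => integral_nonneg fun ω => gapEnergy_nonneg _ _ _ _
  have hmM : ∀ t ∈ Set.Icc 0 (T + 1), m t ≤ M := by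
    intro t ht
    obtain ⟨i1, k1⟩ := hK₁ t ht
    obtain ⟨i2, k2⟩ := hK₂ t ht
    have j : Integrable (fun ω => 2 * |X₁ t ω| + |X₂ t ω|) P := (i1.abs.const_mul 2).add i2.abs
    have h1 : m t ≤ ∫ ω, (2 * |X₁ t ω| + |X₂ t ω| + (R + 1)) ∂P :=
      integral_mono_of_nonneg (ae_of_all _ fun ω => gapEnergy_nonneg _ _ _ _)
        (j.add (integrable_const _)) (ae_of_all _ fun ω => gapEnergy_le _ _ hδ.le hδ1 hy)
    rw [integral_add j (integrable_const _), integral_add (i1.abs.const_mul 2) i2.abs,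
      integral_const_mul] at h1
    simp only [integral_const, probReal_univ, one_smul] at h1
    linarith
  have hmint : ∀ a b, 0 ≤ a → a ≤ b → b ≤ T + 1 → IntervalIntegrable m volume a b := by
    intro a b ha hab hb
    rw [intervalIntegrable_iff_integrableOn_Ioc_of_le hab]
    refine Integrable.of_bound hmm.aestronglyMeasurable M
      ((ae_restrict_mem measurableSet_Ioc).mono fun t ht => ?_)
    rw [Real.norm_eq_abs, abs_of_nonneg (hm0 t)]
    exact hmM t ⟨ha.trans ht.1.le, ht.2.trans hb⟩
  have hk_int : ∀ t, Integrable (fun ω => gapKernel y δ (X₁ t ω) (X₂ t ω)) P := fun t => by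
    refine Integrable.of_bound
      (hkm.comp ((hp.meas₁ t).prodMk (hp.meas₂ t))).aestronglyMeasurable (1 / δ)
      (ae_of_all _ fun ω => ?_)
    rw [Real.norm_eq_abs, abs_of_nonneg (gapKernel_mem hδ).1]
    exact (gapKernel_mem hδ).2
  have hp0 : ∀ t, 0 ≤ p t := fun t => integral_nonneg fun ω => (gapKernel_mem hδ).1
  have hp1 : ∀ t, p t ≤ 1 / δ := fun t => by
    have := integral_mono (hk_int t) (integrable_const (1 / δ)) fun ω => (gapKernel_mem hδ).2
    simpa using this
  have hpint : IntegrableOn p (Set.Ioc 0 T) := by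
    refine Integrable.of_bound hpm.aestronglyMeasurable (1 / δ) (ae_of_all _ fun t => ?_)
    rw [Real.norm_eq_abs, abs_of_nonneg (hp0 t)]
    exact hp1 t
  have hpint' : IntervalIntegrable p volume 0 T :=
    (intervalIntegrable_iff_integrableOn_Ioc_of_le hT).2 hpint
  have hshift : IntervalIntegrable (fun t => m (t + δ ^ 2)) volume 0 T := by
    have := (hmint (δ ^ 2) (T + δ ^ 2) hδ2.le (by linarith) (by linarith)).comp_add_right (δ ^ 2)
    simpa using this
  have hstep : ∀ t ∈ Set.Icc 0 T,
      δ ^ 2 * (g / 10) * p t ≤ m (t + δ ^ 2) - m t + δ ^ 2 * B := fun t ht =>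
    hp.integral_gapEnergy_step hc hK₁ hK₂ hδ hδ1 hy ht.1 (by linarith [ht.2])
  have hmain := intervalIntegral.integral_mono_on hT (hpint'.const_mul (δ ^ 2 * (g / 10)))
    ((hshift.sub (hmint 0 T le_rfl hT (by linarith))).add
      (_root_.intervalIntegrable_const (c := δ ^ 2 * B))) hstep
  rw [intervalIntegral.integral_const_mul,
    intervalIntegral.integral_add (hshift.sub (hmint 0 T le_rfl hT (by linarith)))
      _root_.intervalIntegrable_const,
    intervalIntegral.integral_sub hshift (hmint 0 T le_rfl hT (by linarith)),
    intervalIntegral.integral_comp_add_right, intervalIntegral.integral_const] at hmain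
  have hsplit₁ := intervalIntegral.integral_add_adjacent_intervals
    (hmint 0 (δ ^ 2) le_rfl hδ2.le (by linarith))
    (hmint (δ ^ 2) (T + δ ^ 2) hδ2.le (by linarith) (by linarith))
  have hsplit₂ := intervalIntegral.integral_add_adjacent_intervals
    (hmint 0 T le_rfl hT (by linarith))
    (hmint T (T + δ ^ 2) hT (by linarith) (by linarith))
  have hlow : 0 ≤ ∫ t in (0 : ℝ)..δ ^ 2, m t :=
    intervalIntegral.integral_nonneg hδ2.le fun t _ => hm0 t
  have hupp : ∫ t in T..(T + δ ^ 2), m t ≤ δ ^ 2 * M := by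
    have := intervalIntegral.integral_mono_on (by linarith : T ≤ T + δ ^ 2)
      (hmint T (T + δ ^ 2) hT (by linarith) (by linarith))
      (_root_.intervalIntegrable_const (c := M)) fun t ht =>
        hmM t ⟨hT.trans ht.1, by linarith [ht.2]⟩
    simpa using this
  simp only [smul_eq_mul, zero_add, sub_zero] at hmain
  have hscaled : δ ^ 2 * (g / 10 * ∫ t in (0 : ℝ)..T, p t) ≤ δ ^ 2 * (M + T * B) := by
    linarith
  have hreal : ∫ t in (0 : ℝ)..T, p t ≤ 10 / g * (M + T * B) := by
    have h1 := le_of_mul_le_mul_left hscaled hδ2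
    have h2 := mul_le_mul_of_nonneg_left h1 (by positivity : 0 ≤ 10 / g)
    have h3 : 10 / g * (g / 10 * ∫ t in (0 : ℝ)..T, p t) = ∫ t in (0 : ℝ)..T, p t := by
      field_simp
    rwa [h3] at h2
  have hinner : ∀ t, ∫⁻ ω, ENNReal.ofReal (gapKernel y δ (X₁ t ω) (X₂ t ω)) ∂P
      = ENNReal.ofReal (p t) := fun t =>
    (ofReal_integral_eq_lintegral_ofReal (hk_int t)
      (ae_of_all _ fun ω => (gapKernel_mem hδ).1)).symm
  simp_rw [hinner]
  rw [setLIntegral_congr Ioc_ae_eq_Icc.symm,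
    ← ofReal_integral_eq_lintegral_ofReal hpint (ae_of_all _ hp0),
    ← intervalIntegral.integral_of_le hT]
  exact ENNReal.ofReal_le_ofReal hreal

/-- Integrated form of the occupation estimate against a finite measure carried by `[-R, R]`. -/
theorem IsDrivenPair.exists_lintegral_gapKernel_le (hp : IsDrivenPair P α c x₁ x₂ W X₁ X₂)
    (hc : 0 ≤ c) {T R : ℝ} (hT : 0 ≤ T) (μ : Measure ℝ) [IsFiniteMeasure μ]
    (hμ : ∀ᵐ y ∂μ, |y| ≤ R) :
    ∃ C : ℝ≥0∞, C ≠ ∞ ∧ ∀ δ, 0 < δ → δ ≤ 1 →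
      ∫⁻ ω, (∫⁻ t in Set.Icc 0 T,
        (∫⁻ y, ENNReal.ofReal (gapKernel y δ (X₁ t ω) (X₂ t ω)) ∂μ)) ∂P ≤ C := by
  obtain ⟨K₁, hK₁⟩ := exists_moment_bound hc hp.measW hp.meas₁ hp.contW hp.cont₁ hp.initW hp.init₁
    hp.law hp.drift₁ (T + 1)
  obtain ⟨K₂, hK₂⟩ := exists_moment_bound hc hp.measW hp.meas₂ hp.contW hp.cont₂ hp.initW hp.init₂
    hp.law hp.drift₂ (T + 1)
  set K := max K₁ K₂
  refine ⟨ENNReal.ofReal (10 / truncatedGaussianMoment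
    * (3 * K + (R + 1) + T * (c * (3 + 3 * K)))) * μ Set.univ,
    ENNReal.mul_ne_top ENNReal.ofReal_ne_top (measure_ne_top _ _), fun δ hδ hδ1 => ?_⟩
  have hX : Measurable fun q : ℝ × Ω => (X₁ q.1 q.2, X₂ q.1 q.2) :=
    (measurable_uncurry_of_continuous_of_measurable hp.cont₁ hp.meas₁).prodMk
      (measurable_uncurry_of_continuous_of_measurable hp.cont₂ hp.meas₂)
  have hF : Measurable fun q : (ℝ × Ω) × ℝ =>
      ENNReal.ofReal (gapKernel q.2 δ (X₁ q.1.1 q.1.2) (X₂ q.1.1 q.1.2)) :=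
    ((measurable_gapKernel δ).comp
      (measurable_snd.prodMk (hX.comp measurable_fst))).ennreal_ofReal
  have hFy : Measurable fun q : ℝ × Ω =>
      ∫⁻ y, ENNReal.ofReal (gapKernel y δ (X₁ q.1 q.2) (X₂ q.1 q.2)) ∂μ :=
    hF.lintegral_prod_right'
  have hFω : Measurable fun q : ℝ × ℝ =>
      ∫⁻ ω, ENNReal.ofReal (gapKernel q.2 δ (X₁ q.1 ω) (X₂ q.1 ω)) ∂P :=
    Measurable.lintegral_prod_right' (f := fun q : (ℝ × ℝ) × Ω =>
      ENNReal.ofReal (gapKernel q.1.2 δ (X₁ q.1.1 q.2) (X₂ q.1.1 q.2)))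
      (hF.comp (by fun_prop : Measurable fun q : (ℝ × ℝ) × Ω => ((q.1.1, q.2), q.1.2)))
  rw [lintegral_lintegral_swap
    (f := fun ω t => ∫⁻ y, ENNReal.ofReal (gapKernel y δ (X₁ t ω) (X₂ t ω)) ∂μ)
    (hFy.comp measurable_swap).aemeasurable]
  have hswap : ∀ t, ∫⁻ ω, (∫⁻ y, ENNReal.ofReal (gapKernel y δ (X₁ t ω) (X₂ t ω)) ∂μ) ∂P
      = ∫⁻ y, (∫⁻ ω, ENNReal.ofReal (gapKernel y δ (X₁ t ω) (X₂ t ω)) ∂P) ∂μ := fun t =>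
    lintegral_lintegral_swap
      (f := fun ω y => ENNReal.ofReal (gapKernel y δ (X₁ t ω) (X₂ t ω)))
      (hF.comp (by fun_prop : Measurable fun q : Ω × ℝ => ((t, q.1), q.2))).aemeasurable
  simp_rw [hswap]
  rw [lintegral_lintegral_swap
    (f := fun t y => ∫⁻ ω, ENNReal.ofReal (gapKernel y δ (X₁ t ω) (X₂ t ω)) ∂P)
    hFω.aemeasurable, ← lintegral_const]
  refine lintegral_mono_ae (hμ.mono fun y hy => ?_)
  exact hp.lintegral_gapKernel_le hc hT
    (fun t ht => ⟨(hK₁ t ht).1, (hK₁ t ht).2.trans (le_max_left _ _)⟩)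
    (fun t ht => ⟨(hK₂ t ht).1, (hK₂ t ht).2.trans (le_max_right _ _)⟩) hδ hδ1 hy

/-- The singular functional `∫ (α (X₂) - α (X₁)) / (X₂ - X₁) dt` is dominated by an almost surely
finite one. -/
theorem IsDrivenPair.ae_lintegral_liminf_ne_top (hp : IsDrivenPair P α c x₁ x₂ W X₁ X₂)
    (hc : 0 ≤ c) {T R : ℝ} (hT : 0 ≤ T) (μ : Measure ℝ) [IsFiniteMeasure μ]
    (hμ : ∀ᵐ y ∂μ, |y| ≤ R) :
    ∀ᵐ ω ∂P, ∫⁻ t in Set.Icc 0 T, liminf (fun n : ℕ =>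
      ∫⁻ y, ENNReal.ofReal (gapKernel y (1 / ((n : ℝ) + 1)) (X₁ t ω) (X₂ t ω)) ∂μ) atTop ≠ ∞ := by
  obtain ⟨C, hC, hle⟩ := hp.exists_lintegral_gapKernel_le hc hT μ hμ
  have hX : Measurable fun q : Ω × ℝ => (X₁ q.2 q.1, X₂ q.2 q.1) :=
    ((measurable_uncurry_of_continuous_of_measurable hp.cont₁ hp.meas₁).prodMk
      (measurable_uncurry_of_continuous_of_measurable hp.cont₂ hp.meas₂)).comp measurable_swap
  have hG : ∀ n : ℕ, Measurable fun q : Ω × ℝ =>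
      ∫⁻ y, ENNReal.ofReal (gapKernel y (1 / ((n : ℝ) + 1)) (X₁ q.2 q.1) (X₂ q.2 q.1)) ∂μ :=
    fun n => Measurable.lintegral_prod_right' (f := fun q : (Ω × ℝ) × ℝ =>
      ENNReal.ofReal (gapKernel q.2 (1 / ((n : ℝ) + 1)) (X₁ q.1.2 q.1.1) (X₂ q.1.2 q.1.1)))
      ((measurable_gapKernel _).comp
        (measurable_snd.prodMk (hX.comp measurable_fst))).ennreal_ofReal
  have hGω : ∀ n : ℕ, Measurable fun ω => ∫⁻ t in Set.Icc 0 T,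
      ∫⁻ y, ENNReal.ofReal (gapKernel y (1 / ((n : ℝ) + 1)) (X₁ t ω) (X₂ t ω)) ∂μ :=
    fun n => (hG n).lintegral_prod_right'
  have hfatou : ∫⁻ ω, liminf (fun n : ℕ => ∫⁻ t in Set.Icc 0 T,
      ∫⁻ y, ENNReal.ofReal (gapKernel y (1 / ((n : ℝ) + 1)) (X₁ t ω) (X₂ t ω)) ∂μ) atTop ∂P
        ≤ C := by
    refine (lintegral_liminf_le hGω).trans ?_
    refine (liminf_le_liminf (v := fun _ => C) (Eventually.of_forall fun n => ?_)).trans_eq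
      (liminf_const C)
    refine hle _ (by positivity) ?_
    rw [div_le_one (by positivity)]
    have := n.cast_nonneg (α := ℝ)
    linarith
  have hae := ae_lt_top (Measurable.liminf hGω) (hfatou.trans_lt hC.lt_top).ne
  filter_upwards [hae] with ω hω
  exact ((lintegral_liminf_le fun n => (hG n).comp measurable_prodMk_left).trans_lt hω).ne

end Energy

/-- A function of locally bounded variation is measurable. -/
theorem LocallyBoundedVariationOn.measurable {α : ℝ → ℝ}
    (hα : LocallyBoundedVariationOn α Set.univ) : Measurable α := by
  obtain ⟨p, q, hp, hq, rfl⟩ := hα.exists_monotoneOn_sub_monotoneOn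
  exact (monotoneOn_univ.1 hp).measurable.sub (monotoneOn_univ.1 hq).measurable

/-- The increments of a function of locally bounded variation over subintervals of `[-R, R]` are
dominated by a finite measure carried by `[-R, R]`. -/
theorem LocallyBoundedVariationOn.exists_measure_uIcc_ge {α : ℝ → ℝ}
    (hα : LocallyBoundedVariationOn α Set.univ) (R : ℝ) :
    ∃ μ : Measure ℝ, IsFiniteMeasure μ ∧ (∀ᵐ y ∂μ, |y| ≤ R) ∧
      ∀ a b, |a| ≤ R → |b| ≤ R → ENNReal.ofReal |α b - α a| ≤ μ (Set.uIcc a b) := by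
  obtain ⟨p, q, hp, hq, rfl⟩ := hα.exists_monotoneOn_sub_monotoneOn
  rw [monotoneOn_univ] at hp hq
  have hV : Monotone (p + q) := hp.add hq
  refine ⟨hV.stieltjesFunction.measure.restrict (Set.Icc (-R) R), ?_, ?_, ?_⟩
  · exact ⟨by rw [Measure.restrict_apply_univ]; exact isCompact_Icc.measure_lt_top⟩
  · exact (ae_restrict_mem measurableSet_Icc).mono fun y hy => abs_le.2 hy
  have key : ∀ a b, a ≤ b → |a| ≤ R → |b| ≤ R →
      ENNReal.ofReal |(p - q) b - (p - q) a|
        ≤ hV.stieltjesFunction.measure.restrict (Set.Icc (-R) R) (Set.Icc a b) := by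
    intro a b hab ha hb
    rw [Measure.restrict_apply measurableSet_Icc, Set.inter_eq_left.2
      (Set.Icc_subset_Icc (abs_le.1 ha).1 (abs_le.1 hb).2), StieltjesFunction.measure_Icc]
    refine ENNReal.ofReal_le_ofReal ?_
    have h1 : (p + q) b ≤ hV.stieltjesFunction b := hV.le_rightLim le_rfl
    have h2 : Function.leftLim hV.stieltjesFunction a ≤ (p + q) a := by
      refine le_of_tendsto (hV.stieltjesFunction.mono.tendsto_leftLim a) ?_
      filter_upwards [self_mem_nhdsWithin] with z hz
      exact hV.rightLim_le hz
    have h3 := hp hab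
    have h4 := hq hab
    simp only [Pi.add_apply, Pi.sub_apply] at *
    rw [abs_le]
    constructor <;> linarith
  intro a b ha hb
  rcases le_total a b with h | h
  · rw [Set.uIcc_of_le h]
    exact key a b h ha hb
  · rw [Set.uIcc_of_ge h, abs_sub_comm]
    exact key b a h hb ha

/-- The increments of `α` are dominated by the limiting gap kernel times the gap. -/
theorem ofReal_abs_sub_le_liminf_gapKernel {α : ℝ → ℝ} {R : ℝ} {μ : Measure ℝ}
    (hμ : ∀ a b, |a| ≤ R → |b| ≤ R → ENNReal.ofReal |α b - α a| ≤ μ (Set.uIcc a b))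
    {a b : ℝ} (ha : |a| ≤ R) (hb : |b| ≤ R) :
    ENNReal.ofReal |α b - α a| ≤ liminf (fun n : ℕ =>
      ∫⁻ y, ENNReal.ofReal (gapKernel y (1 / ((n : ℝ) + 1)) a b) ∂μ) atTop
        * ENNReal.ofReal |b - a| := by
  rcases eq_or_ne a b with rfl | hab
  · simp
  have hD : 0 < |b - a| := abs_pos.2 (sub_ne_zero.2 hab.symm)
  have hle : ENNReal.ofReal |α b - α a| / ENNReal.ofReal |b - a| ≤ liminf (fun n : ℕ =>
      ∫⁻ y, ENNReal.ofReal (gapKernel y (1 / ((n : ℝ) + 1)) a b) ∂μ) atTop := by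
    refine le_liminf_of_le (by isBoundedDefault) ?_
    filter_upwards [(tendsto_one_div_add_atTop_nhds_zero_nat (𝕜 := ℝ)).eventually_lt_const hD]
      with n hn
    calc ENNReal.ofReal |α b - α a| / ENNReal.ofReal |b - a|
        ≤ μ (Set.uIcc a b) / ENNReal.ofReal |b - a| := ENNReal.div_le_div_right (hμ a b ha hb) _
      _ = ∫⁻ y, (Set.uIcc a b).indicator (fun _ => (ENNReal.ofReal |b - a|)⁻¹) y ∂μ := by
        rw [lintegral_indicator_const measurableSet_uIcc, mul_comm, div_eq_mul_inv]
      _ ≤ _ := by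
        refine lintegral_mono (Set.indicator_le fun y hy => ?_)
        have h1 : |a - y| ≤ |b - a| := by
          rw [abs_sub_comm]
          exact Set.abs_sub_left_of_mem_uIcc hy
        rw [gapKernel, max_eq_left hn.le, if_pos h1, one_div, ENNReal.ofReal_inv_of_pos hD]
  exact (ENNReal.div_le_iff (by simpa using hD.ne') ENNReal.ofReal_ne_top).1 hle

/-- A driven pair with a coefficient of locally bounded variation does not coalesce. -/
theorem IsDrivenPair.ae_forall_ne {Ω : Type*} [MeasurableSpace Ω] {P : Measure Ω}
    [IsProbabilityMeasure P] {α : ℝ → ℝ} {c x₁ x₂ : ℝ} {W X₁ X₂ : ℝ → Ω → ℝ}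
    (hp : IsDrivenPair P α c x₁ x₂ W X₁ X₂) (hc : 0 ≤ c)
    (hα : LocallyBoundedVariationOn α Set.univ) (hx : x₁ ≠ x₂) :
    ∀ᵐ ω ∂P, ∀ t, 0 ≤ t → X₁ t ω ≠ X₂ t ω := by
  choose μ hfin hsupp hμ using fun R : ℕ => hα.exists_measure_uIcc_ge (R : ℝ)
  have hae : ∀ᵐ ω ∂P, ∀ T R : ℕ, ∫⁻ t in Set.Icc (0 : ℝ) T, liminf (fun n : ℕ =>
      ∫⁻ y, ENNReal.ofReal (gapKernel y (1 / ((n : ℝ) + 1)) (X₁ t ω) (X₂ t ω)) ∂(μ R)) atTop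
        ≠ ∞ :=
    ae_all_iff.2 fun T => ae_all_iff.2 fun R =>
      hp.ae_lintegral_liminf_ne_top hc (Nat.cast_nonneg T) (μ R) (hsupp R)
  filter_upwards [hae] with ω hω t ht
  obtain ⟨T, hT⟩ := exists_nat_ge t
  obtain ⟨R₁, hR₁⟩ := isCompact_Icc.exists_bound_of_continuousOn
    (hp.cont₁ ω).continuousOn (s := Set.Icc (0 : ℝ) T)
  obtain ⟨R₂, hR₂⟩ := isCompact_Icc.exists_bound_of_continuousOn
    (hp.cont₂ ω).continuousOn (s := Set.Icc (0 : ℝ) T)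
  obtain ⟨R, hR⟩ := exists_nat_ge (max R₁ R₂)
  have h := ne_zero_of_abs_sub_le_lintegral (D := fun t => X₂ t ω - X₁ t ω)
    ((hp.cont₂ ω).sub (hp.cont₁ ω)) (hω T R) (fun s r hs hsr hr => ?_)
    (by rw [hp.init₁, hp.init₂]; exact sub_ne_zero.2 hx.symm) t ⟨ht, hT⟩
  · exact fun he => h (by rw [he, sub_self])
  · refine (hp.diff ω s r hs hsr).trans (setLIntegral_mono' measurableSet_Icc fun u hu => ?_)
    have hu' : u ∈ Set.Icc (0 : ℝ) T := ⟨hs.trans hu.1, hu.2.trans hr⟩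
    exact ofReal_abs_sub_le_liminf_gapKernel (hμ R)
      ((hR₁ u hu').trans ((le_max_left _ _).trans hR))
      ((hR₂ u hu').trans ((le_max_right _ _).trans hR))

theorem CondA.locallyBoundedVariationOn {α : ℝ → ℝ} (hA : CondA α) :
    LocallyBoundedVariationOn α Set.univ := fun a b _ _ => by
  simpa [BoundedVariationOn] using hA a b

theorem CondB.exists_abs_le {α : ℝ → ℝ} (hB : CondB α) :
    ∃ c, 0 ≤ c ∧ ∀ x, |α x| ≤ c * (1 + |x|) := by
  obtain ⟨C, hC, h⟩ := hB
  refine ⟨√C, Real.sqrt_nonneg C, fun x => abs_le_of_sq_le_sq ?_ (by positivity)⟩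
  rw [mul_pow, Real.sq_sqrt hC.le]
  refine (sq_abs (α x) ▸ h x).trans (mul_le_mul_of_nonneg_left ?_ hC.le)
  nlinarith [abs_nonneg x]

section Path

variable {α : ℝ → ℝ} {c : ℝ} {Y : ℝ → ℝ}

theorem intervalIntegrable_comp_of_linear_growth (hα : Measurable α)
    (hαc : ∀ x, |α x| ≤ c * (1 + |x|)) (hY : Continuous Y) (s t : ℝ) :
    IntervalIntegrable (fun r => α (Y r)) volume s t := by
  have h : IntervalIntegrable (fun r => c * (1 + |Y r|)) volume s t :=
    Continuous.intervalIntegrable (by fun_prop) s t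
  exact h.mono_fun' (hα.comp hY.measurable).aestronglyMeasurable
    (Eventually.of_forall fun r => hαc (Y r))

variable {x : ℝ} {X w : ℝ → ℝ}

/-- The increments of the extension by a constant to negative times of a solution path. -/
theorem sub_sub_eq_integral_of_solution (hα : Measurable α) (hαc : ∀ x, |α x| ≤ c * (1 + |x|))
    (hX : Continuous fun t => X (max t 0))
    (hsde : ∀ t, 0 ≤ t → X t = x + (∫ s in (0 : ℝ)..t, α (X s)) + w t)
    {s t : ℝ} (hs : 0 ≤ s) (hst : s ≤ t) :
    X (max t 0) - X (max s 0) - (w t - w s) = ∫ r in s..t, α (X (max r 0)) := by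
  have h : ∀ t, 0 ≤ t → X (max t 0) = x + (∫ s in (0 : ℝ)..t, α (X (max s 0))) + w t := by
    intro t ht
    rw [max_eq_left ht, hsde t ht]
    congr 2
    refine intervalIntegral.integral_congr fun r hr => ?_
    rw [Set.uIcc_of_le ht] at hr
    simp only [max_eq_left hr.1]
  rw [h t (hs.trans hst), h s hs, ← intervalIntegral.integral_interval_sub_left
    (intervalIntegrable_comp_of_linear_growth hα hαc hX 0 t)
    (intervalIntegrable_comp_of_linear_growth hα hαc hX 0 s)]
  ring

end Path

/-- Two solutions of the equation driven by the same Wiener process form, after modification on a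
null set and extension to negative times, a driven pair. -/
theorem exists_isDrivenPair {Ω : Type*} [MeasureSpace Ω] {w : ℝ → Ω → ℝ} (hw : IsWiener w)
    {α : ℝ → ℝ} {c x₁ x₂ : ℝ} {φ₁ φ₂ : ℝ → Ω → ℝ} (h₁ : IsStrongSolution α w x₁ φ₁)
    (h₂ : IsStrongSolution α w x₂ φ₂) (hα : Measurable α) (hc : 0 ≤ c)
    (hαc : ∀ x, |α x| ≤ c * (1 + |x|)) :
    ∃ W X₁ X₂ : ℝ → Ω → ℝ, IsDrivenPair ℙ α c x₁ x₂ W X₁ X₂ ∧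
      ∀ᵐ ω ∂(ℙ : Measure Ω), ∀ t, 0 ≤ t → φ₁ t ω = X₁ t ω ∧ φ₂ t ω = X₂ t ω := by
  classical
  have hnat : ∀ t, natSigma w t ≤ (inferInstance : MeasurableSpace Ω) := fun t =>
    iSup₂_le fun s _ => (hw.meas s).comap_le
  have hgood : ∀ᵐ ω ∂(ℙ : Measure Ω), w 0 ω = 0 ∧ (Continuous fun t => w t ω) ∧
      (ContinuousOn (fun t => φ₁ t ω) (Set.Ici 0) ∧ ∀ t : ℝ, 0 ≤ t →
        φ₁ t ω = x₁ + (∫ s in (0:ℝ)..t, α (φ₁ s ω)) + w t ω) ∧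
      (ContinuousOn (fun t => φ₂ t ω) (Set.Ici 0) ∧ ∀ t : ℝ, 0 ≤ t →
        φ₂ t ω = x₂ + (∫ s in (0:ℝ)..t, α (φ₂ s ω)) + w t ω) := by
    filter_upwards [hw.init, hw.cont, h₁.cont, h₁.sde, h₂.cont, h₂.sde] with ω a b c d e f
    exact ⟨a, b, ⟨c, d⟩, e, f⟩
  obtain ⟨N, hsub, hNm, hN⟩ := exists_measurable_superset_of_null (ae_iff.1 hgood)
  have hNae : ∀ᵐ ω ∂(ℙ : Measure Ω), ω ∉ N := measure_eq_zero_iff_ae_notMem.1 hN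
  have hg := fun ω (hω : ω ∉ N) => not_not.1 fun h => hω (hsub h)
  have hmax : ∀ {f : ℝ → ℝ}, ContinuousOn f (Set.Ici 0) → Continuous fun t => f (max t 0) :=
    fun {f} hf => hf.comp_continuous (by fun_prop) fun t => le_max_right t 0
  have hnonneg : ∀ y s t : ℝ, s ≤ t → 0 ≤ ∫ r in s..t, c * (1 + |y|) := fun y s t hst =>
    intervalIntegral.integral_nonneg hst fun _ _ => by positivity
  set W : ℝ → Ω → ℝ := fun t ω => if ω ∈ N then 0 else w t ω with hWdef
  set X₁ : ℝ → Ω → ℝ := fun t ω => if ω ∈ N then x₁ else φ₁ (max t 0) ω with hX₁def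
  set X₂ : ℝ → Ω → ℝ := fun t ω => if ω ∈ N then x₂ else φ₂ (max t 0) ω with hX₂def
  have hWae : ∀ s t, (fun ω => w t ω - w s ω) =ᵐ[ℙ] fun ω => W t ω - W s ω := fun s t => by
    filter_upwards [hNae] with ω hω
    simp only [hWdef, if_neg hω]
  have hdrift : ∀ {x : ℝ} {X : ℝ → ℝ} {ω : Ω}, (ContinuousOn X (Set.Ici 0) ∧
      ∀ t : ℝ, 0 ≤ t → X t = x + (∫ s in (0:ℝ)..t, α (X s)) + w t ω) → ∀ s t, 0 ≤ s → s ≤ t →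
        |X (max t 0) - X (max s 0) - (w t ω - w s ω)| ≤ ∫ r in s..t, c * (1 + |X (max r 0)|) := by
    intro x X ω hX s t hs hst
    rw [sub_sub_eq_integral_of_solution (w := fun t => w t ω) hα hαc (hmax hX.1) hX.2 hs hst]
    have hcont := hmax hX.1
    have hint : IntervalIntegrable (fun r => c * (1 + |X (max r 0)|)) volume s t :=
      ((hcont.abs.const_add 1).const_mul c).intervalIntegrable s t
    rw [← Real.norm_eq_abs]
    exact intervalIntegral.norm_integral_le_of_norm_le hst
      (Eventually.of_forall fun r _ => hαc (X (max r 0))) hint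
  refine ⟨W, X₁, X₂, ?_, ?_⟩
  · refine
      { measW := fun t => Measurable.ite hNm measurable_const (hw.meas t)
        meas₁ := fun t => Measurable.ite hNm measurable_const
          ((h₁.adapted _ (le_max_right t 0)).mono (hnat _) le_rfl)
        meas₂ := fun t => Measurable.ite hNm measurable_const
          ((h₂.adapted _ (le_max_right t 0)).mono (hnat _) le_rfl)
        contW := fun ω => ?_
        cont₁ := fun ω => ?_
        cont₂ := fun ω => ?_
        initW := fun ω => ?_
        init₁ := fun ω => ?_
        init₂ := fun ω => ?_
        law := fun s t hs hst => ?_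
        indep := fun s t hs hst => ?_
        drift₁ := fun ω s t hs hst => ?_
        drift₂ := fun ω s t hs hst => ?_
        diff := fun ω s t hs hst => ?_ }
    · by_cases hω : ω ∈ N
      · simpa only [hWdef, if_pos hω] using continuous_const
      · simpa only [hWdef, if_neg hω] using (hg ω hω).2.1
    · by_cases hω : ω ∈ N
      · simpa only [hX₁def, if_pos hω] using continuous_const
      · simpa only [hX₁def, if_neg hω] using hmax (hg ω hω).2.2.1.1
    · by_cases hω : ω ∈ N
      · simpa only [hX₂def, if_pos hω] using continuous_const
      · simpa only [hX₂def, if_neg hω] using hmax (hg ω hω).2.2.2.1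
    · by_cases hω : ω ∈ N
      · simp only [hWdef, if_pos hω]
      · simp only [hWdef, if_neg hω, (hg ω hω).1]
    · by_cases hω : ω ∈ N
      · simp only [hX₁def, if_pos hω]
      · simp only [hX₁def, if_neg hω, max_self, h₁.init]
    · by_cases hω : ω ∈ N
      · simp only [hX₂def, if_pos hω]
      · simp only [hX₂def, if_neg hω, max_self, h₂.init]
    · rw [← hw.gauss s t hs hst]
      exact (Measure.map_congr (hWae s t)).symm
    · have hpair : Measurable[natSigma w s] fun ω => (φ₁ s ω, φ₂ s ω) :=
        (h₁.adapted s hs).prodMk (h₂.adapted s hs)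
      have hind : IndepFun (fun ω => w t ω - w s ω) (fun ω => (φ₁ s ω, φ₂ s ω)) ℙ :=
        (IndepFun_iff_Indep _ _ _).2 (indep_of_indep_of_le_right (hw.indep s t hs hst)
          hpair.comap_le)
      refine hind.congr (hWae s t) ?_
      filter_upwards [hNae] with ω hω
      simp only [hX₁def, hX₂def, if_neg hω, max_eq_left hs]
    · by_cases hω : ω ∈ N
      · simpa only [hWdef, hX₁def, if_pos hω, sub_self, abs_zero] using hnonneg x₁ s t hst
      · simpa only [hWdef, hX₁def, if_neg hω] using hdrift (hg ω hω).2.2.1 s t hs hst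
    · by_cases hω : ω ∈ N
      · simpa only [hWdef, hX₂def, if_pos hω, sub_self, abs_zero] using hnonneg x₂ s t hst
      · simpa only [hWdef, hX₂def, if_neg hω] using hdrift (hg ω hω).2.2.2 s t hs hst
    · by_cases hω : ω ∈ N
      · simp only [hX₁def, hX₂def, if_pos hω, sub_self, abs_zero, ENNReal.ofReal_zero, zero_le]
      · simp only [hX₁def, hX₂def, if_neg hω]
        obtain ⟨-, -, ⟨hc₁, hs₁⟩, hc₂, hs₂⟩ := hg ω hω
        have e₁ := sub_sub_eq_integral_of_solution (X := fun t => φ₁ t ω) (w := fun t => w t ω)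
          hα hαc (hmax hc₁) hs₁ hs hst
        have e₂ := sub_sub_eq_integral_of_solution (X := fun t => φ₂ t ω) (w := fun t => w t ω)
          hα hαc (hmax hc₂) hs₂ hs hst
        have e : (φ₂ (max t 0) ω - φ₁ (max t 0) ω) - (φ₂ (max s 0) ω - φ₁ (max s 0) ω)
            = ∫ r in Set.Ioc s t, (α (φ₂ (max r 0) ω) - α (φ₁ (max r 0) ω)) := by
          rw [← intervalIntegral.integral_of_le hst, intervalIntegral.integral_sub
            (intervalIntegrable_comp_of_linear_growth hα hαc (hmax hc₂) s t)
            (intervalIntegrable_comp_of_linear_growth hα hαc (hmax hc₁) s t), ← e₁, ← e₂]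
          ring
        rw [e, ← Real.enorm_eq_ofReal_abs]
        refine (enorm_integral_le_lintegral_enorm _).trans ?_
        simp_rw [Real.enorm_eq_ofReal_abs]
        exact lintegral_mono_set Set.Ioc_subset_Icc_self
  · filter_upwards [hNae] with ω hω t ht
    simp only [hX₁def, hX₂def, if_neg hω, max_eq_left ht, and_self]

/-- Under conditions (A) and (B), solutions started at distinct points
(and driven by the same Wiener process) never meet: for `x₁ ≠ x₂`,
`P{φ_t(x₁) ≠ φ_t(x₂) for all t ≥ 0} = 1`. -/
theorem no_coalescence
    {Ω : Type*} [MeasureSpace Ω] (w : ℝ → Ω → ℝ) (hw : IsWiener w)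
    (α : ℝ → ℝ) (hA : CondA α) (hB : CondB α)
    (φ : ℝ → ℝ → Ω → ℝ) (hφ : ∀ x : ℝ, IsStrongSolution α w x (fun s => φ s x))
    (x₁ x₂ : ℝ) (hx : x₁ ≠ x₂) :
    ∀ᵐ ω ∂(ℙ : Measure Ω), ∀ t : ℝ, 0 ≤ t → φ t x₁ ω ≠ φ t x₂ ω := by
  have := hw.isProb
  obtain ⟨c, hc, hαc⟩ := hB.exists_abs_le
  obtain ⟨W, X₁, X₂, hp, heq⟩ := exists_isDrivenPair hw (hφ x₁) (hφ x₂)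
    hA.locallyBoundedVariationOn.measurable hc hαc
  filter_upwards [hp.ae_forall_ne hc hA.locallyBoundedVariationOn hx, heq] with ω hne he t ht
  rw [(he t ht).1, (he t ht).2]
  exact hne t ht

end
end
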